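/- arXiv:2011.08422 — 13 statements merged into one kernel-verified Lean document; each statement's English description precedes it below -/
import Mathlib

section
/- Let k ≥ 1 be an integer, let ε > 0, let V : ℝ → ℝ be a smooth function with V(x) = x^k for all |x| < ε, and let φ : ℝ × ℝ → ℝ be a smooth global flow of V, i.e. φ(0,x) = x, ∂φ/∂t(t,x) = V(φ(t,x)), and φ(s+t,x) = φ(t,φ(s,x)) for all s,t,x. Then for all smooth compactly supported functions f, g : ℝ × ℝ → ℂ, every integer j with 0 ≤ j ≤ k−1, and every t ∈ ℝ, the j-th partial derivative in x at x = 0 satisfies ∂_x^j (f*g)(0,t) = ∂_x^j (g*f)(0,t). (That is, the quotient of the smooth convolution algebra of the foliation F^k_ℝ by the ideal of functions vanishing to order p on the isotropy group of 0 is commutative whenever p ≤ k.) -/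
open MeasureTheory

/-- Convolution on the transformation groupoid `ℝ ⋊_φ ℝ`:
`(f * g)(x, t) = ∫ f(φ(s, x), t − s) · g(x, s) ds`. -/
noncomputable def groupoidConv (φ : ℝ × ℝ → ℝ) (f g : ℝ × ℝ → ℂ) : ℝ × ℝ → ℂ :=
  fun p => ∫ s : ℝ, f (φ (s, p.1), p.2 - s) * g (p.1, s)

open Set Filter Topology Asymptotics

theorem iteratedDeriv_eq_zero_of_isBigO_pow {E : Type*} [NormedAddCommGroup E] [NormedSpace ℝ E]
    {h : ℝ → E} {x₀ : ℝ} {n : ℕ} (hh : ContDiff ℝ n h)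
    (hO : h =O[𝓝 x₀] fun x => (x - x₀) ^ n) {j : ℕ} (hj : j < n) :
    iteratedDeriv j h x₀ = 0 := by
  induction j using Nat.strong_induction_on with
  | _ j ih =>
    have hpow : (fun x : ℝ => (x - x₀) ^ n) =o[𝓝 x₀] fun x => (x - x₀) ^ j := by
      have hsub : Tendsto (fun x : ℝ => x - x₀) (𝓝 x₀) (𝓝 0) :=
        tendsto_sub_nhds_zero_iff.mpr tendsto_id
      exact (isLittleO_pow_pow hj).comp_tendsto hsub
    have htaylor := taylor_isLittleO_univ (x₀ := x₀) (hh.of_le (by exact_mod_cast hj.le) :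
      ContDiff ℝ j h)
    have hlead : (fun x => ((j.factorial : ℝ)⁻¹ * (x - x₀) ^ j) • iteratedDeriv j h x₀)
        =o[𝓝 x₀] fun x => (x - x₀) ^ j := by
      refine ((hO.trans_isLittleO hpow).sub htaylor).congr_left fun x => ?_
      rw [sub_sub_cancel, taylor_within_apply, Finset.sum_range_succ, Finset.sum_eq_zero,
        zero_add, iteratedDerivWithin_univ]
      intro i hi
      have hi' := Finset.mem_range.mp hi
      rw [iteratedDerivWithin_univ, ih i hi' (hi'.trans hj), smul_zero]
    have hconst : (fun _ : ℝ => (j.factorial : ℝ)⁻¹ • iteratedDeriv j h x₀)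
        =o[𝓝[≠] x₀] fun _ => (1 : ℝ) := by
      have hinv := (isBigO_refl (fun x : ℝ => ((x - x₀) ^ j)⁻¹) (𝓝[≠] x₀)).smul_isLittleO
        (hlead.mono nhdsWithin_le_nhds)
      have hne : ∀ᶠ x in 𝓝[≠] x₀, (x - x₀) ^ j ≠ 0 := by
        filter_upwards [self_mem_nhdsWithin] with x hx
        exact pow_ne_zero _ (sub_ne_zero.mpr hx)
      refine hinv.congr' ?_ ?_
      · filter_upwards [hne] with x hx
        rw [smul_smul, mul_left_comm, inv_mul_cancel₀ hx, mul_one]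
      · filter_upwards [hne] with x hx
        exact inv_mul_cancel₀ hx
    have hzero := tendsto_nhds_unique tendsto_const_nhds ((isLittleO_one_iff ℝ).mp hconst)
    exact (smul_eq_zero.mp hzero).resolve_left (by positivity)

theorem ContDiff.integral_of_forall_notMem_eq_zero {P E : Type*}
    [NormedAddCommGroup P] [NormedSpace ℝ P] [NormedAddCommGroup E] [NormedSpace ℝ E]
    {n : ℕ∞} {F : P × ℝ → E} (hF : ContDiff ℝ n F) {K : Set ℝ} (hK : IsCompact K)
    (hFK : ∀ p, ∀ s ∉ K, F (p, s) = 0) :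
    ContDiff ℝ n fun p => ∫ s, F (p, s) := by
  have hconv := contDiffOn_convolution_right_with_param (μ := volume) (f := fun _ : ℝ => (1 : ℝ))
    (g := fun p s => F (p, -s)) (n := n) (ContinuousLinearMap.lsmul ℝ ℝ) isOpen_univ hK.neg
    (fun p s _ hs => hFK p _ fun h => hs (by simpa using h)) (locallyIntegrable_const 1)
    (hF.comp (contDiff_fst.prodMk contDiff_snd.neg)).contDiffOn
  rw [univ_prod_univ, contDiffOn_univ] at hconv
  simpa [convolution, Function.comp_def] using
    hconv.comp (contDiff_id.prodMk (contDiff_const (c := (0 : ℝ))))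

section Flow

variable {V : ℝ → ℝ} {φ : ℝ × ℝ → ℝ}

theorem fderiv_flow_apply_eq (hφ : Differentiable ℝ φ) (hφ0 : ∀ x : ℝ, φ (0, x) = x)
    (hφd : ∀ t x : ℝ, HasDerivAt (fun t' => φ (t', x)) (V (φ (t, x))) t)
    (hφflow : ∀ s t x : ℝ, φ (s + t, x) = φ (t, φ (s, x))) (t x : ℝ) :
    fderiv ℝ φ (t, x) (0, V x) = V (φ (t, x)) := by
  have hshift : HasDerivAt (fun s => φ (s + t, x)) (V (φ (t, x))) 0 := by
    have := hφd (0 + t) x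
    rw [zero_add] at this
    exact HasDerivAt.comp_add_const 0 t (by rwa [zero_add])
  have hinner : HasDerivAt (fun s => (t, φ (s, x))) ((0 : ℝ), V x) 0 := by
    have := hφd 0 x
    rw [hφ0] at this
    exact (hasDerivAt_const 0 t).prodMk this
  have hcomp : HasDerivAt (fun s => φ (t, φ (s, x))) (fderiv ℝ φ (t, x) (0, V x)) 0 := by
    refine HasFDerivAt.comp_hasDerivAt (l := φ) 0 ?_ hinner
    rw [hφ0]
    exact (hφ (t, x)).hasFDerivAt
  simp only [hφflow] at hshift
  exact hcomp.unique hshift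

theorem exists_abs_flow_sub_le (hφ : ContDiff ℝ 1 φ) (hφ0 : ∀ x : ℝ, φ (0, x) = x)
    (hφd : ∀ t x : ℝ, HasDerivAt (fun t' => φ (t', x)) (V (φ (t, x))) t)
    (hφflow : ∀ s t x : ℝ, φ (s + t, x) = φ (t, φ (s, x))) (R ε : ℝ) :
    ∃ C, ∀ s x : ℝ, |s| ≤ R → |x| ≤ ε → |φ (s, x) - x| ≤ C * |V x| := by
  obtain ⟨C, hC⟩ := ((isCompact_Icc (a := -R) (b := R)).prod
    (isCompact_Icc (a := -ε) (b := ε))).exists_bound_of_continuousOn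
      (hφ.continuous_fderiv one_ne_zero).continuousOn
  refine ⟨C * R, fun s x hs hx => ?_⟩
  have hR : 0 ≤ R := (abs_nonneg s).trans hs
  have hderiv : ∀ u ∈ Icc (-R) R, ‖V (φ (u, x))‖ ≤ C * |V x| := fun u hu => by
    rw [← fderiv_flow_apply_eq (hφ.differentiable one_ne_zero) hφ0 hφd hφflow]
    refine ContinuousLinearMap.le_of_opNorm_le_of_le _ (hC (u, x) ⟨hu, abs_le.mp hx⟩) ?_
    simp
  have hmean := Convex.norm_image_sub_le_of_norm_hasDerivWithin_le
    (fun u _ => (hφd u x).hasDerivWithinAt) hderiv (convex_Icc (-R) R)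
    (x := 0) (y := s) (by simpa using hR) (abs_le.mp hs)
  rw [hφ0, sub_zero, Real.norm_eq_abs, Real.norm_eq_abs] at hmean
  have hnonneg : 0 ≤ C * |V x| := (norm_nonneg _).trans (hderiv 0 (by simpa using hR))
  nlinarith

end Flow

theorem exists_forall_lt_abs_eq_zero {g : ℝ × ℝ → ℂ} (hg : HasCompactSupport g) :
    ∃ R : ℝ, ∀ x s : ℝ, R < |s| → g (x, s) = 0 := by
  obtain ⟨R, hR⟩ := hg.isCompact.isBounded.exists_norm_le
  refine ⟨R, fun x s hs => image_eq_zero_of_notMem_tsupport fun hmem => ?_⟩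
  exact absurd ((norm_snd_le (x, s)).trans (hR _ hmem)) (not_le.mpr hs)

theorem ContDiff.groupoidConv {n : ℕ∞} {φ : ℝ × ℝ → ℝ} {f g : ℝ × ℝ → ℂ} (hφ : ContDiff ℝ n φ)
    (hf : ContDiff ℝ n f) (hg : ContDiff ℝ n g) (hgs : HasCompactSupport g) (t : ℝ) :
    ContDiff ℝ n fun x => groupoidConv φ f g (x, t) := by
  obtain ⟨R, hR⟩ := exists_forall_lt_abs_eq_zero hgs
  refine ContDiff.integral_of_forall_notMem_eq_zero
    (F := fun p : ℝ × ℝ => f (φ (p.2, p.1), t - p.2) * g p) ?_ (isCompact_Icc (a := -R) (b := R)) ?_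
  · fun_prop
  · intro x s hs
    rw [mem_Icc, ← abs_le, not_le] at hs
    simp [hR x s hs]

theorem groupoidConv_snd_comm (f g : ℝ × ℝ → ℂ) :
    groupoidConv Prod.snd f g = groupoidConv Prod.snd g f := by
  ext ⟨x, t⟩
  rw [groupoidConv, ← integral_sub_left_eq_self _ volume t]
  simp [groupoidConv, mul_comm]

theorem groupoidConv_sub_groupoidConv_snd_isBigO {φ : ℝ × ℝ → ℝ} {f g : ℝ × ℝ → ℂ} {w : ℝ → ℝ}
    (hφ : Continuous φ) (hf : ContDiff ℝ 1 f) (hfs : HasCompactSupport f)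
    (hg : Continuous g) (hgs : HasCompactSupport g)
    (hφw : ∀ R : ℝ, ∃ C, ∀ᶠ x in 𝓝 0, ∀ s : ℝ, |s| ≤ R → |φ (s, x) - x| ≤ C * |w x|) (t : ℝ) :
    (fun x => groupoidConv φ f g (x, t) - groupoidConv Prod.snd f g (x, t)) =O[𝓝 0] w := by
  obtain ⟨R, hR⟩ := exists_forall_lt_abs_eq_zero hgs
  obtain ⟨L, hL⟩ := hf.lipschitzWith_of_hasCompactSupport hfs one_ne_zero
  obtain ⟨M, hM⟩ := hgs.exists_bound_of_continuous hg
  obtain ⟨C, hC⟩ := hφw R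
  have hsupp : ∀ x s : ℝ, s ∉ Icc (-R) R → g (x, s) = 0 := fun x s hs => by
    rw [mem_Icc, ← abs_le, not_le] at hs
    exact hR x s hs
  have hint : ∀ ψ : ℝ × ℝ → ℝ, Continuous ψ → ∀ x : ℝ,
      Integrable fun s => f (ψ (s, x), t - s) * g (x, s) := fun ψ hψ x =>
    Continuous.integrable_of_hasCompactSupport
      (by have := hf.continuous; fun_prop)
      (HasCompactSupport.intro (isCompact_Icc (a := -R) (b := R)) fun s hs => by
        simp [hsupp x s hs])
  refine IsBigO.of_bound (L * C * M * volume.real (Icc (-R) R)) ?_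
  filter_upwards [hC] with x hx
  simp only [groupoidConv]
  rw [← integral_sub (hint φ hφ x) (hint Prod.snd continuous_snd x),
    ← setIntegral_eq_integral_of_forall_compl_eq_zero (s := Icc (-R) R)
      fun s hs => by simp [hsupp x s hs]]
  refine (norm_setIntegral_le_of_norm_le_const (C := L * (C * |w x|) * M)
    measure_Icc_lt_top fun s hs => ?_).trans_eq (by rw [Real.norm_eq_abs]; ring)
  rw [← sub_mul, norm_mul]
  have hlip := hL.norm_sub_le (φ (s, x), t - s) (x, t - s)
  rw [Prod.mk_sub_mk, sub_self, Prod.norm_mk, norm_zero, max_eq_left (norm_nonneg _),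
    Real.norm_eq_abs] at hlip
  have hflow : L * |φ (s, x) - x| ≤ L * (C * |w x|) := by
    gcongr
    exact hx s (abs_le.mpr hs)
  exact mul_le_mul (hlip.trans hflow) (hM _) (norm_nonneg _)
    ((by positivity : (0 : ℝ) ≤ L * |φ (s, x) - x|).trans hflow)

/-- For the foliation `F^k_ℝ`, the quotient of the smooth convolution algebra by the ideal of
functions vanishing to order `p ≤ k` on the isotropy group of `0` is commutative: all
`x`-derivatives at `x = 0` of order `j ≤ k − 1` of `f * g` and `g * f` agree. -/
theorem statement0 (k : ℕ) (hk : 1 ≤ k) (ε : ℝ) (hε : 0 < ε)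
    (V : ℝ → ℝ) (hV : ContDiff ℝ (⊤ : ℕ∞) V)
    (hVeq : ∀ x : ℝ, |x| < ε → V x = x ^ k)
    (φ : ℝ × ℝ → ℝ) (hφ : ContDiff ℝ (⊤ : ℕ∞) φ)
    (hφ0 : ∀ x : ℝ, φ (0, x) = x)
    (hφd : ∀ t x : ℝ, HasDerivAt (fun t' => φ (t', x)) (V (φ (t, x))) t)
    (hφflow : ∀ s t x : ℝ, φ (s + t, x) = φ (t, φ (s, x))) :
    ∀ f g : ℝ × ℝ → ℂ,
      ContDiff ℝ (⊤ : ℕ∞) f → HasCompactSupport f →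
      ContDiff ℝ (⊤ : ℕ∞) g → HasCompactSupport g →
      ∀ j : ℕ, j ≤ k - 1 → ∀ t : ℝ,
        iteratedDeriv j (fun x => groupoidConv φ f g (x, t)) 0 =
          iteratedDeriv j (fun x => groupoidConv φ g f (x, t)) 0 := by
  intro f g hf hfs hg hgs j hj t
  have hφw : ∀ R : ℝ, ∃ C, ∀ᶠ x in 𝓝 0, ∀ s : ℝ, |s| ≤ R →
      |φ (s, x) - x| ≤ C * |(x - 0) ^ k| := fun R => by
    obtain ⟨C, hC⟩ := exists_abs_flow_sub_le (hφ.of_le (by simp)) hφ0 hφd hφflow R ε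
    refine ⟨C, ?_⟩
    filter_upwards [Metric.ball_mem_nhds (0 : ℝ) hε] with x hx s hs
    have hxε : |x| < ε := by simpa using hx
    simpa [hVeq x hxε] using hC s x hs hxε.le
  have key : ∀ f g : ℝ × ℝ → ℂ, ContDiff ℝ (⊤ : ℕ∞) f → HasCompactSupport f →
      ContDiff ℝ (⊤ : ℕ∞) g → HasCompactSupport g →
      iteratedDeriv j (fun x => groupoidConv φ f g (x, t)) 0 =
        iteratedDeriv j (fun x => groupoidConv Prod.snd f g (x, t)) 0 := by
    intro f g hf hfs hg hgs
    have hleft := hφ.groupoidConv hf hg hgs t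
    have hright := (contDiff_snd (𝕜 := ℝ) (E := ℝ) (F := ℝ)).groupoidConv hf hg hgs t
    have hle : ∀ m : ℕ, (m : WithTop ℕ∞) ≤ ((⊤ : ℕ∞) : WithTop ℕ∞) := fun m => by
      exact_mod_cast le_top
    rw [← sub_eq_zero, ← iteratedDeriv_fun_sub (hleft.of_le (hle j)).contDiffAt
      (hright.of_le (hle j)).contDiffAt]
    exact iteratedDeriv_eq_zero_of_isBigO_pow ((hleft.sub hright).of_le (hle k))
      (groupoidConv_sub_groupoidConv_snd_isBigO hφ.continuous (hf.of_le (by simp)) hfs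
        hg.continuous hgs hφw t) (by omega)
  rw [key f g hf hfs hg hgs, key g f hg hgs hf hfs, groupoidConv_snd_comm]
end

section
/- Let k ≥ 1 be an integer, let ε > 0, let V : ℝ → ℝ be a smooth function with V(x) = x^k for all |x| < ε, and let φ : ℝ × ℝ → ℝ be a smooth global flow of V (φ(0,x) = x, ∂φ/∂t(t,x) = V(φ(t,x)), φ(s+t,x) = φ(t,φ(s,x))). Then there exist smooth compactly supported functions f, g : ℝ × ℝ → ℂ and a real number t such that ∂_x^k (f*g)(0,t) ≠ ∂_x^k (g*f)(0,t). (That is, the quotient of the smooth convolution algebra of the foliation F^k_ℝ by the ideal of functions vanishing to order k+1 on the isotropy group of 0 is noncommutative.) -/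
open MeasureTheory

open Filter Topology Metric Set

/-- The directional derivative `p ↦ Dψ(p) v` of a function on the plane. -/
noncomputable def dirDeriv (v : ℝ × ℝ) (ψ : ℝ × ℝ → ℝ) : ℝ × ℝ → ℝ :=
  fun p => fderiv ℝ ψ p v

theorem contDiff_dirDeriv (v : ℝ × ℝ) {ψ : ℝ × ℝ → ℝ} (hψ : ContDiff ℝ (⊤ : ℕ∞) ψ) :
    ContDiff ℝ (⊤ : ℕ∞) (dirDeriv v ψ) :=
  (hψ.fderiv_right (m := ((⊤ : ℕ∞) : WithTop ℕ∞)) le_rfl).clm_apply contDiff_const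

theorem contDiff_iterate_dirDeriv (v : ℝ × ℝ) {ψ : ℝ × ℝ → ℝ} (hψ : ContDiff ℝ (⊤ : ℕ∞) ψ)
    (n : ℕ) : ContDiff ℝ (⊤ : ℕ∞) ((dirDeriv v)^[n] ψ) := by
  induction n with
  | zero => exact hψ
  | succ n ih =>
    rw [Function.iterate_succ_apply']
    exact contDiff_dirDeriv v ih

theorem dirDeriv_comm (v w : ℝ × ℝ) {ψ : ℝ × ℝ → ℝ} (hψ : ContDiff ℝ (⊤ : ℕ∞) ψ) :
    dirDeriv v (dirDeriv w ψ) = dirDeriv w (dirDeriv v ψ) := by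
  have hd : Differentiable ℝ (fderiv ℝ ψ) :=
    (hψ.fderiv_right (m := ((⊤ : ℕ∞) : WithTop ℕ∞)) le_rfl).differentiable (by simp)
  have key : ∀ (v w p : ℝ × ℝ), dirDeriv v (dirDeriv w ψ) p = fderiv ℝ (fderiv ℝ ψ) p v w := by
    intro v w p
    have := (hd p).hasFDerivAt.clm_apply (hasFDerivAt_const w p)
    unfold dirDeriv
    rw [this.fderiv]
    simp
  funext p
  rw [key, key]
  exact (hψ.contDiffAt.isSymmSndFDerivAt (by
    rw [minSmoothness_of_isRCLikeNormedField]
    exact WithTop.coe_le_coe.2 le_top)).eq v w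

theorem dirDeriv_iterate_comm (v w : ℝ × ℝ) {ψ : ℝ × ℝ → ℝ} (hψ : ContDiff ℝ (⊤ : ℕ∞) ψ)
    (n : ℕ) : dirDeriv v ((dirDeriv w)^[n] ψ) = (dirDeriv w)^[n] (dirDeriv v ψ) := by
  induction n with
  | zero => rfl
  | succ n ih =>
    rw [Function.iterate_succ_apply', Function.iterate_succ_apply',
      dirDeriv_comm v w (contDiff_iterate_dirDeriv w hψ n), ih]

theorem hasDerivAt_dirDeriv_fst {ψ : ℝ × ℝ → ℝ} (hψ : ContDiff ℝ (⊤ : ℕ∞) ψ) (s x : ℝ) :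
    HasDerivAt (fun r => ψ (r, x)) (dirDeriv (1, 0) ψ (s, x)) s :=
  (hψ.differentiable (by simp) (s, x)).hasFDerivAt.comp_hasDerivAt s
    ((hasDerivAt_id s).prodMk (hasDerivAt_const s x))

theorem hasDerivAt_dirDeriv_snd {ψ : ℝ × ℝ → ℝ} (hψ : ContDiff ℝ (⊤ : ℕ∞) ψ) (s x : ℝ) :
    HasDerivAt (fun y => ψ (s, y)) (dirDeriv (0, 1) ψ (s, x)) x :=
  (hψ.differentiable (by simp) (s, x)).hasFDerivAt.comp_hasDerivAt x
    ((hasDerivAt_const x s).prodMk (hasDerivAt_id x))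

theorem iteratedDeriv_eq_of_hasDerivAt {E : Type*} [NormedAddCommGroup E] [NormedSpace ℝ E]
    {h : ℕ → ℝ → E} (hh : ∀ j x, HasDerivAt (h j) (h (j + 1) x) x) (n : ℕ) :
    iteratedDeriv n (h 0) = h n := by
  induction n with
  | zero => simp
  | succ n ih =>
    rw [iteratedDeriv_succ, ih]
    exact funext fun x => (hh n x).deriv

theorem iterate_dirDeriv_snd_eq_iteratedDeriv {ψ : ℝ × ℝ → ℝ} (hψ : ContDiff ℝ (⊤ : ℕ∞) ψ)
    (n : ℕ) (s x : ℝ) :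
    (dirDeriv (0, 1))^[n] ψ (s, x) = iteratedDeriv n (fun y => ψ (s, y)) x := by
  refine congrFun (iteratedDeriv_eq_of_hasDerivAt
    (h := fun j y => (dirDeriv (0, 1))^[j] ψ (s, y)) (fun j y => ?_) n).symm x
  rw [Function.iterate_succ_apply']
  exact hasDerivAt_dirDeriv_snd (contDiff_iterate_dirDeriv _ hψ j) s y

theorem hasDerivAt_integral_mul_of_hasCompactSupport {ψ : ℝ × ℝ → ℝ}
    (hψ : ContDiff ℝ (⊤ : ℕ∞) ψ) {w : ℝ → ℝ} (hw : Continuous w) (hwc : HasCompactSupport w)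
    (x : ℝ) :
    HasDerivAt (fun y => ∫ s, ψ (s, y) * w s) (∫ s, dirDeriv (0, 1) ψ (s, x) * w s) x := by
  have hψc := hψ.continuous
  have hdc := (contDiff_dirDeriv (0, 1) hψ).continuous
  obtain ⟨C, hC⟩ := (hwc.isCompact.prod (isCompact_closedBall x 1)).exists_bound_of_continuousOn
    hdc.continuousOn
  refine (hasDerivAt_integral_of_dominated_loc_of_deriv_le (closedBall_mem_nhds x one_pos)
    (F := fun y s => ψ (s, y) * w s) (F' := fun y s => dirDeriv (0, 1) ψ (s, y) * w s)
    (bound := fun s => C * ‖w s‖) ?_ ?_ ?_ ?_ ?_ ?_).2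
  · exact Eventually.of_forall fun y =>
      Continuous.aestronglyMeasurable (by fun_prop)
  · exact Continuous.integrable_of_hasCompactSupport (by fun_prop) hwc.mul_left
  · exact Continuous.aestronglyMeasurable (by fun_prop)
  · refine Eventually.of_forall fun s y hy => ?_
    rw [norm_mul]
    by_cases hs : s ∈ tsupport w
    · exact mul_le_mul_of_nonneg_right (hC (s, y) ⟨hs, hy⟩) (norm_nonneg _)
    · simp [image_eq_zero_of_notMem_tsupport hs]
  · exact ((hw.integrable_of_hasCompactSupport hwc).norm).const_mul C
  · exact Eventually.of_forall fun s y _ => (hasDerivAt_dirDeriv_snd hψ s y).mul_const _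

theorem iteratedDeriv_ofReal_integral_mul {ψ : ℝ × ℝ → ℝ}
    (hψ : ContDiff ℝ (⊤ : ℕ∞) ψ) {w : ℝ → ℝ} (hw : Continuous w) (hwc : HasCompactSupport w)
    (n : ℕ) (x : ℝ) :
    iteratedDeriv n (fun y => ((∫ s, ψ (s, y) * w s : ℝ) : ℂ)) x =
      ((∫ s, (dirDeriv (0, 1))^[n] ψ (s, x) * w s : ℝ) : ℂ) := by
  refine congrFun (iteratedDeriv_eq_of_hasDerivAt
    (h := fun j y => ((∫ s, (dirDeriv (0, 1))^[j] ψ (s, y) * w s : ℝ) : ℂ))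
    (fun j y => ?_) n) x
  rw [Function.iterate_succ_apply']
  exact (hasDerivAt_integral_mul_of_hasCompactSupport
    (contDiff_iterate_dirDeriv _ hψ j) hw hwc y).ofReal_comp

theorem HasDerivAt.exists_forall_lt_of_pos {u : ℝ → ℝ} {u' a : ℝ} (hu : HasDerivAt u u' a)
    (hu' : 0 < u') : ∃ δ > 0, ∀ s, a < s → s < a + δ → u a < u s := by
  have h : ∀ᶠ s in 𝓝[≠] a, 0 < slope u a s :=
    (hasDerivAt_iff_tendsto_slope.1 hu).eventually (lt_mem_nhds hu')
  obtain ⟨δ, hδ, hball⟩ := Metric.mem_nhdsWithin_iff.1 h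
  refine ⟨δ, hδ, fun s has hs => (slope_pos_iff_of_le has.le).1 (hball ⟨?_, has.ne'⟩)⟩
  rw [mem_ball, Real.dist_eq, abs_of_pos (sub_pos.2 has)]
  linarith

/-- Mixed partial derivatives commute, so the `k`-jet of the flow of `x ^ k` at the origin moves
with speed `k!`. -/
theorem hasDerivAt_iterate_dirDeriv_flow {k : ℕ} {ε : ℝ} (hε : 0 < ε) {V : ℝ → ℝ}
    (hVeq : ∀ x : ℝ, |x| < ε → V x = x ^ k)
    {φ : ℝ × ℝ → ℝ} (hφ : ContDiff ℝ (⊤ : ℕ∞) φ) (hφ0 : ∀ x : ℝ, φ (0, x) = x)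
    (hφd : ∀ t x : ℝ, HasDerivAt (fun t' => φ (t', x)) (V (φ (t, x))) t) :
    HasDerivAt (fun s => (dirDeriv (0, 1))^[k] φ (s, 0)) (k.factorial : ℝ) 0 := by
  have h := hasDerivAt_dirDeriv_fst (contDiff_iterate_dirDeriv (0, 1) hφ k) 0 0
  have hV : (fun y => dirDeriv (1, 0) φ (0, y)) =ᶠ[𝓝 0] fun y => y ^ k := by
    filter_upwards [ball_mem_nhds (0 : ℝ) hε] with y hy
    rw [(hasDerivAt_dirDeriv_fst hφ 0 y).unique (hφd 0 y), hφ0]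
    exact hVeq y (by simpa using hy)
  rwa [dirDeriv_iterate_comm _ _ hφ,
    iterate_dirDeriv_snd_eq_iteratedDeriv (contDiff_dirDeriv _ hφ),
    hV.iteratedDeriv_eq, iteratedDeriv_fun_pow_zero, if_pos rfl] at h

theorem hasCompactSupport_ofReal_mul {χ α : ℝ → ℝ} (hχ : HasCompactSupport χ)
    (hα : HasCompactSupport α) :
    HasCompactSupport fun p : ℝ × ℝ => ((χ p.1 * α p.2 : ℝ) : ℂ) := by
  refine HasCompactSupport.intro (hχ.isCompact.prod hα.isCompact) fun p hp => ?_
  rcases not_and_or.1 (mt mem_prod.2 hp) with h | h <;>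
    simp [image_eq_zero_of_notMem_tsupport h]

theorem contDiff_ofReal_mul {χ α : ℝ → ℝ} (hχ : ContDiff ℝ (⊤ : ℕ∞) χ)
    (hα : ContDiff ℝ (⊤ : ℕ∞) α) :
    ContDiff ℝ (⊤ : ℕ∞) fun p : ℝ × ℝ => ((χ p.1 * α p.2 : ℝ) : ℂ) :=
  Complex.ofRealCLM.contDiff.comp ((hχ.comp contDiff_fst).mul (hα.comp contDiff_snd))

theorem exists_smooth_bump (c : ℝ) {r R : ℝ} (hr : 0 < r) (hrR : r < R) :
    ∃ b : ℝ → ℝ, ContDiff ℝ (⊤ : ℕ∞) b ∧ HasCompactSupport b ∧ (∀ s, 0 ≤ b s) ∧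
      (∀ s, |s - c| ≤ r → b s = 1) ∧ ∀ s, R ≤ |s - c| → b s = 0 := by
  let b : ContDiffBump c := ⟨r, R, hr, hrR⟩
  exact ⟨b, b.contDiff, b.hasCompactSupport, b.nonneg',
    fun s hs => b.one_of_mem_closedBall (mem_closedBall_iff_norm.2 hs),
    fun s hs => b.zero_of_le_dist (hs.trans_eq (Real.dist_eq s c).symm)⟩

/-- For the foliation `F^k_ℝ`, the quotient of the smooth convolution algebra by the ideal of
functions vanishing to order `k + 1` on the isotropy group of `0` is noncommutative: there exist
`f`, `g` and `t` with `∂_x^k (f*g)(0,t) ≠ ∂_x^k (g*f)(0,t)`. -/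
theorem statement1 (k : ℕ) (hk : 1 ≤ k) (ε : ℝ) (hε : 0 < ε)
    (V : ℝ → ℝ) (hV : ContDiff ℝ (⊤ : ℕ∞) V)
    (hVeq : ∀ x : ℝ, |x| < ε → V x = x ^ k)
    (φ : ℝ × ℝ → ℝ) (hφ : ContDiff ℝ (⊤ : ℕ∞) φ)
    (hφ0 : ∀ x : ℝ, φ (0, x) = x)
    (hφd : ∀ t x : ℝ, HasDerivAt (fun t' => φ (t', x)) (V (φ (t, x))) t)
    (hφflow : ∀ s t x : ℝ, φ (s + t, x) = φ (t, φ (s, x))) :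
    ∃ f g : ℝ × ℝ → ℂ,
      ContDiff ℝ (⊤ : ℕ∞) f ∧ HasCompactSupport f ∧
      ContDiff ℝ (⊤ : ℕ∞) g ∧ HasCompactSupport g ∧
      ∃ t : ℝ,
        iteratedDeriv k (fun x => groupoidConv φ f g (x, t)) 0 ≠
          iteratedDeriv k (fun x => groupoidConv φ g f (x, t)) 0 := by
  obtain ⟨δ₀, hδ₀, hmono₀⟩ :=
    (hasDerivAt_iterate_dirDeriv_flow hε hVeq hφ hφ0 hφd).exists_forall_lt_of_pos
      (by exact_mod_cast k.factorial_pos)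
  obtain ⟨δ, hδ, hδ1, hmono⟩ : ∃ δ > 0, δ ≤ 1 ∧ ∀ s, 0 < s → s < δ →
      (dirDeriv (0, 1))^[k] φ (0, 0) < (dirDeriv (0, 1))^[k] φ (s, 0) :=
    ⟨min δ₀ 1, lt_min hδ₀ one_pos, min_le_right _ _, fun s h0 h1 =>
      hmono₀ s h0 (by simpa using h1.trans_le (min_le_left _ _))⟩
  obtain ⟨R, hR⟩ := ((isCompact_closedBall (0 : ℝ) 1).prod
    (isCompact_closedBall (0 : ℝ) 1)).exists_bound_of_continuousOn hφ.continuous.continuousOn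
  have hR0 : 0 ≤ R := (norm_nonneg _).trans (hR (0, 0) (by simp))
  obtain ⟨χ, hχ, hχc, -, hχ1, -⟩ :=
    exists_smooth_bump 0 (r := R + 1) (R := R + 2) (by linarith) (by linarith)
  obtain ⟨a, ha, hac, -, ha1, -⟩ := exists_smooth_bump 0 one_pos one_lt_two
  obtain ⟨b, hb, hbs, hbnn, hb1, hbz⟩ :=
    exists_smooth_bump (δ / 2) (r := δ / 8) (R := δ / 4) (by linarith) (by linarith)
  simp only [sub_zero] at hχ1 ha1
  have hb0 : ∀ s, ¬ (0 < s ∧ s < δ) → b s = 0 := by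
    intro s hs
    refine hbz s ?_
    by_contra! h
    rw [abs_lt] at h
    exact hs ⟨by linarith, by linarith⟩
  have hφR : ∀ s x, |s| ≤ 1 → |x| ≤ 1 → |φ (s, x)| ≤ R + 1 := fun s x hs hx =>
    (hR (s, x) ⟨by simpa using hs, by simpa using hx⟩).trans (by linarith)
  have hbc : Continuous b := hb.continuous
  let f : ℝ × ℝ → ℂ := fun p => ((p.1 * χ p.1 * a p.2 : ℝ) : ℂ)
  let g : ℝ × ℝ → ℂ := fun p => ((χ p.1 * b p.2 : ℝ) : ℂ)
  have hfg : (fun x => groupoidConv φ f g (x, 0)) =ᶠ[𝓝 0]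
      fun x => ((∫ s, φ (s, x) * b s : ℝ) : ℂ) := by
    filter_upwards [closedBall_mem_nhds (0 : ℝ) one_pos] with x hx
    replace hx : |x| ≤ 1 := by simpa using hx
    rw [← integral_complex_ofReal]
    refine integral_congr_ae (Eventually.of_forall fun s => ?_)
    by_cases hs : 0 < s ∧ s < δ
    · have hs1 : |s| ≤ 1 := by rw [abs_of_pos hs.1]; linarith [hs.2]
      simp [f, g, hχ1 _ (hφR s x hs1 hx), hχ1 x (by linarith), ha1 (-s) (by rwa [abs_neg])]
    · simp [g, hb0 s hs]
  have hgf : (fun x => groupoidConv φ g f (x, 0)) =ᶠ[𝓝 0]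
      fun x => ((∫ s, (Prod.snd (s, x) : ℝ) * b s : ℝ) : ℂ) := by
    filter_upwards [closedBall_mem_nhds (0 : ℝ) one_pos] with x hx
    replace hx : |x| ≤ 1 := by simpa using hx
    rw [← integral_neg_eq_self (fun s => (Prod.snd (s, x) : ℝ) * b s),
      ← integral_complex_ofReal]
    refine integral_congr_ae (Eventually.of_forall fun s => ?_)
    by_cases hs : 0 < -s ∧ -s < δ
    · have hs1 : |s| ≤ 1 := by rw [abs_of_neg (by linarith)]; linarith [hs.2]
      simp [f, g, hχ1 _ (hφR s x hs1 hx), hχ1 x (by linarith), ha1 s hs1, mul_comm]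
    · simp [g, hb0 _ hs]
  have hxχ : ContDiff ℝ (⊤ : ℕ∞) fun x => x * χ x := contDiff_id.mul hχ
  have hxχc : HasCompactSupport fun x => x * χ x := hχc.mul_left
  refine ⟨f, g, contDiff_ofReal_mul hxχ ha, hasCompactSupport_ofReal_mul hxχc hac,
    contDiff_ofReal_mul hχ hb, hasCompactSupport_ofReal_mul hχc hbs, 0, ?_⟩
  rw [hfg.iteratedDeriv_eq, hgf.iteratedDeriv_eq,
    iteratedDeriv_ofReal_integral_mul hφ hbc hbs,
    iteratedDeriv_ofReal_integral_mul contDiff_snd hbc hbs]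
  have hsnd : ∀ s, (dirDeriv (0, 1))^[k] Prod.snd (s, 0) = (dirDeriv (0, 1))^[k] φ (0, 0) := by
    intro s
    rw [iterate_dirDeriv_snd_eq_iteratedDeriv contDiff_snd,
      iterate_dirDeriv_snd_eq_iteratedDeriv hφ]
    simp only [hφ0]
  have hcont := (contDiff_iterate_dirDeriv (0, 1) hφ k).continuous
  have hpos : 0 < ∫ s, ((dirDeriv (0, 1))^[k] φ (s, 0) - (dirDeriv (0, 1))^[k] φ (0, 0)) * b s := by
    refine Continuous.integral_pos_of_hasCompactSupport_nonneg_nonzero (x := δ / 2)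
      (by fun_prop) hbs.mul_left (fun s => ?_) ?_
    · by_cases hs : 0 < s ∧ s < δ
      · exact mul_nonneg (sub_pos.2 (hmono s hs.1 hs.2)).le (hbnn s)
      · simp [hb0 s hs]
    · exact mul_ne_zero (sub_pos.2 (hmono _ (by linarith) (by linarith))).ne'
        (by rw [hb1 _ (by rw [sub_self, abs_zero]; positivity)]; exact one_ne_zero)
  have hint : ∀ c : ℝ → ℝ, Continuous c → Integrable fun s => c s * b s := fun c hc =>
    (hc.mul hbc).integrable_of_hasCompactSupport hbs.mul_left
  simp only [sub_mul] at hpos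
  rw [integral_sub (hint (fun s => (dirDeriv (0, 1))^[k] φ (s, 0)) (by fun_prop))
    (hint _ continuous_const)] at hpos
  simp only [hsnd]
  exact_mod_cast (sub_pos.1 hpos).ne'
end

section
/- Let φ : ℝ × ℝ → ℝ be a smooth global flow (φ(0,x) = x and φ(s+t,x) = φ(t,φ(s,x)) for all s,t,x) satisfying φ(t,0) = 0 for all t. For smooth compactly supported f, g : ℝ × ℝ → ℂ, define the Taylor coefficients f_n(t) = (1/n!)·∂_x^n f(0,t), g_j(t) = (1/j!)·∂_x^j g(0,t), and φ_m^n(s) = (1/m!)·∂_x^m[(φ(s,x))^n] evaluated at x = 0. Then for every natural number p and every t ∈ ℝ, (1/p!)·∂_x^p (f*g)(0,t) = Σ_{m=0}^{p} Σ_{n=0}^{m} ∫_ℝ f_n(t−s)·φ_m^n(s)·g_{p−m}(s) ds. -/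
open MeasureTheory

open Finset

theorem HasCompactSupport.slice {X Y M : Type*} [TopologicalSpace X] [TopologicalSpace Y]
    [T2Space Y] [Zero M] {F : X × Y → M} (hF : HasCompactSupport F) (x : X) :
    HasCompactSupport fun y => F (x, y) :=
  HasCompactSupport.intro (K := Prod.snd '' tsupport F) (hF.isCompact.image continuous_snd)
    fun y hy => image_eq_zero_of_notMem_tsupport fun h => hy ⟨(x, y), h, rfl⟩

section PartialDerivative

variable {E : Type*} [NormedAddCommGroup E] [NormedSpace ℝ E]

/-- The partial derivative of a function on the plane in its first variable. -/
noncomputable def derivFst (F : ℝ × ℝ → E) : ℝ × ℝ → E :=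
  fun q => fderiv ℝ F q (1, 0)

theorem ContDiff.derivFst {F : ℝ × ℝ → E} (hF : ContDiff ℝ (⊤ : ℕ∞) F) :
    ContDiff ℝ (⊤ : ℕ∞) (derivFst F) :=
  (hF.fderiv_right (m := (⊤ : ℕ∞)) (by simp)).clm_apply contDiff_const

theorem HasCompactSupport.derivFst {F : ℝ × ℝ → E} (hF : HasCompactSupport F) :
    HasCompactSupport (derivFst F) :=
  hF.fderiv_apply (𝕜 := ℝ) (1, 0)

theorem ContDiff.hasDerivAt_derivFst {F : ℝ × ℝ → E} (hF : ContDiff ℝ (⊤ : ℕ∞) F) (x s : ℝ) :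
    HasDerivAt (fun y => F (y, s)) (_root_.derivFst F (x, s)) x := by
  have h := (hF.differentiable (by simp) (x, s)).hasFDerivAt
  exact h.comp_hasDerivAt x ((hasDerivAt_id x).prodMk (hasDerivAt_const x s))

theorem ContDiff.iterate_derivFst {F : ℝ × ℝ → E} (hF : ContDiff ℝ (⊤ : ℕ∞) F) (k : ℕ) :
    ContDiff ℝ (⊤ : ℕ∞) (_root_.derivFst^[k] F) := by
  induction k with
  | zero => exact hF
  | succ k ih => rw [Function.iterate_succ_apply']; exact ih.derivFst

theorem HasCompactSupport.iterate_derivFst {F : ℝ × ℝ → E} (hF : HasCompactSupport F) (k : ℕ) :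
    HasCompactSupport (_root_.derivFst^[k] F) := by
  induction k with
  | zero => exact hF
  | succ k ih => rw [Function.iterate_succ_apply']; exact ih.derivFst

theorem ContDiff.iteratedDeriv_slice {F : ℝ × ℝ → E} (hF : ContDiff ℝ (⊤ : ℕ∞) F) (k : ℕ)
    (x s : ℝ) : iteratedDeriv k (fun y => F (y, s)) x = _root_.derivFst^[k] F (x, s) := by
  induction k generalizing x with
  | zero => simp
  | succ k ih =>
    rw [iteratedDeriv_succ, Function.iterate_succ_apply', funext ih]
    exact ((hF.iterate_derivFst k).hasDerivAt_derivFst x s).deriv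

theorem ContDiff.continuous_iteratedDeriv_slice {F : ℝ × ℝ → E}
    (hF : ContDiff ℝ (⊤ : ℕ∞) F) (k : ℕ) (x : ℝ) :
    Continuous fun s => iteratedDeriv k (fun y => F (y, s)) x := by
  simp only [hF.iteratedDeriv_slice]
  exact (hF.iterate_derivFst k).continuous.comp (by fun_prop)

theorem hasDerivAt_integral_slice {F : ℝ × ℝ → E} (hF : ContDiff ℝ (⊤ : ℕ∞) F)
    (hFc : HasCompactSupport F) (x : ℝ) :
    HasDerivAt (fun y => ∫ s : ℝ, F (y, s)) (∫ s : ℝ, derivFst F (x, s)) x := by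
  have hslice : ∀ (y : ℝ) {G : ℝ × ℝ → E}, Continuous G → Continuous fun s => G (y, s) :=
    fun y G hG => hG.comp (by fun_prop)
  have hF' := hF.derivFst.continuous
  obtain ⟨C, hC⟩ := hFc.derivFst.exists_bound_of_continuous hF'
  have hK : IsCompact (Prod.snd '' tsupport (derivFst F)) :=
    hFc.derivFst.isCompact.image continuous_snd
  refine (hasDerivAt_integral_of_dominated_loc_of_deriv_le (F := fun y s => F (y, s))
    (F' := fun y s => derivFst F (y, s)) (s := Set.univ)
    (bound := (Prod.snd '' tsupport (derivFst F)).indicator fun _ => C) Filter.univ_mem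
    (Filter.Eventually.of_forall fun y => (hslice y hF.continuous).aestronglyMeasurable)
    ((hslice x hF.continuous).integrable_of_hasCompactSupport (hFc.slice x))
    (hslice x hF').aestronglyMeasurable
    (Filter.Eventually.of_forall fun s y _ => ?_) ?_
    (Filter.Eventually.of_forall fun s y _ => hF.hasDerivAt_derivFst y s)).2
  · by_cases hs : s ∈ Prod.snd '' tsupport (derivFst F)
    · simpa [Set.indicator_of_mem hs] using hC (y, s)
    · rw [Set.indicator_of_notMem hs, image_eq_zero_of_notMem_tsupport fun h => hs ⟨(y, s), h, rfl⟩,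
        norm_zero]
  · exact (integrableOn_const hK.measure_lt_top.ne).integrable_indicator hK.measurableSet

theorem iteratedDeriv_integral_slice {F : ℝ × ℝ → E} (hF : ContDiff ℝ (⊤ : ℕ∞) F)
    (hFc : HasCompactSupport F) (k : ℕ) (x : ℝ) :
    iteratedDeriv k (fun y => ∫ s : ℝ, F (y, s)) x =
      ∫ s : ℝ, iteratedDeriv k (fun y => F (y, s)) x := by
  simp only [hF.iteratedDeriv_slice]
  induction k generalizing x with
  | zero => simp
  | succ k ih =>
    rw [iteratedDeriv_succ, Function.iterate_succ_apply', funext ih]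
    exact (hasDerivAt_integral_slice (hF.iterate_derivFst k) (hFc.iterate_derivFst k) x).deriv

end PartialDerivative

section Composition

variable {E : Type*} [NormedAddCommGroup E] [NormedSpace ℝ E]

theorem iteratedDeriv_comp_eq_zero {R : ℝ → E} {u : ℝ → ℝ} (hR : ContDiff ℝ (⊤ : ℕ∞) R)
    (hu : ContDiff ℝ (⊤ : ℕ∞) u) {x : ℝ} {m : ℕ}
    (h : ∀ i ≤ m, iteratedDeriv i R (u x) = 0) :
    iteratedDeriv m (fun y => R (u y)) x = 0 := by
  let D : ℝ := 1 + ∑ i ∈ range (m + 1), ‖iteratedFDeriv ℝ i u x‖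
  have hD : 1 ≤ D := le_add_of_nonneg_right (by positivity)
  have key := norm_iteratedFDeriv_comp_le (n := m) (C := 0) (D := D) hR hu
    (by exact_mod_cast le_top) x
    (fun i hi => by rw [norm_iteratedFDeriv_eq_norm_iteratedDeriv, h i hi, norm_zero])
    (fun i hi him => by
      have h1 : ‖iteratedFDeriv ℝ i u x‖ ≤ D :=
        (single_le_sum (f := fun i => ‖iteratedFDeriv ℝ i u x‖) (fun _ _ => norm_nonneg _)
          (mem_range.2 (Nat.lt_succ_of_le him))).trans (le_add_of_nonneg_left zero_le_one)
      exact h1.trans (le_self_pow₀ hD (by omega)))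
  rw [norm_iteratedFDeriv_eq_norm_iteratedDeriv] at key
  simpa [Function.comp_def] using key

theorem iteratedDeriv_sum_pow_smul_zero (a : ℕ → E) {i m : ℕ} (hi : i ≤ m) :
    iteratedDeriv i (fun y : ℝ => ∑ n ∈ range (m + 1), y ^ n • a n) 0 =
      (i.factorial : ℝ) • a i := by
  rw [iteratedDeriv_fun_sum fun n _ => by fun_prop]
  rw [sum_eq_single i]
  · rw [iteratedDeriv_smul_const (by fun_prop), iteratedDeriv_fun_pow_zero]
    simp
  · intro n _ hn
    rw [iteratedDeriv_smul_const (by fun_prop), iteratedDeriv_fun_pow_zero]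
    simp [hn.symm]
  · intro hn
    exact absurd (mem_range.2 (Nat.lt_succ_of_le hi)) hn

theorem iteratedDeriv_comp_eq_sum_taylor {h : ℝ → E} {u : ℝ → ℝ} (hh : ContDiff ℝ (⊤ : ℕ∞) h)
    (hu : ContDiff ℝ (⊤ : ℕ∞) u) {x : ℝ} (hx : u x = 0) (m : ℕ) :
    iteratedDeriv m (fun y => h (u y)) x = ∑ n ∈ range (m + 1),
      iteratedDeriv m (fun y => u y ^ n) x • (n.factorial : ℝ)⁻¹ • iteratedDeriv n h 0 := by
  have hm : ((m : ℕ∞) : WithTop ℕ∞) ≤ (⊤ : ℕ∞) := by exact_mod_cast le_top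
  let a : ℕ → E := fun n => (n.factorial : ℝ)⁻¹ • iteratedDeriv n h 0
  let T : ℝ → E := fun y => ∑ n ∈ range (m + 1), y ^ n • a n
  have hT : ContDiff ℝ (⊤ : ℕ∞) T := by fun_prop
  have hzero := iteratedDeriv_comp_eq_zero (R := fun y => h y - T y) (hh.sub hT) hu (x := x)
    (m := m) fun i hi => by
      have hi' : (i : WithTop ℕ∞) ≤ (⊤ : ℕ∞) := by exact_mod_cast le_top
      change iteratedDeriv i (h - T) (u x) = 0
      rw [hx, iteratedDeriv_sub (hh.of_le hi').contDiffAt (hT.of_le hi').contDiffAt,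
        iteratedDeriv_sum_pow_smul_zero a hi,
        smul_inv_smul₀ (by exact_mod_cast i.factorial_ne_zero), sub_self]
  have hhu : ContDiff ℝ m fun y => h (u y) := (hh.comp hu).of_le hm
  have hTu : ContDiff ℝ m fun y => T (u y) := (hT.comp hu).of_le hm
  have hu' : ContDiff ℝ m u := hu.of_le hm
  change iteratedDeriv m ((fun y => h (u y)) - fun y => T (u y)) x = 0 at hzero
  rw [iteratedDeriv_sub hhu.contDiffAt hTu.contDiffAt, sub_eq_zero] at hzero
  have hterm : ∀ n ∈ range (m + 1), ContDiffAt ℝ m (fun y => u y ^ n • a n) x :=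
    fun n _ => ((hu'.pow n).smul contDiff_const).contDiffAt
  rw [hzero, iteratedDeriv_fun_sum hterm]
  exact sum_congr rfl fun n _ => iteratedDeriv_smul_const (hu'.pow n).contDiffAt _

end Composition

theorem taylorCoeff_comp_mul {h k : ℝ → ℂ} {u : ℝ → ℝ} (hh : ContDiff ℝ (⊤ : ℕ∞) h)
    (hk : ContDiff ℝ (⊤ : ℕ∞) k) (hu : ContDiff ℝ (⊤ : ℕ∞) u) {x : ℝ} (hx : u x = 0) (p : ℕ) :
    (1 / (Nat.factorial p) : ℂ) * iteratedDeriv p (fun y => h (u y) * k y) x =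
      ∑ m ∈ range (p + 1), ∑ n ∈ range (m + 1),
        ((1 / (Nat.factorial n) : ℂ) * iteratedDeriv n h 0) *
          (((1 / (Nat.factorial m) : ℝ) * iteratedDeriv m (fun y => u y ^ n) x : ℝ) : ℂ) *
          ((1 / (Nat.factorial (p - m)) : ℂ) * iteratedDeriv (p - m) k x) := by
  have hp : ((p : ℕ∞) : WithTop ℕ∞) ≤ (⊤ : ℕ∞) := by exact_mod_cast le_top
  have hhu : ContDiff ℝ p fun y => h (u y) := (hh.comp hu).of_le hp
  change _ * iteratedDeriv p ((fun y => h (u y)) * k) x = _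
  rw [iteratedDeriv_mul hhu.contDiffAt (hk.of_le hp).contDiffAt, mul_sum]
  refine sum_congr rfl fun m hm => ?_
  have hmp : m ≤ p := Nat.lt_succ_iff.1 (mem_range.1 hm)
  rw [iteratedDeriv_comp_eq_sum_taylor hh hu hx, Nat.cast_choose ℂ hmp, mul_sum, sum_mul, mul_sum]
  refine sum_congr rfl fun n _ => ?_
  have h1 : (p.factorial : ℂ) ≠ 0 := by exact_mod_cast p.factorial_ne_zero
  simp only [Complex.real_smul]
  push_cast
  field_simp

/-- Formula for the Taylor coefficients in `x` at `x = 0` of a groupoid convolution product: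
`(1/p!)·∂_x^p (f*g)(0,t) = Σ_{m=0}^{p} Σ_{n=0}^{m} ∫ f_n(t−s)·φ_m^n(s)·g_{p−m}(s) ds`. -/
theorem statement2 (φ : ℝ × ℝ → ℝ) (hφ : ContDiff ℝ (⊤ : ℕ∞) φ)
    (hφ0 : ∀ x : ℝ, φ (0, x) = x)
    (hφflow : ∀ s t x : ℝ, φ (s + t, x) = φ (t, φ (s, x)))
    (hφfix : ∀ t : ℝ, φ (t, 0) = 0)
    (f g : ℝ × ℝ → ℂ)
    (hf : ContDiff ℝ (⊤ : ℕ∞) f) (hfc : HasCompactSupport f)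
    (hg : ContDiff ℝ (⊤ : ℕ∞) g) (hgc : HasCompactSupport g)
    (p : ℕ) (t : ℝ) :
    (1 / (Nat.factorial p) : ℂ) * iteratedDeriv p (fun x => groupoidConv φ f g (x, t)) 0 =
      ∑ m ∈ Finset.range (p + 1), ∑ n ∈ Finset.range (m + 1),
        ∫ s : ℝ,
          ((1 / (Nat.factorial n) : ℂ) * iteratedDeriv n (fun x => f (x, t - s)) 0) *
            (((1 / (Nat.factorial m) : ℝ) *
              iteratedDeriv m (fun x => (φ (s, x)) ^ n) 0 : ℝ) : ℂ) *
            ((1 / (Nat.factorial (p - m)) : ℂ) *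
              iteratedDeriv (p - m) (fun x => g (x, s)) 0) := by
  have hF : ContDiff ℝ (⊤ : ℕ∞) fun q : ℝ × ℝ => f (φ (q.2, q.1), t - q.2) * g q := by
    fun_prop
  have hFc : HasCompactSupport fun q : ℝ × ℝ => f (φ (q.2, q.1), t - q.2) * g q :=
    hgc.mul_left
  have hpow : ∀ n : ℕ, ContDiff ℝ (⊤ : ℕ∞) fun q : ℝ × ℝ => φ (q.2, q.1) ^ n := fun n => by
    fun_prop
  have hterm : ∀ m n : ℕ, Integrable fun s : ℝ =>
      ((1 / (Nat.factorial n) : ℂ) * iteratedDeriv n (fun x => f (x, t - s)) 0) *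
        (((1 / (Nat.factorial m) : ℝ) *
          iteratedDeriv m (fun x => (φ (s, x)) ^ n) 0 : ℝ) : ℂ) *
        ((1 / (Nat.factorial (p - m)) : ℂ) *
          iteratedDeriv (p - m) (fun x => g (x, s)) 0) := by
    intro m n
    refine Continuous.integrable_of_hasCompactSupport ?_ ?_
    · have c1 := (hf.continuous_iteratedDeriv_slice n 0).comp (continuous_sub_left t)
      have c2 := (hpow n).continuous_iteratedDeriv_slice m 0
      have c3 := hg.continuous_iteratedDeriv_slice (p - m) 0
      exact ((continuous_const.mul c1).mul
        (Complex.continuous_ofReal.comp (continuous_const.mul c2))).mul (continuous_const.mul c3)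
    · refine HasCompactSupport.mul_left (HasCompactSupport.mul_left ?_)
      simp only [hg.iteratedDeriv_slice]
      exact (hgc.iterate_derivFst (p - m)).slice 0
  simp only [groupoidConv]
  rw [iteratedDeriv_integral_slice hF hFc, ← integral_const_mul]
  simp only
  rw [integral_congr_ae (Filter.Eventually.of_forall fun s =>
    taylorCoeff_comp_mul (h := fun x => f (x, t - s)) (k := fun x => g (x, s))
      (u := fun x => φ (s, x)) (by fun_prop) (by fun_prop) (by fun_prop) (hφfix s) p)]
  rw [integral_finsetSum _ fun m _ => integrable_finsetSum _ fun n _ => hterm m n]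
  exact sum_congr rfl fun m _ => integral_finsetSum _ fun n _ => hterm m n
end

section
/- Let φ : ℝ × ℝ → ℝ be a smooth global flow (φ(0,x) = x and φ(s+t,x) = φ(t,φ(s,x)) for all s,t,x) satisfying φ(t,0) = 0 for all t. Define φ_m^n(t) = (1/m!)·∂_x^m[(φ(t,x))^n] evaluated at x = 0, for natural numbers m, n. Then for all natural numbers n ≤ m and all real s, t: φ_m^n(t) = Σ_{i=n}^{m} φ_m^i(t−s)·φ_i^n(s). -/
/-- The `m`-th derivative of `G ∘ g` at `x` depends only on the `m`-jet of `G` at `g x`. -/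
theorem iteratedDeriv_comp_congr_of_jet_eq {G H g : ℝ → ℝ} {x : ℝ} {m : ℕ}
    (hG : ContDiffAt ℝ m G (g x)) (hH : ContDiffAt ℝ m H (g x)) (hg : ContDiffAt ℝ m g x)
    (h : ∀ k ≤ m, iteratedDeriv k G (g x) = iteratedDeriv k H (g x)) :
    iteratedDeriv m (G ∘ g) x = iteratedDeriv m (H ∘ g) x := by
  rw [iteratedDeriv_comp_eq_sum_orderedFinpartition hG hg le_rfl,
    iteratedDeriv_comp_eq_sum_orderedFinpartition hH hg le_rfl]
  exact Finset.sum_congr rfl fun c _ => by rw [h _ c.length_le]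

/-- The `k`-th derivative at `0` of a polynomial function of degree at most `m`, for `k ≤ m`. -/
theorem iteratedDeriv_sum_range_mul_pow_zero (a : ℕ → ℝ) {k m : ℕ} (hk : k ≤ m) :
    iteratedDeriv k (fun y : ℝ => ∑ i ∈ Finset.range (m + 1), a i * y ^ i) 0 =
      a k * k.factorial := by
  rw [iteratedDeriv_fun_sum fun i _ => by fun_prop]
  simp only [iteratedDeriv_const_mul_field, iteratedDeriv_fun_pow_zero]
  rw [Finset.sum_eq_single_of_mem k (by simp; omega) fun b _ hb => by simp [hb.symm]]
  simp

/-- The derivatives of order less than `n` of `f ^ n` vanish at a zero of `f`. -/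
theorem iteratedDeriv_fun_pow_eq_zero_of_lt {f : ℝ → ℝ} {x : ℝ} {k n : ℕ}
    (hf : ContDiffAt ℝ k f x) (hx : f x = 0) (hk : k < n) :
    iteratedDeriv k (fun y => f y ^ n) x = 0 := by
  have h := iteratedDeriv_comp_congr_of_jet_eq (G := fun y : ℝ => y ^ n) (H := fun _ => 0)
    (by fun_prop) (by fun_prop) hf fun j hj => by
      rw [hx, iteratedDeriv_fun_pow_zero, if_neg (by omega)]
      simp
  simpa [Function.comp_def, iteratedDeriv_const] using h

/-- The derivatives of `G ∘ g` at `0`, for `g` fixing `0`, in terms of those of `G` and of the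
powers of `g`. -/
theorem iteratedDeriv_comp_eq_sum_pow {G g : ℝ → ℝ} {m : ℕ}
    (hG : ContDiffAt ℝ m G 0) (hg : ContDiffAt ℝ m g 0) (h0 : g 0 = 0) :
    iteratedDeriv m (G ∘ g) 0 = ∑ i ∈ Finset.range (m + 1),
      (1 / (i.factorial : ℝ) * iteratedDeriv i G 0) * iteratedDeriv m (fun x => g x ^ i) 0 := by
  rw [iteratedDeriv_comp_congr_of_jet_eq (G := G) (H := fun y => ∑ i ∈ Finset.range (m + 1),
    (1 / (i.factorial : ℝ) * iteratedDeriv i G 0) * y ^ i) (by rwa [h0]) (by fun_prop) hg]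
  · simp only [Function.comp_def]
    rw [iteratedDeriv_fun_sum fun i _ => by fun_prop]
    simp only [iteratedDeriv_const_mul_field]
  · intro k hk
    rw [h0, iteratedDeriv_sum_range_mul_pow_zero _ hk]
    field_simp

/-- Cocycle-type identity for the Taylor coefficients `φ_m^n(t) = (1/m!)·∂_x^m[(φ(t,x))^n]|_{x=0}`
of powers of a flow fixing the origin: `φ_m^n(t) = Σ_{i=n}^{m} φ_m^i(t−s)·φ_i^n(s)`. -/
theorem statement3 (φ : ℝ × ℝ → ℝ) (hφ : ContDiff ℝ (⊤ : ℕ∞) φ)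
    (hφ0 : ∀ x : ℝ, φ (0, x) = x)
    (hφflow : ∀ s t x : ℝ, φ (s + t, x) = φ (t, φ (s, x)))
    (hφfix : ∀ t : ℝ, φ (t, 0) = 0)
    (m n : ℕ) (hnm : n ≤ m) (s t : ℝ) :
    (1 / (Nat.factorial m) : ℝ) * iteratedDeriv m (fun x => (φ (t, x)) ^ n) 0 =
      ∑ i ∈ Finset.Icc n m,
        ((1 / (Nat.factorial m) : ℝ) * iteratedDeriv m (fun x => (φ (t - s, x)) ^ i) 0) *
          ((1 / (Nat.factorial i) : ℝ) * iteratedDeriv i (fun x => (φ (s, x)) ^ n) 0) := by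
  have hsmooth : ∀ (r : ℝ) (k : ℕ), ContDiff ℝ k fun x => φ (r, x) := fun r k =>
    (hφ.of_le (by exact_mod_cast le_top)).comp (by fun_prop)
  have hcomp : (fun x => φ (t, x) ^ n) = (fun y => φ (s, y) ^ n) ∘ fun x => φ (t - s, x) := by
    ext x
    simp [← hφflow]
  rw [hcomp, iteratedDeriv_comp_eq_sum_pow ((hsmooth s m).pow n).contDiffAt
    (hsmooth (t - s) m).contDiffAt (hφfix _), Finset.mul_sum]
  symm
  refine (Finset.sum_subset (fun i hi => ?_) fun i hi hi' => ?_).trans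
    (Finset.sum_congr rfl fun i _ => by ring)
  · simp at hi ⊢
    omega
  · rw [iteratedDeriv_fun_pow_eq_zero_of_lt (hsmooth s i).contDiffAt (hφfix s)
      (by simp at hi hi'; omega)]
    simp
end

section
/- Let k ≥ 1 be an integer, let h : ℝ → ℝ be a smooth nowhere-vanishing function, set V(x) = h(x)·x^k, and suppose φ : ℝ × ℝ → ℝ is a smooth global flow of V (φ(0,x) = x, ∂φ/∂t(t,x) = V(φ(t,x)), φ(s+t,x) = φ(t,φ(s,x))). Then there exists a smooth function Δ : ℝ × ℝ → ℝ with Δ(t,x) > 0 for all (t,x), such that Δ(t,x) = φ(t,x)/x whenever x ≠ 0, and Δ satisfies the cocycle identity Δ(s+t, x) = Δ(t, φ(s,x))·Δ(s,x) for all s, t, x. -/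
open scoped ContDiff in
/-- The integral over a compact interval of a smooth function is smooth in the parameter. -/
theorem contDiff_parametric_intervalIntegral {E G : Type} [NormedAddCommGroup E]
    [NormedSpace ℝ E] [ProperSpace E] [NormedAddCommGroup G] [NormedSpace ℝ G]
    {F : E × ℝ → G} (hF : ContDiff ℝ ∞ F) (a b : ℝ) :
    ContDiff ℝ ∞ (fun p : E => ∫ s in a..b, F (p, s)) := by
  rw [contDiff_infty]
  intro n
  induction n generalizing G with
  | zero =>
    exact contDiff_zero.2 (intervalIntegral.continuous_parametric_intervalIntegral_of_continuous'
      (f := fun p s => F (p, s)) hF.continuous a b)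
  | succ n ih =>
    set F' : E × ℝ → E →L[ℝ] G := fun q => (fderiv ℝ F q).comp (ContinuousLinearMap.inl ℝ E ℝ)
      with hF'_def
    have hF' : ContDiff ℝ ∞ F' :=
      (hF.fderiv_right (m := ∞) (by simp)).clm_comp contDiff_const
    rw [Nat.cast_succ, contDiff_succ_iff_hasFDerivAt]
    refine ⟨fun p => ∫ s in a..b, F' (p, s), ih hF', fun p => ?_⟩
    obtain ⟨C, hC⟩ := ((isCompact_closedBall p 1).prod (isCompact_uIcc (a := a) (b := b))
      ).exists_bound_of_continuousOn hF'.continuous.continuousOn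
    refine intervalIntegral.hasFDerivAt_integral_of_dominated_of_fderiv_le
      (F := fun p s => F (p, s)) (F' := fun p s => F' (p, s)) (bound := fun _ => C)
      (Metric.closedBall_mem_nhds p one_pos) (.of_forall fun x => ?_) ?_ ?_ ?_ ?_ ?_
    · exact (hF.continuous.comp (.prodMk_right x)).aestronglyMeasurable
    · exact (hF.continuous.comp (.prodMk_right p)).intervalIntegrable _ _
    · exact (hF'.continuous.comp (.prodMk_right p)).aestronglyMeasurable
    · exact .of_forall fun t ht x hx => hC (x, t) ⟨hx, Set.uIoc_subset_uIcc ht⟩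
    · exact intervalIntegrable_const
    · refine .of_forall fun t _ x _ => ?_
      exact ((hF.differentiable (by simp) (x, t)).hasFDerivAt).comp x (hasFDerivAt_prodMk_left x t)

open scoped ContDiff in
/-- The primitive in the first variable of a smooth function of two variables is smooth. -/
theorem contDiff_parametric_primitive {g : ℝ × ℝ → ℝ} (hg : ContDiff ℝ ∞ g) :
    ContDiff ℝ ∞ (fun p : ℝ × ℝ => ∫ u in (0 : ℝ)..p.1, g (u, p.2)) := by
  have hF : ContDiff ℝ ∞ (fun q : (ℝ × ℝ) × ℝ => q.1.1 * g (q.1.1 * q.2, q.1.2)) := by fun_prop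
  convert contDiff_parametric_intervalIntegral hF 0 1 using 2 with p
  simpa using (intervalIntegral.mul_integral_comp_mul_left (a := 0) (b := 1) p.1
    (f := fun u => g (u, p.2))).symm

/-- For the flow `φ` of `V(x)·d/dx` with `V(x) = h(x)·x^k`, `h` nowhere vanishing, there is a
smooth positive 1-cocycle `Δ` on `ℝ ⋊_φ ℝ` with `Δ(t,x) = φ(t,x)/x` for `x ≠ 0`. -/
theorem statement5 (k : ℕ) (hk : 1 ≤ k)
    (h : ℝ → ℝ) (hh : ContDiff ℝ (⊤ : ℕ∞) h) (hhne : ∀ x : ℝ, h x ≠ 0)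
    (φ : ℝ × ℝ → ℝ) (hφ : ContDiff ℝ (⊤ : ℕ∞) φ)
    (hφ0 : ∀ x : ℝ, φ (0, x) = x)
    (hφd : ∀ t x : ℝ, HasDerivAt (fun t' => φ (t', x)) (h (φ (t, x)) * (φ (t, x)) ^ k) t)
    (hφflow : ∀ s t x : ℝ, φ (s + t, x) = φ (t, φ (s, x))) :
    ∃ Δ : ℝ × ℝ → ℝ,
      ContDiff ℝ (⊤ : ℕ∞) Δ ∧
      (∀ t x : ℝ, 0 < Δ (t, x)) ∧
      (∀ t x : ℝ, x ≠ 0 → Δ (t, x) = φ (t, x) / x) ∧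
      (∀ s t x : ℝ, Δ (s + t, x) = Δ (t, φ (s, x)) * Δ (s, x)) := by
  set g : ℝ × ℝ → ℝ := fun p => h (φ p) * φ p ^ (k - 1) with hg_def
  have hg : ContDiff ℝ (⊤ : ℕ∞) g := (hh.comp hφ).mul (hφ.pow _)
  have hgc (x : ℝ) : Continuous fun u => g (u, x) := hg.continuous.comp (.prodMk_left x)
  set I : ℝ × ℝ → ℝ := fun p => ∫ u in (0 : ℝ)..p.1, g (u, p.2) with hI_def
  have hI : ContDiff ℝ (⊤ : ℕ∞) I := contDiff_parametric_primitive hg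
  have hId (t x : ℝ) : HasDerivAt (fun t' => I (t', x)) (g (t, x)) t :=
    (hgc x).integral_hasStrictDerivAt 0 t |>.hasDerivAt
  have hI0 (x : ℝ) : I (0, x) = 0 := intervalIntegral.integral_same
  have hφI (t x : ℝ) : φ (t, x) = x * Real.exp (I (t, x)) := by
    have hd (t : ℝ) : HasDerivAt (fun t' => φ (t', x) * Real.exp (-I (t', x))) 0 t := by
      refine ((hφd t x).mul (hId t x).neg.exp).congr_deriv ?_
      obtain ⟨m, rfl⟩ := Nat.exists_eq_add_of_le' hk
      simp only [hg_def, Nat.add_sub_cancel]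
      ring
    have hconst := is_const_of_deriv_eq_zero (fun t => (hd t).differentiableAt)
      (fun t => (hd t).deriv) t 0
    simp only [hφ0, hI0, neg_zero, Real.exp_zero, mul_one] at hconst
    rw [Real.exp_neg, ← div_eq_mul_inv] at hconst
    exact (div_eq_iff (Real.exp_ne_zero _)).1 hconst
  refine ⟨fun p => Real.exp (I p), hI.exp, fun t x => Real.exp_pos _, fun t x hx => ?_,
    fun s t x => ?_⟩
  · rw [hφI, mul_div_cancel_left₀ _ hx]
  · have hshift : I (t, φ (s, x)) = ∫ u in s..s + t, g (u, x) := by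
      have := intervalIntegral.integral_comp_add_left (a := 0) (b := t) (fun u => g (u, x)) s
      rw [add_zero] at this
      rw [← this]
      simp only [hI_def, hg_def, hφflow]
    change Real.exp (I (s + t, x)) = Real.exp (I (t, φ (s, x))) * Real.exp (I (s, x))
    rw [← Real.exp_add, hshift, add_comm (∫ u in s..s + t, g (u, x)),
      intervalIntegral.integral_add_adjacent_intervals
        ((hgc x).intervalIntegrable _ _) ((hgc x).intervalIntegrable _ _)]
end

section
/- Let φ : ℝ × ℝ → ℝ be a smooth global flow (φ(0,x) = x, φ(s+t,x) = φ(t,φ(s,x))) satisfying φ(t,0) = 0 for all t, and let p ≥ 1 be an integer. If g : ℝ × ℝ → ℂ is smooth and compactly supported with ∂_x^j g(0,t) = 0 for all 0 ≤ j < p and all t ∈ ℝ, then for every smooth compactly supported f : ℝ × ℝ → ℂ, both f*g and g*f satisfy the same vanishing: ∂_x^j (f*g)(0,t) = 0 and ∂_x^j (g*f)(0,t) = 0 for all 0 ≤ j < p and all t ∈ ℝ. (The functions vanishing to order p on the isotropy group {0} × ℝ form a two-sided ideal under convolution.) -/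
open MeasureTheory

/-- `u` vanishes to order `p` at the origin: its derivatives of order less than `p` are zero. -/
def VanishesToOrder (p : ℕ) (u : ℝ → ℂ) : Prop :=
  ∀ j : ℕ, j < p → iteratedDeriv j u 0 = 0

theorem vanishesToOrder_succ {p : ℕ} {u : ℝ → ℂ} :
    VanishesToOrder (p + 1) u ↔ u 0 = 0 ∧ VanishesToOrder p (deriv u) := by
  constructor
  · intro h
    refine ⟨by simpa using h 0 p.succ_pos, fun j hj => ?_⟩
    rw [← iteratedDeriv_succ']
    exact h (j + 1) (by omega)
  · rintro ⟨h0, h⟩ j hj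
    cases j with
    | zero => simpa using h0
    | succ j =>
      rw [iteratedDeriv_succ']
      exact h j (by omega)

theorem VanishesToOrder.mono {p q : ℕ} {u : ℝ → ℂ} (h : VanishesToOrder q u) (hpq : p ≤ q) :
    VanishesToOrder p u :=
  fun j hj => h j (hj.trans_le hpq)

theorem VanishesToOrder.add {p : ℕ} {u v : ℝ → ℂ} (hu : ContDiff ℝ (⊤ : ℕ∞) u)
    (hv : ContDiff ℝ (⊤ : ℕ∞) v) (h : VanishesToOrder p u) (h' : VanishesToOrder p v) :
    VanishesToOrder p (u + v) := by
  intro j hj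
  rw [iteratedDeriv_add (hu.of_le (mod_cast le_top)).contDiffAt
    (hv.of_le (mod_cast le_top)).contDiffAt, h j hj, h' j hj, add_zero]

theorem ContDiff.deriv_of_smooth {E : Type*} [NormedAddCommGroup E] [NormedSpace ℝ E]
    {u : ℝ → E} (hu : ContDiff ℝ (⊤ : ℕ∞) u) :
    ContDiff ℝ (⊤ : ℕ∞) (deriv u) :=
  (contDiff_infty_iff_deriv.1 hu).2

theorem ContDiff.differentiable_of_smooth {E F : Type*} [NormedAddCommGroup E] [NormedSpace ℝ E]
    [NormedAddCommGroup F] [NormedSpace ℝ F]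
    {u : E → F} (hu : ContDiff ℝ (⊤ : ℕ∞) u) : Differentiable ℝ u :=
  hu.differentiable (by simp)

theorem VanishesToOrder.mul_left {p : ℕ} {a b : ℝ → ℂ} (ha : ContDiff ℝ (⊤ : ℕ∞) a)
    (hb : ContDiff ℝ (⊤ : ℕ∞) b) (h : VanishesToOrder p b) :
    VanishesToOrder p (a * b) := by
  induction p generalizing a b with
  | zero => intro j hj; omega
  | succ p ih =>
    have h' := vanishesToOrder_succ.1 h
    refine vanishesToOrder_succ.2 ⟨by simp [h'.1], ?_⟩
    have hd : deriv (a * b) = deriv a * b + a * deriv b := by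
      funext x
      exact deriv_mul (ha.differentiable_of_smooth x) (hb.differentiable_of_smooth x)
    rw [hd]
    exact (ih ha.deriv_of_smooth hb (h.mono p.le_succ)).add (ha.deriv_of_smooth.mul hb)
      (ha.mul hb.deriv_of_smooth) (ih ha hb.deriv_of_smooth h'.2)

theorem VanishesToOrder.comp {p : ℕ} {u : ℝ → ℂ} {v : ℝ → ℝ} (hu : ContDiff ℝ (⊤ : ℕ∞) u)
    (hv : ContDiff ℝ (⊤ : ℕ∞) v) (hv0 : v 0 = 0) (h : VanishesToOrder p u) :
    VanishesToOrder p (u ∘ v) := by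
  induction p generalizing u with
  | zero => intro j hj; omega
  | succ p ih =>
    have h' := vanishesToOrder_succ.1 h
    refine vanishesToOrder_succ.2 ⟨by simp [hv0, h'.1], ?_⟩
    have hd : deriv (u ∘ v) = (fun x => ((deriv v x : ℝ) : ℂ)) * (deriv u ∘ v) := by
      funext x
      rw [deriv.scomp x (hu.differentiable_of_smooth _) (hv.differentiable_of_smooth _)]
      simp
    rw [hd]
    exact (ih hu.deriv_of_smooth h'.2).mul_left
      (Complex.ofRealCLM.contDiff.comp hv.deriv_of_smooth) (hu.deriv_of_smooth.comp hv)

/-- The partial derivative in the first variable. -/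
noncomputable def partialFst (h : ℝ × ℝ → ℂ) : ℝ × ℝ → ℂ :=
  fun q => fderiv ℝ h q (1, 0)

theorem ContDiff.partialFst {h : ℝ × ℝ → ℂ} (hh : ContDiff ℝ (⊤ : ℕ∞) h) :
    ContDiff ℝ (⊤ : ℕ∞) (partialFst h) :=
  (hh.fderiv_right (m := (⊤ : ℕ∞)) (by simp)).clm_apply contDiff_const

theorem hasDerivAt_partialFst {h : ℝ × ℝ → ℂ} (hh : ContDiff ℝ (⊤ : ℕ∞) h) (x s : ℝ) :
    HasDerivAt (fun y => h (y, s)) (partialFst h (x, s)) x :=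
  (hh.differentiable_of_smooth (x, s)).hasFDerivAt.comp_hasDerivAt x
    ((hasDerivAt_id x).prodMk (hasDerivAt_const x s))

theorem partialFst_eq_zero {h : ℝ × ℝ → ℂ} (hh : ContDiff ℝ (⊤ : ℕ∞) h) {s : ℝ}
    (hs : ∀ x, h (x, s) = 0) (x : ℝ) : partialFst h (x, s) = 0 := by
  have := hasDerivAt_partialFst hh x s
  simp only [hs] at this
  exact this.unique (hasDerivAt_const x 0)

theorem integrable_slice {h : ℝ × ℝ → ℂ} (hh : Continuous h) {K : Set ℝ}
    (hK : IsCompact K) (hsupp : ∀ x, ∀ s ∉ K, h (x, s) = 0) (x : ℝ) :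
    Integrable (fun s => h (x, s)) :=
  (hh.comp (by fun_prop : Continuous fun s : ℝ => (x, s))).integrable_of_hasCompactSupport
    (HasCompactSupport.intro hK (hsupp x))

theorem deriv_integral_slice {h : ℝ × ℝ → ℂ} (hh : ContDiff ℝ (⊤ : ℕ∞) h) {K : Set ℝ}
    (hK : IsCompact K) (hsupp : ∀ x, ∀ s ∉ K, h (x, s) = 0) :
    deriv (fun x => ∫ s, h (x, s)) = fun x => ∫ s, partialFst h (x, s) := by
  funext x
  have hsupp' : ∀ x, ∀ s ∉ K, partialFst h (x, s) = 0 := fun x s hs =>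
    partialFst_eq_zero hh (fun y => hsupp y s hs) x
  have hc := hh.partialFst.continuous
  obtain ⟨C, hC⟩ := ((isCompact_closedBall x 1).prod hK).exists_bound_of_continuousOn
    hc.continuousOn
  refine (hasDerivAt_integral_of_dominated_loc_of_deriv_le
    (bound := K.indicator fun _ => C) (F' := fun y s => partialFst h (y, s))
    (Metric.ball_mem_nhds x one_pos)
    (Filter.Eventually.of_forall fun y =>
      (integrable_slice hh.continuous hK hsupp y).aestronglyMeasurable)
    (integrable_slice hh.continuous hK hsupp x)
    (integrable_slice hc hK hsupp' x).aestronglyMeasurable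
    (Filter.Eventually.of_forall fun s y hy => ?_)
    ((integrable_indicator_iff hK.measurableSet).2
      (integrableOn_const hK.measure_lt_top.ne))
    (Filter.Eventually.of_forall fun s y _ => hasDerivAt_partialFst hh y s)).2.deriv
  by_cases hs : s ∈ K
  · rw [Set.indicator_of_mem hs]
    exact hC (y, s) ⟨Metric.ball_subset_closedBall hy, hs⟩
  · rw [Set.indicator_of_notMem hs, hsupp' y s hs, norm_zero]

theorem vanishesToOrder_integral {p : ℕ} {h : ℝ × ℝ → ℂ} (hh : ContDiff ℝ (⊤ : ℕ∞) h) {K : Set ℝ}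
    (hK : IsCompact K) (hsupp : ∀ x, ∀ s ∉ K, h (x, s) = 0)
    (hvan : ∀ s, VanishesToOrder p fun x => h (x, s)) :
    VanishesToOrder p fun x => ∫ s, h (x, s) := by
  induction p generalizing h with
  | zero => intro j hj; omega
  | succ p ih =>
    have hvan' := fun s => vanishesToOrder_succ.1 (hvan s)
    refine vanishesToOrder_succ.2 ⟨by simp [(hvan' _).1], ?_⟩
    rw [deriv_integral_slice hh hK hsupp]
    refine ih hh.partialFst (fun x s hs => partialFst_eq_zero hh (fun y => hsupp y s hs) x)
      fun s => ?_
    have hd : deriv (fun x => h (x, s)) = fun x => partialFst h (x, s) :=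
      funext fun x => (hasDerivAt_partialFst hh x s).deriv
    exact hd ▸ (hvan' s).2

theorem vanishesToOrder_groupoidConv {p : ℕ} {φ : ℝ × ℝ → ℝ} (hφ : ContDiff ℝ (⊤ : ℕ∞) φ)
    {f g : ℝ × ℝ → ℂ} (hf : ContDiff ℝ (⊤ : ℕ∞) f) (hg : ContDiff ℝ (⊤ : ℕ∞) g)
    (hgc : HasCompactSupport g) (t : ℝ)
    (hvan : ∀ s, VanishesToOrder p fun x => f (φ (s, x), t - s) * g (x, s)) :
    VanishesToOrder p fun x => groupoidConv φ f g (x, t) := by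
  refine vanishesToOrder_integral (h := fun q => f (φ (q.2, q.1), t - q.2) * g (q.1, q.2))
    (by fun_prop) (hgc.isCompact.image continuous_snd) (fun x s hs => ?_) hvan
  have : (x, s) ∉ tsupport g := fun hmem => hs ⟨(x, s), hmem, rfl⟩
  simp [image_eq_zero_of_notMem_tsupport this]

/-- The functions vanishing to order `p` on the isotropy group `{0} × ℝ` form a two-sided ideal
under groupoid convolution. -/
theorem statement7 (φ : ℝ × ℝ → ℝ) (hφ : ContDiff ℝ (⊤ : ℕ∞) φ)
    (hφ0 : ∀ x : ℝ, φ (0, x) = x)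
    (hφflow : ∀ s t x : ℝ, φ (s + t, x) = φ (t, φ (s, x)))
    (hφfix : ∀ t : ℝ, φ (t, 0) = 0)
    (p : ℕ) (hp : 1 ≤ p)
    (g : ℝ × ℝ → ℂ) (hg : ContDiff ℝ (⊤ : ℕ∞) g) (hgc : HasCompactSupport g)
    (hgvan : ∀ j : ℕ, j < p → ∀ t : ℝ, iteratedDeriv j (fun x => g (x, t)) 0 = 0)
    (f : ℝ × ℝ → ℂ) (hf : ContDiff ℝ (⊤ : ℕ∞) f) (hfc : HasCompactSupport f) :
    (∀ j : ℕ, j < p → ∀ t : ℝ,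
      iteratedDeriv j (fun x => groupoidConv φ f g (x, t)) 0 = 0) ∧
    (∀ j : ℕ, j < p → ∀ t : ℝ,
      iteratedDeriv j (fun x => groupoidConv φ g f (x, t)) 0 = 0) := by
  constructor
  · intro j hj t
    refine vanishesToOrder_groupoidConv hφ hf hg hgc t (fun s => ?_) j hj
    exact VanishesToOrder.mul_left (a := fun x => f (φ (s, x), t - s)) (b := fun x => g (x, s))
      (by fun_prop) (by fun_prop) fun i hi => hgvan i hi s
  · intro j hj t
    refine vanishesToOrder_groupoidConv hφ hg hf hfc t (fun s => ?_) j hj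
    have hcomp : VanishesToOrder p ((fun y => g (y, t - s)) ∘ fun x => φ (s, x)) :=
      VanishesToOrder.comp (by fun_prop) (by fun_prop) (hφfix s) fun i hi => hgvan i hi (t - s)
    have hmul := hcomp.mul_left (a := fun x => f (x, s)) (by fun_prop) (by fun_prop)
    rw [mul_comm] at hmul
    exact hmul
end

section
/- Let φ : ℝ × ℝ → ℝ be a smooth global flow (φ(0,x) = x, φ(s+t,x) = φ(t,φ(s,x))) satisfying φ(t,0) = 0 for all t, and let p ≥ 1 be an integer. For a smooth compactly supported f : ℝ × ℝ → ℂ, define its adjoint f^*(x,t) = conj(f(φ(t,x), −t)). If ∂_x^j f(0,t) = 0 for all 0 ≤ j < p and all t ∈ ℝ, then ∂_x^j f^*(0,t) = 0 for all 0 ≤ j < p and all t ∈ ℝ. (The ideal of functions vanishing to order p on the isotropy group {0} × ℝ is *-invariant.) -/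
theorem iteratedDeriv_comp_eq_zero_s8 {F : Type*} [NormedAddCommGroup F] [NormedSpace ℝ F]
    {g : ℝ → F} {h : ℝ → ℝ} {n : ℕ} {x : ℝ} (hg : ContDiff ℝ n g) (hh : ContDiff ℝ n h)
    (hvan : ∀ i ≤ n, iteratedDeriv i g (h x) = 0) :
    iteratedDeriv n (g ∘ h) x = 0 := by
  have hnonneg : ∀ i ∈ Finset.range (n + 1), 0 ≤ ‖iteratedFDeriv ℝ i h x‖ :=
    fun _ _ => norm_nonneg _
  have hbound : ‖iteratedFDeriv ℝ n (g ∘ h) x‖ ≤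
      n.factorial * 0 * (1 + ∑ i ∈ Finset.range (n + 1), ‖iteratedFDeriv ℝ i h x‖) ^ n := by
    refine norm_iteratedFDeriv_comp_le hg hh le_rfl x (fun i hi => ?_) (fun i hi hin => ?_)
    · rw [norm_iteratedFDeriv_eq_norm_iteratedDeriv, hvan i hi, norm_zero]
    · have hle := Finset.single_le_sum hnonneg (Finset.mem_range.2 (Nat.lt_succ_of_le hin))
      have hsum := Finset.sum_nonneg hnonneg
      exact (hle.trans (by linarith)).trans (le_self_pow₀ (by linarith) (by lia))
  rw [norm_iteratedFDeriv_eq_norm_iteratedDeriv, mul_zero, zero_mul] at hbound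
  exact norm_le_zero_iff.1 hbound

/-- The ideal of functions vanishing to order `p` on the isotropy group `{0} × ℝ` is invariant
under the adjoint `f^*(x,t) = conj (f (φ(t,x), −t))` of the groupoid convolution algebra. -/
theorem statement8 (φ : ℝ × ℝ → ℝ) (hφ : ContDiff ℝ (⊤ : ℕ∞) φ)
    (hφ0 : ∀ x : ℝ, φ (0, x) = x)
    (hφflow : ∀ s t x : ℝ, φ (s + t, x) = φ (t, φ (s, x)))
    (hφfix : ∀ t : ℝ, φ (t, 0) = 0)
    (p : ℕ) (hp : 1 ≤ p)
    (f : ℝ × ℝ → ℂ) (hf : ContDiff ℝ (⊤ : ℕ∞) f) (hfc : HasCompactSupport f)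
    (hvan : ∀ j : ℕ, j < p → ∀ t : ℝ, iteratedDeriv j (fun x => f (x, t)) 0 = 0) :
    ∀ j : ℕ, j < p → ∀ t : ℝ,
      iteratedDeriv j (fun x => (starRingEnd ℂ) (f (φ (t, x), -t))) 0 = 0 := by
  intro j hj t
  have hslice : ContDiff ℝ j (fun x => f (x, -t)) :=
    (hf.comp (contDiff_id.prodMk contDiff_const)).of_le (by exact_mod_cast le_top)
  have hflow : ContDiff ℝ j (fun x => φ (t, x)) :=
    (hφ.comp (contDiff_const.prodMk contDiff_id)).of_le (by exact_mod_cast le_top)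
  have hcomp : iteratedDeriv j ((fun x => f (x, -t)) ∘ fun x => φ (t, x)) 0 = 0 :=
    iteratedDeriv_comp_eq_zero_s8 hslice hflow fun i hi => by
      rw [hφfix]
      exact hvan i (hi.trans_lt hj) (-t)
  have hconj := Complex.conjLIE.norm_iteratedFDeriv_comp_left
    ((fun x => f (x, -t)) ∘ fun x => φ (t, x)) (0 : ℝ) j
  rw [norm_iteratedFDeriv_eq_norm_iteratedDeriv, norm_iteratedFDeriv_eq_norm_iteratedDeriv,
    hcomp, norm_zero, norm_eq_zero] at hconj
  exact hconj
end

section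
/- Let k ≥ 2 be an integer, let ε > 0, let V : ℝ → ℝ be a smooth function with V(x) = x^k for all |x| < ε, and let φ : ℝ × ℝ → ℝ be smooth with φ(0,x) = x and ∂φ/∂t(t,x) = V(φ(t,x)) for all t, x. Then for every t ∈ ℝ, the function x ↦ φ(t,x) − x − t·x^k has vanishing derivatives in x at x = 0 of all orders j with 0 ≤ j ≤ k. (The flow can be written φ(t,x) = x + t·x^k + h(t,x) with h vanishing to order k+1 in x along {0} × ℝ.) -/
open Asymptotics Set Topology in
/-- A smooth function which is `o(x ^ n)` at `0` has vanishing derivatives at `0` up to order `n`. -/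
theorem iteratedDeriv_eq_zero_of_isLittleO_pow {g : ℝ → ℝ} (hg : ContDiff ℝ (⊤ : ℕ∞) g) {n : ℕ}
    (h : g =o[𝓝 0] fun x => x ^ n) : ∀ j ≤ n, iteratedDeriv j g 0 = 0 := by
  intro j
  induction j using Nat.strong_induction_on with
  | _ j ih =>
    intro hj
    have htaylor := taylor_isLittleO_univ (x₀ := 0)
      (hg.of_le (by exact_mod_cast le_top) : ContDiff ℝ j g)
    have hO : (fun x : ℝ => x ^ n) =O[𝓝 0] fun x => x ^ j := by
      rcases hj.eq_or_lt with rfl | hlt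
      · exact isBigO_refl _ _
      · exact (isLittleO_pow_pow hlt).isBigO
    have hpoly : ∀ x, taylorWithinEval g j univ 0 x
        = ((j.factorial : ℝ)⁻¹ * iteratedDeriv j g 0) * x ^ j := by
      intro x
      rw [taylor_within_apply, Finset.sum_range_succ, Finset.sum_eq_zero]
      · simp only [iteratedDerivWithin_univ, sub_zero, smul_eq_mul, zero_add]
        ring
      · intro i hi
        have hij := Finset.mem_range.1 hi
        simp [iteratedDerivWithin_univ, ih i hij (hij.le.trans hj)]
    simp only [hpoly, sub_zero] at htaylor
    have hmono : (fun x : ℝ => ((j.factorial : ℝ)⁻¹ * iteratedDeriv j g 0) * x ^ j)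
        =o[𝓝 0] fun x => x ^ j := by
      simpa using (h.trans_isBigO hO).sub htaylor
    by_contra hne
    have hc : (j.factorial : ℝ)⁻¹ * iteratedDeriv j g 0 ≠ 0 :=
      mul_ne_zero (inv_ne_zero (by positivity)) hne
    rw [isLittleO_const_mul_left_iff hc] at hmono
    have hself := hmono.mono (nhdsWithin_le_nhds (s := {(0 : ℝ)}ᶜ))
    refine isLittleO_irrefl ?_ hself
    refine Filter.Eventually.frequently ?_
    filter_upwards [self_mem_nhdsWithin] with x hx
    exact pow_ne_zero _ hx

open Set in
/-- A global integral curve of a `C¹` autonomous vector field which starts at a zero of the field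
is constant. -/
theorem eq_of_hasDerivAt_of_apply_eq_zero {V : ℝ → ℝ} (hV : ContDiff ℝ 1 V) {γ : ℝ → ℝ}
    (hγ : ∀ t, HasDerivAt γ (V (γ t)) t) (h0 : V (γ 0) = 0) (t : ℝ) : γ t = γ 0 := by
  have hcont : Continuous γ := continuous_iff_continuousAt.2 fun s => (hγ s).continuousAt
  set I : Set ℝ := Icc (-(|t| + 1)) (|t| + 1)
  have hmem0 : (0 : ℝ) ∈ Ioo (-(|t| + 1)) (|t| + 1) := by
    constructor <;> linarith [abs_nonneg t]
  have hmemt : t ∈ Ioo (-(|t| + 1)) (|t| + 1) := by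
    constructor <;> linarith [neg_abs_le t, le_abs_self t]
  obtain ⟨K, hK⟩ := (hV.locallyLipschitz.locallyLipschitzOn
    (s := γ '' I)).exists_lipschitzOnWith_of_compact (isCompact_Icc.image hcont)
  refine ODE_solution_unique_of_mem_Ioo (v := fun _ => V) (s := fun _ => γ '' I) (g := fun _ => γ 0)
    (fun _ _ => hK) hmem0 (fun s hs => ⟨hγ s, mem_image_of_mem _ (Ioo_subset_Icc_self hs)⟩)
    (fun s _ => ⟨?_, mem_image_of_mem _ (Ioo_subset_Icc_self hmem0)⟩) rfl hmemt
  simpa only [h0] using hasDerivAt_const s (γ 0)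


/-- For the flow of a vector field agreeing with `x^k·d/dx` (`k ≥ 2`) near `0`, the function
`x ↦ φ(t,x) − x − t·x^k` vanishes to order `k + 1` in `x` at `x = 0`, i.e. all its
`x`-derivatives at `0` of order `j ≤ k` vanish. -/
theorem statement9 (k : ℕ) (hk : 2 ≤ k) (ε : ℝ) (hε : 0 < ε)
    (V : ℝ → ℝ) (hV : ContDiff ℝ (⊤ : ℕ∞) V)
    (hVeq : ∀ x : ℝ, |x| < ε → V x = x ^ k)
    (φ : ℝ × ℝ → ℝ) (hφ : ContDiff ℝ (⊤ : ℕ∞) φ)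
    (hφ0 : ∀ x : ℝ, φ (0, x) = x)
    (hφd : ∀ t x : ℝ, HasDerivAt (fun t' => φ (t', x)) (V (φ (t, x))) t) :
    ∀ t : ℝ, ∀ j : ℕ, j ≤ k →
      iteratedDeriv j (fun x => φ (t, x) - x - t * x ^ k) 0 = 0 := by
  intro t
  have hfix : ∀ s, φ (s, 0) = 0 := fun s => by
    have hV0 : V (φ (0, 0)) = 0 := by
      rw [hφ0, hVeq 0 (by simpa using hε), zero_pow (by omega)]
    simpa only [hφ0] using eq_of_hasDerivAt_of_apply_eq_zero
      (hV.of_le (by exact_mod_cast le_top)) (fun s => hφd s 0) hV0 s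
  set I : Set ℝ := Set.Icc (-|t|) |t|
  have hI0 : (0 : ℝ) ∈ I := ⟨by simp, by simp⟩
  have hIt : t ∈ I := ⟨neg_abs_le t, le_abs_self t⟩
  obtain ⟨K, hK⟩ := ((hφ.of_le (by exact_mod_cast le_top) : ContDiff ℝ 1 φ)
    |>.locallyLipschitz.locallyLipschitzOn
    (s := I ×ˢ Set.Icc (-1) 1)).exists_lipschitzOnWith_of_compact
      (isCompact_Icc.prod isCompact_Icc)
  obtain ⟨C, hC1, hC⟩ : ∃ C : ℝ, 1 ≤ C ∧ ∀ s ∈ I, ∀ x, |x| ≤ 1 → |φ (s, x)| ≤ C * |x| := by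
    refine ⟨K + 1, by simp, fun s hs x hx => ?_⟩
    have h := hK.dist_le_mul (s, x) ⟨hs, abs_le.1 hx⟩ (s, 0) ⟨hs, by norm_num⟩
    rw [Prod.dist_eq, hfix] at h
    simp only [dist_self, dist_zero_right, Real.norm_eq_abs, abs_nonneg, sup_of_le_right] at h
    nlinarith [abs_nonneg x]
  have hbound : ∀ x, |x| ≤ 1 → C * |x| < ε →
      |φ (t, x) - x - t * x ^ k| ≤ C ^ k * |t| * k * C ^ (k - 1) * |t| * |x ^ (k + 1)| := by
    intro x hx hxε
    have hVφ : ∀ s ∈ I, V (φ (s, x)) = φ (s, x) ^ k := fun s hs =>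
      hVeq _ ((hC s hs x hx).trans_lt hxε)
    have hclose : ∀ s ∈ I, |φ (s, x) - x| ≤ (C * |x|) ^ k * |t| := by
      intro s hs
      have h := (convex_Icc (-|t|) |t|).norm_image_sub_le_of_norm_hasDerivWithin_le
        (f := fun s => φ (s, x)) (C := (C * |x|) ^ k)
        (fun s _ => (hφd s x).hasDerivWithinAt) (fun s hs => ?_) hI0 hs
      · simp only [hφ0, sub_zero, Real.norm_eq_abs] at h
        exact h.trans (mul_le_mul_of_nonneg_left (abs_le.2 hs) (by positivity))
      · rw [hVφ s hs, norm_pow]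
        gcongr
        exact hC s hs x hx
    have h := (convex_Icc (-|t|) |t|).norm_image_sub_le_of_norm_hasDerivWithin_le
      (f := fun s => φ (s, x) - x - s * x ^ k)
      (C := (C * |x|) ^ k * |t| * k * (C * |x|) ^ (k - 1))
      (fun s _ => (((hφd s x).sub_const x).sub
        ((hasDerivAt_id s).mul_const (x ^ k))).hasDerivWithinAt) (fun s hs => ?_) hI0 hIt
    · simp only [hφ0, sub_zero, sub_self, zero_mul, Real.norm_eq_abs] at h
      refine h.trans ?_
      have hpow : |x| ^ k * |x| ^ (k - 1) ≤ |x| ^ (k + 1) := by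
        rw [← pow_add]
        exact pow_le_pow_of_le_one (abs_nonneg x) hx (by omega)
      calc (C * |x|) ^ k * |t| * k * (C * |x|) ^ (k - 1) * |t|
          = C ^ k * |t| * k * C ^ (k - 1) * |t| * (|x| ^ k * |x| ^ (k - 1)) := by
            rw [mul_pow, mul_pow]; ring
        _ ≤ _ := by rw [abs_pow]; gcongr
    · rw [hVφ s hs, one_mul, Real.norm_eq_abs]
      refine (abs_pow_sub_pow_le ..).trans ?_
      gcongr
      · exact hclose s hs
      · exact max_le (hC s hs x hx) (le_mul_of_one_le_left (abs_nonneg x) hC1)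
  have hsmooth : ContDiff ℝ (⊤ : ℕ∞) fun x => φ (t, x) - x - t * x ^ k := by fun_prop
  refine iteratedDeriv_eq_zero_of_isLittleO_pow hsmooth (Asymptotics.IsBigO.trans_isLittleO ?_
    (Asymptotics.isLittleO_pow_pow (Nat.lt_succ_self k)))
  refine Asymptotics.IsBigO.of_bound (C ^ k * |t| * k * C ^ (k - 1) * |t|) ?_
  have hcont : Continuous fun x : ℝ => C * |x| := by fun_prop
  filter_upwards [(continuous_abs.tendsto (0 : ℝ)).eventually_le_const (u := 1) (by simp),
    (hcont.tendsto 0).eventually_lt_const (u := ε) (by simpa using hε)] with x hx hxε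
  exact hbound x hx hxε
end

section
/- Let ε > 0, let V : ℝ → ℝ be a smooth function with V(x) = x for all |x| < ε, and let φ : ℝ × ℝ → ℝ be a smooth global flow of V (φ(0,x) = x, ∂φ/∂t(t,x) = V(φ(t,x)), φ(s+t,x) = φ(t,φ(s,x))). Then ∂φ/∂x(t,0) = e^t for all t, and for all smooth compactly supported f, g : ℝ × ℝ → ℂ and all t ∈ ℝ: ∂_x(f*g)(0,t) = ∫_ℝ e^s·∂_x f(0,t−s)·g(0,s) ds + ∫_ℝ f(0,t−s)·∂_x g(0,s) ds. (In the quotient of the smooth convolution algebra of F^1_ℝ by functions vanishing to second order at x = 0, the product is determined by the relation x·f = Δ(f)·x where Δ(f)(t) = e^t f(t).) -/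
open MeasureTheory

/-- A function whose derivative equals itself on a symmetric interval is exponential there. -/
lemma eq_exp_mul_of_hasDerivAt_self {u : ℝ → ℝ} {δ : ℝ}
    (hu : ∀ s, |s| < δ → HasDerivAt u (u s) s) {s : ℝ} (hs : |s| < δ) :
    u s = Real.exp s * u 0 := by
  have hd : ∀ r ∈ Metric.ball (0 : ℝ) δ, HasDerivAt (fun r => u r * Real.exp (-r)) 0 r := by
    intro r hr
    have h := (hu r (by simpa using hr)).mul (hasDerivAt_neg r).exp
    exact h.congr_deriv (by ring)
  have h0 : (0 : ℝ) ∈ Metric.ball (0 : ℝ) δ :=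
    Metric.mem_ball_self ((abs_nonneg s).trans_lt hs)
  have h := Metric.isOpen_ball.is_const_of_deriv_eq_zero
    (convex_ball (0 : ℝ) δ).isPreconnected
    (fun r hr => (hd r hr).differentiableAt.differentiableWithinAt)
    (fun r hr => (hd r hr).deriv) (show s ∈ Metric.ball (0 : ℝ) δ by simpa using hs) h0
  simp only [neg_zero, Real.exp_zero, mul_one] at h
  rw [← h, mul_comm, mul_assoc, ← Real.exp_add]
  simp

/-- The flow of a vector field equal to `x·d/dx` near `0` is, at each fixed time, multiplication
by `e^t` near `0`. -/
lemma eventually_flow_eq_exp_mul {ε : ℝ} (hε : 0 < ε) {V : ℝ → ℝ}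
    (hV : ∀ x : ℝ, |x| < ε → V x = x) {φ : ℝ × ℝ → ℝ} (hφ : Continuous φ)
    (hφ0 : ∀ x : ℝ, φ (0, x) = x)
    (hφd : ∀ t x : ℝ, HasDerivAt (fun t' => φ (t', x)) (V (φ (t, x))) t)
    (hφflow : ∀ s t x : ℝ, φ (s + t, x) = φ (t, φ (s, x))) (t : ℝ) :
    ∀ᶠ x in nhds (0 : ℝ), φ (t, x) = Real.exp t * x := by
  obtain ⟨δ, hδ, hsmall⟩ : ∃ δ > 0, ∀ s x : ℝ, |s| < δ → |x| < δ → |φ (s, x)| < ε := by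
    obtain ⟨δ, hδ, h⟩ := Metric.continuousAt_iff.1 (hφ.continuousAt (x := (0, 0))) ε hε
    refine ⟨δ, hδ, fun s x hs hx => ?_⟩
    have := h (x := (s, x)) (by simpa [Prod.dist_eq] using ⟨hs, hx⟩)
    simpa [hφ0] using this
  have hloc : ∀ s : ℝ, |s| < δ → ∀ᶠ x in nhds (0 : ℝ), φ (s, x) = Real.exp s * x := by
    intro s hs
    filter_upwards [Metric.ball_mem_nhds (0 : ℝ) hδ] with x hx
    have hx' : |x| < δ := by simpa using hx
    have h := eq_exp_mul_of_hasDerivAt_self (u := fun r => φ (r, x)) (δ := δ)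
      (fun r hr => by simpa only [hV _ (hsmall r x hr hx')] using hφd r x) hs
    simpa only [hφ0] using h
  have hadd : ∀ r s : ℝ, (∀ᶠ x in nhds (0 : ℝ), φ (r, x) = Real.exp r * x) →
      (∀ᶠ x in nhds (0 : ℝ), φ (s, x) = Real.exp s * x) →
      ∀ᶠ x in nhds (0 : ℝ), φ (r + s, x) = Real.exp (r + s) * x := by
    intro r s hr hs
    have hlim : Filter.Tendsto (fun x : ℝ => Real.exp r * x) (nhds 0) (nhds 0) := by
      simpa using (continuous_const_mul (Real.exp r)).tendsto (0 : ℝ)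
    filter_upwards [hr, hlim.eventually hs] with x h1 h2
    rw [hφflow, h1, h2, Real.exp_add]
    ring
  have hmul : ∀ s : ℝ, |s| < δ → ∀ n : ℕ,
      ∀ᶠ x in nhds (0 : ℝ), φ (n * s, x) = Real.exp (n * s) * x := by
    intro s hs n
    induction n with
    | zero => simp [hφ0]
    | succ n ih =>
      have := hadd _ _ ih (hloc s hs)
      simpa only [Nat.cast_succ, add_mul, one_mul] using this
  obtain ⟨n, hn⟩ := exists_nat_gt (|t| / δ)
  have hn0 : (0 : ℝ) < n := (div_nonneg (abs_nonneg t) hδ.le).trans_lt hn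
  have h := hmul (t / n) (by
    rw [abs_div, abs_of_pos hn0, div_lt_iff₀ hn0, mul_comm]
    exact (div_lt_iff₀ hδ).1 hn) n
  rwa [mul_div_cancel₀ _ hn0.ne'] at h

lemma hasDerivAt_fst_slice {F : ℝ × ℝ → ℂ} (hF : ContDiff ℝ 1 F) (x s : ℝ) :
    HasDerivAt (fun y => F (y, s)) (fderiv ℝ F (x, s) (1, 0)) x :=
  ((hF.differentiable one_ne_zero (x, s)).hasFDerivAt).comp_hasDerivAt x
    ((hasDerivAt_id x).prodMk (hasDerivAt_const x s))

lemma continuous_fderiv_fst {F : ℝ × ℝ → ℂ} (hF : ContDiff ℝ 1 F) :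
    Continuous fun p => fderiv ℝ F p (1, 0) :=
  (hF.continuous_fderiv one_ne_zero).clm_apply continuous_const

lemma HasCompactSupport.prodMk_slice {F : ℝ × ℝ → ℂ} (hF : HasCompactSupport F) (x : ℝ) :
    HasCompactSupport fun s => F (x, s) :=
  hF.comp_isClosedEmbedding
    (Isometry.of_dist_eq fun a b => by simp [Prod.dist_eq] : Isometry (Prod.mk x)).isClosedEmbedding

/-- Differentiation under the integral sign for a compactly supported `C¹` function. -/
lemma hasDerivAt_integral_of_hasCompactSupport {F : ℝ × ℝ → ℂ} (hF : ContDiff ℝ 1 F)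
    (hc : HasCompactSupport F) (x : ℝ) :
    HasDerivAt (fun y => ∫ s, F (y, s)) (∫ s, fderiv ℝ F (x, s) (1, 0)) x := by
  have hcont := continuous_fderiv_fst hF
  have hc' := hc.fderiv_apply ℝ (1, 0)
  obtain ⟨C, hC⟩ := hc'.exists_bound_of_continuous hcont
  let K : Set ℝ := Prod.snd '' tsupport fun p => fderiv ℝ F p (1, 0)
  have hK : IsCompact K := hc'.isCompact.image continuous_snd
  refine (hasDerivAt_integral_of_dominated_loc_of_deriv_le
    (F := fun y s => F (y, s)) (F' := fun y s => fderiv ℝ F (y, s) (1, 0))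
    (bound := K.indicator fun _ => C)
    (s := Set.univ) Filter.univ_mem ?_ ?_ ?_ ?_ ?_ ?_).2
  · exact .of_forall fun y =>
      (hF.continuous.comp (Continuous.prodMk_right y)).aestronglyMeasurable
  · exact (hF.continuous.comp (Continuous.prodMk_right x)).integrable_of_hasCompactSupport
      (hc.prodMk_slice x)
  · exact (hcont.comp (Continuous.prodMk_right x)).aestronglyMeasurable
  · refine .of_forall fun s y _ => ?_
    by_cases hs : s ∈ K
    · rw [Set.indicator_of_mem hs]
      exact hC (y, s)
    · rw [Set.indicator_of_notMem hs,
        image_eq_zero_of_notMem_tsupport (f := fun p => fderiv ℝ F p (1, 0))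
          fun h => hs ⟨(y, s), h, rfl⟩, norm_zero]
  · exact (integrable_indicator_iff hK.measurableSet).2
      (integrableOn_const hK.measure_lt_top.ne)
  · exact .of_forall fun s y _ => hasDerivAt_fst_slice hF y s

/-- For the flow of a vector field agreeing with `x·d/dx` near `0`: `∂φ/∂x(t,0) = e^t`, and in the
quotient of the smooth convolution algebra of `F¹_ℝ` by functions vanishing to second order at
`x = 0` the product is given by
`∂_x(f*g)(0,t) = ∫ e^s·∂_x f(0,t−s)·g(0,s) ds + ∫ f(0,t−s)·∂_x g(0,s) ds`. -/
theorem statement10 (ε : ℝ) (hε : 0 < ε)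
    (V : ℝ → ℝ) (hV : ContDiff ℝ (⊤ : ℕ∞) V)
    (hVeq : ∀ x : ℝ, |x| < ε → V x = x)
    (φ : ℝ × ℝ → ℝ) (hφ : ContDiff ℝ (⊤ : ℕ∞) φ)
    (hφ0 : ∀ x : ℝ, φ (0, x) = x)
    (hφd : ∀ t x : ℝ, HasDerivAt (fun t' => φ (t', x)) (V (φ (t, x))) t)
    (hφflow : ∀ s t x : ℝ, φ (s + t, x) = φ (t, φ (s, x))) :
    (∀ t : ℝ, deriv (fun x => φ (t, x)) 0 = Real.exp t) ∧
    (∀ f g : ℝ × ℝ → ℂ,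
      ContDiff ℝ (⊤ : ℕ∞) f → HasCompactSupport f →
      ContDiff ℝ (⊤ : ℕ∞) g → HasCompactSupport g →
      ∀ t : ℝ,
        deriv (fun x => groupoidConv φ f g (x, t)) 0 =
          (∫ s : ℝ, (Real.exp s : ℂ) * deriv (fun x => f (x, t - s)) 0 * g (0, s)) +
            (∫ s : ℝ, f (0, t - s) * deriv (fun x => g (x, s)) 0)) := by
  have hev := eventually_flow_eq_exp_mul hε hVeq hφ.continuous hφ0 hφd hφflow
  have hzero : ∀ t, φ (t, 0) = 0 := fun t => by simpa using (hev t).self_of_nhds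
  have hderiv : ∀ t, HasDerivAt (fun x => φ (t, x)) (Real.exp t) 0 := fun t =>
    (((hasDerivAt_id (0 : ℝ)).const_mul (Real.exp t)).congr_deriv (mul_one _)).congr_of_eventuallyEq
      (hev t)
  refine ⟨fun t => (hderiv t).deriv, fun f g hf hfc hg hgc t => ?_⟩
  have one_le : (1 : WithTop ℕ∞) ≤ ((⊤ : ℕ∞) : WithTop ℕ∞) := by exact_mod_cast le_top
  replace hf := hf.of_le one_le
  replace hg := hg.of_le one_le
  replace hφ := hφ.of_le one_le
  let F : ℝ × ℝ → ℂ := fun p => f (φ (p.2, p.1), t - p.2) * g p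
  have hF : ContDiff ℝ 1 F :=
    (hf.comp ((hφ.comp (contDiff_snd.prodMk contDiff_fst)).prodMk
      (contDiff_const.sub contDiff_snd))).mul hg
  have hFc : HasCompactSupport F := hgc.mul_left
  have hint := (hasDerivAt_integral_of_hasCompactSupport hF hFc 0).deriv
  have hfd : ∀ s, deriv (fun x => f (x, s)) 0 = fderiv ℝ f (0, s) (1, 0) := fun s =>
    (hasDerivAt_fst_slice hf 0 s).deriv
  have hgd : ∀ s, deriv (fun x => g (x, s)) 0 = fderiv ℝ g (0, s) (1, 0) := fun s =>
    (hasDerivAt_fst_slice hg 0 s).deriv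
  have hFd : ∀ s, fderiv ℝ F (0, s) (1, 0) =
      (Real.exp s : ℂ) * fderiv ℝ f (0, t - s) (1, 0) * g (0, s) +
        f (0, t - s) * fderiv ℝ g (0, s) (1, 0) := by
    intro s
    have h1 : HasDerivAt (fun x => f (φ (s, x), t - s))
        (Real.exp s • fderiv ℝ f (0, t - s) (1, 0)) 0 := by
      have h := hasDerivAt_fst_slice hf (φ (s, 0)) (t - s)
      have h' := h.scomp (0 : ℝ) (hderiv s)
      rwa [hzero] at h'
    have h2 := h1.mul (hasDerivAt_fst_slice hg 0 s)
    rw [hzero] at h2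
    have h3 := (hasDerivAt_fst_slice hF 0 s).unique h2
    rw [h3, Complex.real_smul]
  have hfcont := continuous_fderiv_fst hf
  have hgcont := continuous_fderiv_fst hg
  have hf0 := hf.continuous
  have hg0 := hg.continuous
  simp only [hfd, hgd]
  rw [← integral_add]
  · simp only [← hFd]
    exact hint
  · refine Continuous.integrable_of_hasCompactSupport ?_ (hgc.prodMk_slice 0).mul_left
    have := hfcont.comp (f := fun s : ℝ => ((0 : ℝ), t - s)) (by fun_prop)
    exact ((Complex.continuous_ofReal.comp Real.continuous_exp).mul this).mul
      (hg0.comp (Continuous.prodMk_right 0))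
  · refine Continuous.integrable_of_hasCompactSupport ?_
      ((hgc.fderiv_apply ℝ (1, 0)).prodMk_slice 0).mul_left
    have := hgcont.comp (Continuous.prodMk_right (0 : ℝ))
    exact (hf0.comp (f := fun s : ℝ => ((0 : ℝ), t - s)) (by fun_prop)).mul this
end

section
/- Let u : ℝ → ℝ be a continuously differentiable bijection with u'(x) > 0 for all x and u'(x) → ∞ as x → +∞. Let U : L²(ℝ,ℂ) → L²(ℝ,ℂ) be the unitary operator (Uξ)(x) = (u'(x))^{1/2}·ξ(u(x)), and let χ denote the indicator function of [0,∞). Let g₁, g₂ ∈ L¹(ℝ,ℂ), not both zero (as elements of L¹). Then the bounded operator T on L²(ℝ,ℂ) defined by Tξ = g₁ * (χ·ξ) − U⁻¹( g₂ * (χ·(Uξ)) ) is not a compact operator. (Consequently, the Wiener-Hopf algebra is not preserved under conjugation by U: its intersection with its conjugate consists only of compact operators.) -/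
open MeasureTheory

open Filter Set
open scoped Topology ENNReal ContDiff

/-- A compact operator sends some subsequence of an orthogonal sequence of constant norm to a null
sequence. -/
theorem IsCompactOperator.exists_subseq_tendsto_zero {H : Type*} [NormedAddCommGroup H]
    [InnerProductSpace ℂ H] [CompleteSpace H] (T : H →L[ℂ] H) (hT : IsCompactOperator T)
    (x : ℕ → H) (c : ℝ) (hx : ∀ n, ‖x n‖ = c)
    (hort : Pairwise fun m n => inner ℂ (x m) (x n) = 0) :
    ∃ φ : ℕ → ℕ, StrictMono φ ∧ Tendsto (fun n => T (x (φ n))) atTop (𝓝 0) := by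
  rcases eq_or_ne c 0 with rfl | hc
  · refine ⟨id, strictMono_id, ?_⟩
    simp [fun n => norm_eq_zero.1 (hx n)]
  have hweak : ∀ z : H, Tendsto (fun n => inner ℂ (x n) z) atTop (𝓝 0) := by
    intro z
    have horth : Orthonormal ℂ fun n => ((c : ℂ)⁻¹) • x n := by
      refine ⟨fun n => ?_, fun m n hmn => ?_⟩
      · have hc0 : 0 ≤ c := hx n ▸ norm_nonneg _
        simp [norm_smul, hx n, abs_of_nonneg hc0, hc]
      · simp [inner_smul_left, inner_smul_right, hort hmn]
    have h1 := (horth.inner_products_summable z).tendsto_atTop_zero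
    have h2 : Tendsto (fun n => inner ℂ (((c : ℂ)⁻¹) • x n) z) atTop (𝓝 0) := by
      rw [tendsto_zero_iff_norm_tendsto_zero]
      simpa only [Real.sqrt_sq (norm_nonneg _), Real.sqrt_zero] using h1.sqrt
    have h3 : ∀ n, (c : ℂ) * inner ℂ (((c : ℂ)⁻¹) • x n) z = inner ℂ (x n) z := fun n => by
      simp [mul_left_comm (c : ℂ), hc]
    simpa only [h3, mul_zero] using h2.const_mul (c : ℂ)
  obtain ⟨K, hK, hKsub⟩ := hT.image_closedBall_subset_compact (f := (T : H →ₗ[ℂ] H)) c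
  obtain ⟨y, -, φ, hφ, hy⟩ := hK.tendsto_subseq (x := fun n => T (x n))
    fun n => hKsub ⟨x n, by simp [hx n], rfl⟩
  refine ⟨φ, hφ, ?_⟩
  have hy0 : y = 0 := by
    have h1 : Tendsto (fun n => inner ℂ (T (x (φ n))) y) atTop (𝓝 (inner ℂ y y)) :=
      hy.inner tendsto_const_nhds
    have h2 : Tendsto (fun n => inner ℂ (T (x (φ n))) y) atTop (𝓝 0) := by
      simp_rw [← ContinuousLinearMap.adjoint_inner_right]
      exact (hweak _).comp hφ.tendsto_atTop
    exact inner_self_eq_zero.1 (tendsto_nhds_unique h1 h2)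
  exact hy0 ▸ hy

theorem continuous_integral_mul_of_hasCompactSupport {g : ℝ → ℂ} (hg : Integrable g) {f : ℝ → ℝ}
    (hf : Continuous f) (hfs : HasCompactSupport f) :
    Continuous fun t => ∫ s, g (t - s) * (f s : ℂ) := by
  have h1 : HasCompactSupport fun s => (f s : ℂ) :=
    hfs.comp_left (g := fun x : ℝ => (x : ℂ)) (by simp)
  have := h1.continuous_convolution_left (ContinuousLinearMap.mul ℂ ℂ) (μ := volume)
    (by fun_prop) hg.locallyIntegrable
  exact this.congr fun t => by simp [convolution_def, mul_comm]

/-- An integrable function whose convolution with test functions vanishes weakly is zero. -/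
theorem ae_eq_zero_of_integral_mul_convolution_eq_zero {g : ℝ → ℂ} (hg : Integrable g)
    (H : ∀ f h : ℝ → ℝ, ContDiff ℝ ∞ f → HasCompactSupport f → ContDiff ℝ ∞ h →
      HasCompactSupport h → ∫ t, (h t : ℂ) * ∫ s, g (t - s) * (f s : ℂ) = 0) :
    g =ᵐ[volume] 0 := by
  have hzero : ∀ f : ℝ → ℝ, ContDiff ℝ ∞ f → HasCompactSupport f →
      ∫ s, g (-s) * (f s : ℂ) = 0 := by
    intro f hf hfs
    have hc := continuous_integral_mul_of_hasCompactSupport hg hf.continuous hfs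
    have h1 := ae_eq_zero_of_integral_contDiff_smul_eq_zero (μ := volume) hc.locallyIntegrable
      fun h hh hhs => by simpa using H f h hf hfs hh hhs
    have h2 := (hc.ae_eq_iff_eq volume continuous_const).1 h1
    simpa using congrFun h2 0
  have h1 := ae_eq_zero_of_integral_contDiff_smul_eq_zero (μ := volume)
    (f := fun s => g (-s)) hg.comp_neg.locallyIntegrable
    fun f hf hfs => by simpa [mul_comm] using hzero f hf hfs
  have h2 := (Measure.measurePreserving_neg (volume : Measure ℝ)).quasiMeasurePreserving.ae h1
  filter_upwards [h2] with x hx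
  simpa using hx

/-- The test function `f` translated by `a` and transported by the unitary induced by `w`. -/
noncomputable def wavePacket (w f : ℝ → ℝ) (a : ℝ) (t : ℝ) : ℂ :=
  ((√(deriv w t) * f (w t - a) : ℝ) : ℂ)

theorem lintegral_comp_diffeo {w : ℝ → ℝ} (hw : ContDiff ℝ 1 w) (hbij : Function.Bijective w)
    (hw' : ∀ x, 0 < deriv w x) (F : ℝ → ℝ≥0∞) :
    ∫⁻ x, ENNReal.ofReal (deriv w x) * F (w x) = ∫⁻ x, F x := by
  have h := lintegral_image_eq_lintegral_abs_deriv_mul (s := univ) (f := w) (f' := deriv w)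
    MeasurableSet.univ
    (fun x _ => (hw.differentiable one_ne_zero x).hasDerivAt.hasDerivWithinAt)
    hbij.injective.injOn F
  simpa [image_univ, hbij.surjective.range_eq, abs_of_pos (hw' _)] using h.symm

theorem integral_comp_diffeo {w : ℝ → ℝ} (hw : ContDiff ℝ 1 w) (hbij : Function.Bijective w)
    (hw' : ∀ x, 0 < deriv w x) (F : ℝ → ℂ) :
    ∫ x, ((deriv w x : ℝ) : ℂ) * F (w x) = ∫ x, F x := by
  have h := integral_image_eq_integral_abs_deriv_smul (s := univ) (f := w) (f' := deriv w)
    MeasurableSet.univ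
    (fun x _ => (hw.differentiable one_ne_zero x).hasDerivAt.hasDerivWithinAt)
    hbij.injective.injOn F
  simpa [image_univ, hbij.surjective.range_eq, abs_of_pos (hw' _)] using h.symm

theorem memLp_wavePacket {w f : ℝ → ℝ} (hw : ContDiff ℝ 1 w) (hbij : Function.Bijective w)
    (hw' : ∀ x, 0 < deriv w x) (hf : Continuous f) (hfs : HasCompactSupport f) (a : ℝ) :
    MemLp (wavePacket w f a) 2 volume := by
  have hd : Continuous (deriv w) := hw.continuous_deriv le_rfl
  have hwc := hw.continuous
  have hmono : StrictMono w := strictMono_of_deriv_pos hw'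
  let e : ℝ ≃ₜ ℝ := (hmono.orderIsoOfSurjective w hbij.surjective).toHomeomorph
  have h1 : HasCompactSupport fun t => f (w t - a) := by
    have := hfs.comp_homeomorph (e.trans (Homeomorph.subRight a))
    exact this
  have h2 : HasCompactSupport (wavePacket w f a) :=
    (h1.mul_left (f := fun t => √(deriv w t))).comp_left (g := fun x : ℝ => (x : ℂ)) (by simp)
  refine Continuous.memLp_of_hasCompactSupport ?_ h2
  unfold wavePacket
  fun_prop

theorem lintegral_enorm_wavePacket {w f : ℝ → ℝ} (hw : ContDiff ℝ 1 w)
    (hbij : Function.Bijective w) (hw' : ∀ x, 0 < deriv w x) (a : ℝ) :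
    ∫⁻ t, ‖wavePacket w f a t‖ₑ ^ (2 : ℝ) = ∫⁻ t, ‖f t‖ₑ ^ (2 : ℝ) := by
  rw [← lintegral_sub_right_eq_self (fun t => ‖f t‖ₑ ^ (2 : ℝ)) a,
    ← lintegral_comp_diffeo hw hbij hw' (fun t => ‖f (t - a)‖ₑ ^ (2 : ℝ))]
  congr 1 with t
  have h : ‖wavePacket w f a t‖ₑ = ENNReal.ofReal (√(deriv w t)) * ‖f (w t - a)‖ₑ := by
    rw [← Real.enorm_of_nonneg (Real.sqrt_nonneg _), ← enorm_mul, wavePacket,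
      ← enorm_norm, Complex.norm_real, enorm_norm]
  rw [h, ENNReal.mul_rpow_of_nonneg _ _ (by norm_num),
    ENNReal.ofReal_rpow_of_nonneg (Real.sqrt_nonneg _) (by norm_num), Real.rpow_two,
    Real.sq_sqrt (hw' t).le]

theorem wavePacket_mul_eq_zero {w f : ℝ → ℝ} {R : ℝ} (hf : ∀ x, R < |x| → f x = 0) {a b : ℝ}
    (hab : 2 * R < |a - b|) (t : ℝ) : wavePacket w f a t * wavePacket w f b t = 0 := by
  have : f (w t - a) = 0 ∨ f (w t - b) = 0 := by
    by_contra! hc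
    have h1 : |w t - a| ≤ R := not_lt.1 fun h => hc.1 (hf _ h)
    have h2 : |w t - b| ≤ R := not_lt.1 fun h => hc.2 (hf _ h)
    have h3 := abs_sub (w t - b) (w t - a)
    rw [show w t - b - (w t - a) = a - b by ring] at h3
    linarith
  rcases this with h | h <;> simp [wavePacket, h]

theorem HasCompactSupport.exists_bound_support {f : ℝ → ℝ} (hf : HasCompactSupport f) :
    ∃ R > 0, ∀ x, R < |x| → f x = 0 := by
  obtain ⟨R, hR, h⟩ := hf.isCompact.isBounded.subset_closedBall_lt 0 0
  refine ⟨R, hR, fun x hx => image_eq_zero_of_notMem_tsupport fun hmem => ?_⟩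
  have := h hmem
  simp at this
  linarith

/-- Matrix coefficients of a compact operator along escaping wave packets tend to zero. -/
theorem IsCompactOperator.exists_wavePacket_tendsto_zero
    {T : Lp ℂ 2 (volume : Measure ℝ) →L[ℂ] Lp ℂ 2 (volume : Measure ℝ)}
    (hT : IsCompactOperator T) {w f h : ℝ → ℝ} (hw : ContDiff ℝ 1 w)
    (hbij : Function.Bijective w) (hw' : ∀ x, 0 < deriv w x) (hf : Continuous f)
    (hfs : HasCompactSupport f) (hh : Continuous h) (hhs : HasCompactSupport h) :
    ∃ (a : ℕ → ℝ) (ξ : ℕ → Lp ℂ 2 (volume : Measure ℝ)), Tendsto a atTop atTop ∧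
      (∀ n, ξ n =ᵐ[volume] wavePacket w f (a n)) ∧
      (∀ n, Integrable fun t => wavePacket w h (a n) t * T (ξ n) t) ∧
      Tendsto (fun n => ∫ t, wavePacket w h (a n) t * T (ξ n) t) atTop (𝓝 0) := by
  obtain ⟨R, hR, hRf⟩ := hfs.exists_bound_support
  have hmf := fun a => memLp_wavePacket hw hbij hw' hf hfs a
  have hmh := fun a => memLp_wavePacket hw hbij hw' hh hhs a
  have hnorm : ∀ {k : ℝ → ℝ} (hk : ∀ a, MemLp (wavePacket w k a) 2 volume) (a : ℝ),
      ‖(hk a).toLp‖ = ((∫⁻ t, ‖k t‖ₑ ^ (2 : ℝ)) ^ (1 / (2 : ℝ))).toReal := by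
    intro k hk a
    rw [Lp.norm_toLp, eLpNorm_eq_lintegral_rpow_enorm_toReal (by simp) (by simp)]
    simp only [ENNReal.toReal_ofNat]
    rw [lintegral_enorm_wavePacket hw hbij hw']
  obtain ⟨φ, hφ, hlim⟩ := hT.exists_subseq_tendsto_zero T
    (fun n : ℕ => (hmf (3 * R * n)).toLp) _ (fun n => hnorm hmf _) (by
      intro m n hmn
      rw [L2.inner_def]
      refine (integral_congr_ae ?_).trans (integral_zero ℝ ℂ)
      filter_upwards [(hmf (3 * R * m)).coeFn_toLp, (hmf (3 * R * n)).coeFn_toLp] with t h1 h2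
      rw [h1, h2]
      have hmn' : (1 : ℝ) ≤ |(m : ℝ) - n| := by
        have : (1 : ℤ) ≤ |(m : ℤ) - n| := Int.one_le_abs (sub_ne_zero.2 (by exact_mod_cast hmn))
        exact_mod_cast this
      have := wavePacket_mul_eq_zero (w := w) hRf (a := 3 * R * m) (b := 3 * R * n) (by
        rw [← mul_sub, abs_mul, abs_of_pos (by positivity)]
        nlinarith) t
      simpa [wavePacket, or_comm] using this)
  have hinner : ∀ (a : ℝ) (F : Lp ℂ 2 (volume : Measure ℝ)),
      (fun t => inner ℂ ((hmh a).toLp _ t) (F t)) =ᵐ[volume] fun t => wavePacket w h a t * F t := by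
    intro a F
    filter_upwards [(hmh a).coeFn_toLp] with t ht
    rw [ht]
    simp [wavePacket, mul_comm]
  refine ⟨fun n => 3 * R * φ n, fun n => (hmf (3 * R * φ n)).toLp, ?_, fun n => MemLp.coeFn_toLp _,
    fun n => (L2.integrable_inner _ _).congr (hinner _ _), ?_⟩
  · exact (tendsto_natCast_atTop_atTop.comp hφ.tendsto_atTop).const_mul_atTop (by positivity)
  · have heq : ∀ n, ∫ t, wavePacket w h (3 * R * φ n) t * T ((hmf (3 * R * φ n)).toLp) t =
        inner ℂ (hmh (3 * R * φ n)).toLp (T ((hmf (3 * R * φ n)).toLp)) := fun n => by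
      rw [L2.inner_def]
      exact (integral_congr_ae (hinner _ _)).symm
    simp_rw [heq]
    refine squeeze_zero_norm (fun n => norm_inner_le_norm _ _) ?_
    simp_rw [hnorm hmh]
    simpa using hlim.norm.const_mul _

theorem leftInverse_regularity {u v : ℝ → ℝ} (hu : ContDiff ℝ 1 u)
    (hubij : Function.Bijective u) (hu' : ∀ x, 0 < deriv u x) (huv : ∀ x, u (v x) = x) :
    ContDiff ℝ 1 v ∧ ∀ t, deriv v t = (deriv u (v t))⁻¹ := by
  have hmono : StrictMono u := strictMono_of_deriv_pos hu'
  let e : ℝ ≃ₜ ℝ := (hmono.orderIsoOfSurjective u hubij.surjective).toHomeomorph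
  have hve : v = e.symm := by
    ext x
    apply e.injective
    rw [e.apply_symm_apply]
    exact huv x
  have hvc : Continuous v := hve ▸ e.symm.continuous
  have hd : ∀ t, HasDerivAt v (deriv u (v t))⁻¹ t := fun t =>
    HasDerivAt.of_local_left_inverse hvc.continuousAt
      (hu.differentiable one_ne_zero _).hasDerivAt (hu' _).ne' (Eventually.of_forall huv)
  refine ⟨contDiff_one_iff_deriv.2 ⟨fun t => (hd t).differentiableAt, ?_⟩, fun t => (hd t).deriv⟩
  rw [show deriv v = fun t => (deriv u (v t))⁻¹ from funext fun t => (hd t).deriv]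
  exact ((hu.continuous_deriv le_rfl).comp hvc).inv₀ fun t => (hu' _).ne'

theorem ae_comp_of_differentiable_inverse {u v : ℝ → ℝ} (hv : Differentiable ℝ v)
    (hvu : ∀ x, v (u x) = x) {P : ℝ → Prop} (hP : ∀ᵐ x, P x) : ∀ᵐ x, P (u x) := by
  have h := addHaar_image_eq_zero_of_differentiableOn_of_addHaar_eq_zero volume
    hv.differentiableOn (ae_iff.1 hP)
  have hsub : {x | ¬ P (u x)} ⊆ v '' {x | ¬ P x} := fun x hx => ⟨u x, hx, hvu x⟩
  exact ae_iff.2 (measure_mono_null hsub h)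

theorem setLIntegral_preimage_deriv {u : ℝ → ℝ} (hu : ContDiff ℝ 1 u)
    (hubij : Function.Bijective u) (hu' : ∀ x, 0 < deriv u x) {s : Set ℝ} (hs : MeasurableSet s) :
    ∫⁻ x in u ⁻¹' s, ENNReal.ofReal (deriv u x) = volume s := by
  rw [← lintegral_indicator_one hs, ← lintegral_comp_diffeo hu hubij hu',
    ← lintegral_indicator (hu.continuous.measurable hs)]
  congr 1 with x
  by_cases hx : u x ∈ s <;> simp [indicator, hx]

theorem tendsto_volume_preimage_Icc {u : ℝ → ℝ} (hu : ContDiff ℝ 1 u)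
    (hubij : Function.Bijective u) (hu' : ∀ x, 0 < deriv u x)
    (hulim : Tendsto (deriv u) atTop atTop) (R : ℝ) :
    Tendsto (fun a => volume (u ⁻¹' Icc (a - R) (a + R))) atTop (𝓝 0) := by
  have hmono : StrictMono u := strictMono_of_deriv_pos hu'
  have hmeas : ∀ a, MeasurableSet (u ⁻¹' Icc (a - R) (a + R)) := fun a =>
    hu.continuous.measurable measurableSet_Icc
  have hbound : ∀ K > 0, ∀ᶠ a in atTop,
      volume (u ⁻¹' Icc (a - R) (a + R)) ≤ ENNReal.ofReal (2 * R / K) := by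
    intro K hK
    obtain ⟨X, hX⟩ := eventually_atTop.1 (hulim.eventually_ge_atTop K)
    filter_upwards [eventually_ge_atTop (u X + R)] with a ha
    have h1 : ENNReal.ofReal K * volume (u ⁻¹' Icc (a - R) (a + R)) ≤ ENNReal.ofReal (2 * R) := by
      calc ENNReal.ofReal K * volume (u ⁻¹' Icc (a - R) (a + R))
          = ∫⁻ _ in u ⁻¹' Icc (a - R) (a + R), ENNReal.ofReal K := by rw [setLIntegral_const]
        _ ≤ ∫⁻ x in u ⁻¹' Icc (a - R) (a + R), ENNReal.ofReal (deriv u x) := by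
          refine setLIntegral_mono' (hmeas a) fun x hx => ENNReal.ofReal_le_ofReal (hX x ?_)
          exact hmono.le_iff_le.1 (by linarith [hx.1])
        _ = ENNReal.ofReal (2 * R) := by
          rw [setLIntegral_preimage_deriv hu hubij hu' measurableSet_Icc, Real.volume_Icc]
          congr 1
          ring
    rw [ENNReal.ofReal_div_of_pos hK, ENNReal.le_div_iff_mul_le (by simp [hK]) (by simp), mul_comm]
    exact h1
  refine ENNReal.tendsto_nhds_zero.2 fun ε hε => ?_
  have hlim : Tendsto (fun K : ℝ => ENNReal.ofReal (2 * R / K)) atTop (𝓝 0) := by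
    simpa using ENNReal.tendsto_ofReal (tendsto_const_nhds.div_atTop tendsto_id)
  obtain ⟨K, hKε, hK⟩ := ((ENNReal.tendsto_nhds_zero.1 hlim ε hε).and
    (eventually_gt_atTop 0)).exists
  exact (hbound K hK).mono fun a ha => ha.trans hKε

theorem setLIntegral_setLIntegral_kernel_le {d : ℝ → ℝ} (hd : Continuous d) {g : ℝ → ℂ}
    (hg : AEStronglyMeasurable g) {A : Set ℝ} {ε : ℝ≥0∞}
    (h1 : ∀ x, ∫⁻ s in A, ‖g (x - s)‖ₑ ≤ ε) (h2 : ∀ s, ∫⁻ x in A, ‖g (x - s)‖ₑ ≤ ε) :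
    ∫⁻ x in A, ∫⁻ s in A, ENNReal.ofReal √(d x) * ENNReal.ofReal √(d s) * ‖g (x - s)‖ₑ ≤
      2 * (ε * ∫⁻ x in A, ENNReal.ofReal (d x)) := by
  have hgm : AEMeasurable (fun p : ℝ × ℝ => ‖g (p.1 - p.2)‖ₑ)
      ((volume.restrict A).prod (volume.restrict A)) := by
    have : AEMeasurable (fun p : ℝ × ℝ => ‖g (p.1 - p.2)‖ₑ) (volume.prod volume) :=
      (hg.comp_quasiMeasurePreserving (quasiMeasurePreserving_sub volume volume)).enorm
    rw [Measure.prod_restrict]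
    exact this.restrict
  have hsl : ∀ x, AEMeasurable (fun s => ‖g (x - s)‖ₑ) (volume.restrict A) := fun x =>
    (hg.comp_quasiMeasurePreserving
      (quasiMeasurePreserving_sub_left volume x)).enorm.restrict
  have hdm : Measurable fun x => ENNReal.ofReal (d x) := hd.measurable.ennreal_ofReal
  have hε : ∀ (p : ℝ → ℝ≥0∞), (∀ x, p x ≤ ε) →
      ∫⁻ x in A, ENNReal.ofReal (d x) * p x ≤ ε * ∫⁻ x in A, ENNReal.ofReal (d x) := by
    intro p hp
    rw [← lintegral_const_mul _ hdm]
    exact lintegral_mono fun x => by rw [mul_comm]; gcongr; exact hp x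
  have hsqrt : ∀ {a b c : ℝ}, a ≤ c → b ≤ c →
      ENNReal.ofReal √a * ENNReal.ofReal √b ≤ ENNReal.ofReal c := by
    intro a b c ha hb
    rcases le_total c 0 with hc | hc
    · simp [Real.sqrt_eq_zero_of_nonpos (ha.trans hc)]
    · calc ENNReal.ofReal √a * ENNReal.ofReal √b ≤ ENNReal.ofReal √c * ENNReal.ofReal √c := by
            gcongr
        _ = ENNReal.ofReal c := by
            rw [← ENNReal.ofReal_mul (Real.sqrt_nonneg _), Real.mul_self_sqrt hc]
  calc _ ≤ ∫⁻ x in A, ∫⁻ s in A, (ENNReal.ofReal (d x) * ‖g (x - s)‖ₑ +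
        ENNReal.ofReal (d s) * ‖g (x - s)‖ₑ) := by
        refine lintegral_mono fun x => lintegral_mono fun s => ?_
        rw [← add_mul]
        gcongr
        rcases le_total (d x) (d s) with h | h
        · exact (hsqrt h le_rfl).trans le_add_self
        · exact (hsqrt le_rfl h).trans le_self_add
    _ = (∫⁻ x in A, ∫⁻ s in A, ENNReal.ofReal (d x) * ‖g (x - s)‖ₑ) +
        ∫⁻ x in A, ∫⁻ s in A, ENNReal.ofReal (d s) * ‖g (x - s)‖ₑ := by
        rw [← lintegral_add_left']
        · congr 1 with x
          rw [lintegral_add_left']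
          exact (hsl x).const_mul _
        · exact ((hdm.comp measurable_fst).aemeasurable.mul hgm).lintegral_prod_right'
    _ = (∫⁻ x in A, ENNReal.ofReal (d x) * ∫⁻ s in A, ‖g (x - s)‖ₑ) +
        ∫⁻ s in A, ENNReal.ofReal (d s) * ∫⁻ x in A, ‖g (x - s)‖ₑ := by
        congr 1
        · congr 1 with x
          rw [lintegral_const_mul' _ _ ENNReal.ofReal_ne_top]
        · rw [lintegral_lintegral_swap
            ((hdm.comp measurable_snd).aemeasurable.mul hgm)]
          congr 1 with s
          rw [lintegral_const_mul' _ _ ENNReal.ofReal_ne_top]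
    _ ≤ _ := by
        rw [two_mul]
        exact add_le_add (hε _ h1) (hε _ h2)

theorem exists_forall_setLIntegral_translate_le {g : ℝ → ℂ} (hg : Integrable g) {ε : ℝ≥0∞}
    (hε : ε ≠ 0) : ∃ δ > 0, ∀ A : Set ℝ, MeasurableSet A → volume A < δ →
      (∀ x, ∫⁻ s in A, ‖g (x - s)‖ₑ ≤ ε) ∧ ∀ s, ∫⁻ x in A, ‖g (x - s)‖ₑ ≤ ε := by
  obtain ⟨δ, hδ, h⟩ := exists_pos_setLIntegral_lt_of_measure_lt hg.2.ne hε
  refine ⟨δ, hδ, fun A hA hAδ => ⟨fun x => ?_, fun s => ?_⟩⟩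
  · have hm := Measure.measurePreserving_sub_left (volume : Measure ℝ) x
    have hA' : volume ((fun s => x - s) ⁻¹' A) < δ := by
      rwa [hm.measure_preimage hA.nullMeasurableSet]
    refine le_trans (le_of_eq ?_) (h _ hA').le
    rw [← hm.setLIntegral_comp_preimage_emb (Homeomorph.subLeft x).measurableEmbedding]
    simp
  · have hm := measurePreserving_add_right (volume : Measure ℝ) s
    have hA' : volume ((fun x => x + s) ⁻¹' A) < δ := by
      rwa [hm.measure_preimage hA.nullMeasurableSet]
    refine le_trans (le_of_eq ?_) (h _ hA').le
    rw [← hm.setLIntegral_comp_preimage_emb (Homeomorph.addRight s).measurableEmbedding]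
    simp

theorem tendsto_setLIntegral_kernel_preimage_Icc {u : ℝ → ℝ} (hu : ContDiff ℝ 1 u)
    (hubij : Function.Bijective u) (hu' : ∀ x, 0 < deriv u x)
    (hulim : Tendsto (deriv u) atTop atTop) {g : ℝ → ℂ} (hg : Integrable g) (R : ℝ) :
    Tendsto (fun a => ∫⁻ x in u ⁻¹' Icc (a - R) (a + R), ∫⁻ s in u ⁻¹' Icc (a - R) (a + R),
      ENNReal.ofReal √(deriv u x) * ENNReal.ofReal √(deriv u s) * ‖g (x - s)‖ₑ)
      atTop (𝓝 0) := by
  have hbound : ∀ ε : ℝ≥0∞, ε ≠ 0 → ∀ᶠ a in atTop,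
      (∫⁻ x in u ⁻¹' Icc (a - R) (a + R), ∫⁻ s in u ⁻¹' Icc (a - R) (a + R),
        ENNReal.ofReal √(deriv u x) * ENNReal.ofReal √(deriv u s) * ‖g (x - s)‖ₑ) ≤
      2 * (ε * ENNReal.ofReal (2 * R)) := by
    intro ε hε
    obtain ⟨δ, hδ, h⟩ := exists_forall_setLIntegral_translate_le hg hε
    filter_upwards [(tendsto_volume_preimage_Icc hu hubij hu' hulim R).eventually_lt_const hδ]
      with a ha
    obtain ⟨h1, h2⟩ := h _ (hu.continuous.measurable measurableSet_Icc) ha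
    refine (setLIntegral_setLIntegral_kernel_le (hu.continuous_deriv le_rfl) hg.1 h1 h2).trans_eq ?_
    rw [setLIntegral_preimage_deriv hu hubij hu' measurableSet_Icc, Real.volume_Icc]
    congr 3
    ring
  refine ENNReal.tendsto_nhds_zero.2 fun η hη => ?_
  have hlim : Tendsto (fun ε : ℝ≥0∞ => 2 * (ε * ENNReal.ofReal (2 * R))) (𝓝[>] 0) (𝓝 0) := by
    have : Tendsto (fun ε : ℝ≥0∞ => 2 * (ε * ENNReal.ofReal (2 * R))) (𝓝 0)
        (𝓝 (2 * (0 * ENNReal.ofReal (2 * R)))) :=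
      ENNReal.Tendsto.const_mul (ENNReal.Tendsto.mul_const tendsto_id
        (Or.inr ENNReal.ofReal_ne_top)) (by simp)
    simpa using this.mono_left nhdsWithin_le_nhds
  obtain ⟨ε, hεη, hε⟩ := ((ENNReal.tendsto_nhds_zero.1 hlim η hη).and
    self_mem_nhdsWithin).exists
  exact (hbound ε (ne_of_gt hε)).mono fun a ha => ha.trans hεη

/-- Conjugating a convolution operator by a diffeomorphism that expands at `+∞` makes its matrix
coefficients along translates tend to zero. -/
theorem tendsto_integral_conj_convolution {u v : ℝ → ℝ} (hu : ContDiff ℝ 1 u)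
    (hubij : Function.Bijective u) (hu' : ∀ x, 0 < deriv u x)
    (hulim : Tendsto (deriv u) atTop atTop) (hvu : ∀ x, v (u x) = x) {g : ℝ → ℂ}
    (hg : Integrable g) {f h : ℝ → ℝ} (hf : Continuous f) (hfs : HasCompactSupport f)
    (hh : Continuous h) (hhs : HasCompactSupport h) :
    Tendsto (fun a => ∫ t, (h (t - a) : ℂ) * (((1 / √(deriv u (v t)) : ℝ) : ℂ) *
      ∫ s, g (v t - s) * (Ici (0 : ℝ)).indicator
        (fun r => ((√(deriv u r) : ℝ) : ℂ) * (f (u r - a) : ℂ)) s)) atTop (𝓝 0) := by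
  obtain ⟨R₁, -, hR₁⟩ := hfs.exists_bound_support
  obtain ⟨R₂, -, hR₂⟩ := hhs.exists_bound_support
  obtain ⟨M₁, hM₁⟩ := hfs.exists_bound_of_continuous hf
  obtain ⟨M₂, hM₂⟩ := hhs.exists_bound_of_continuous hh
  set R := max R₁ R₂
  have hsupp : ∀ {k : ℝ → ℝ} {r : ℝ}, r ≤ R → (∀ x, r < |x| → k x = 0) → ∀ a x,
      x ∉ u ⁻¹' Icc (a - R) (a + R) → k (u x - a) = 0 := by
    intro k r hr hk a x hx
    refine hk _ (hr.trans_lt (not_le.1 fun hle => hx ?_))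
    rw [abs_le] at hle
    exact ⟨by linarith, by linarith⟩
  have hlim := tendsto_setLIntegral_kernel_preimage_Icc hu hubij hu' hulim hg R
  have hlim' := ENNReal.Tendsto.const_mul (a := ENNReal.ofReal M₂ * ENNReal.ofReal M₁) hlim
    (Or.inr (by finiteness))
  rw [mul_zero] at hlim'
  refine tendsto_zero_iff_enorm_tendsto_zero.2 (tendsto_of_tendsto_of_tendsto_of_le_of_le
    tendsto_const_nhds hlim' (fun _ => zero_le) fun a => ?_)
  set A := u ⁻¹' Icc (a - R) (a + R)
  have hAm : MeasurableSet A := hu.continuous.measurable measurableSet_Icc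
  have henorm : ∀ x : ℝ, ‖(x : ℂ)‖ₑ = ‖x‖ₑ := fun x => by
    rw [← enorm_norm, Complex.norm_real, enorm_norm]
  have hle : ∀ {x M : ℝ}, ‖x‖ ≤ M → ‖x‖ₑ ≤ ENNReal.ofReal M := fun {x M} hx => by
    rw [← ofReal_norm]; exact ENNReal.ofReal_le_ofReal hx
  refine (enorm_integral_le_lintegral_enorm _).trans ?_
  rw [← lintegral_comp_diffeo hu hubij hu', ← lintegral_const_mul' _ _ (by finiteness),
    ← lintegral_indicator hAm]
  refine lintegral_mono fun x => ?_
  by_cases hx : x ∈ A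
  · rw [indicator_of_mem hx, hvu, enorm_mul, enorm_mul, henorm, henorm]
    have hinner : ‖∫ s, g (x - s) * (Ici (0 : ℝ)).indicator
        (fun r => ((√(deriv u r) : ℝ) : ℂ) * (f (u r - a) : ℂ)) s‖ₑ ≤
        ∫⁻ s in A, ENNReal.ofReal M₁ * (ENNReal.ofReal √(deriv u s) * ‖g (x - s)‖ₑ) := by
      refine (enorm_integral_le_lintegral_enorm _).trans ?_
      rw [← lintegral_indicator hAm]
      refine lintegral_mono fun s => ?_
      by_cases hs : s ∈ A
      · rw [indicator_of_mem hs, enorm_mul]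
        calc _ ≤ ‖g (x - s)‖ₑ * ‖((√(deriv u s) : ℝ) : ℂ) * (f (u s - a) : ℂ)‖ₑ := by
              gcongr
              exact enorm_indicator_le_enorm_self _ _
          _ ≤ ‖g (x - s)‖ₑ * (ENNReal.ofReal √(deriv u s) * ENNReal.ofReal M₁) := by
              rw [enorm_mul, henorm, henorm, Real.enorm_of_nonneg (Real.sqrt_nonneg _)]
              gcongr
              exact hle (hM₁ _)
          _ = _ := by ring
      · rw [indicator_of_notMem hs]
        have h0 : f (u s - a) = 0 := hsupp (le_max_left _ _) hR₁ a s hs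
        simp [indicator, h0]
    have hsq : ENNReal.ofReal (deriv u x) * ENNReal.ofReal (1 / √(deriv u x)) =
        ENNReal.ofReal √(deriv u x) := by
      rw [← ENNReal.ofReal_mul (hu' x).le, mul_one_div, Real.div_sqrt]
    calc _ ≤ ENNReal.ofReal (deriv u x) * (ENNReal.ofReal M₂ *
          (ENNReal.ofReal (1 / √(deriv u x)) *
          ∫⁻ s in A, ENNReal.ofReal M₁ * (ENNReal.ofReal √(deriv u s) * ‖g (x - s)‖ₑ))) := by
          rw [Real.enorm_of_nonneg (by positivity : 0 ≤ 1 / √(deriv u x))]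
          gcongr
          exact hle (hM₂ _)
      _ = ENNReal.ofReal M₂ * (ENNReal.ofReal √(deriv u x) *
          ∫⁻ s in A, ENNReal.ofReal M₁ * (ENNReal.ofReal √(deriv u s) * ‖g (x - s)‖ₑ)) := by
          rw [← hsq]; ring
      _ = _ := by
          simp_rw [mul_assoc]
          rw [lintegral_const_mul' _ _ ENNReal.ofReal_ne_top,
            lintegral_const_mul' _ _ ENNReal.ofReal_ne_top]
          ring
  · have h0 : h (u x - a) = 0 := hsupp (le_max_right _ _) hR₂ a x hx
    simp [h0]

theorem indicator_Ici_translate {f : ℝ → ℝ} {R a : ℝ} (hR0 : 0 < R)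
    (hR : ∀ x, R < |x| → f x = 0) (ha : R < a) :
    (Ici (0 : ℝ)).indicator (fun r => (f (r - a) : ℂ)) = fun r => (f (r - a) : ℂ) := by
  refine indicator_eq_self.2 fun r hr => ?_
  by_contra hr0
  rw [mem_Ici, not_le] at hr0
  refine hr ?_
  have : f (r - a) = 0 := hR _ (by rw [abs_of_neg (by linarith)]; linarith)
  simp [this]

/-- Far to the right, the half-line cutoff is invisible to a translated test function. -/
theorem integral_mul_convolution_translate {g : ℝ → ℂ} {f h : ℝ → ℝ} {R a : ℝ} (hR0 : 0 < R)
    (hR : ∀ x, R < |x| → f x = 0) (ha : R < a) :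
    ∫ t, (h (t - a) : ℂ) * ∫ s, g (t - s) * (Ici (0 : ℝ)).indicator (fun r => (f (r - a) : ℂ)) s =
      ∫ t, (h t : ℂ) * ∫ s, g (t - s) * (f s : ℂ) := by
  rw [indicator_Ici_translate hR0 hR ha, ← integral_sub_right_eq_self
    (fun t => (h t : ℂ) * ∫ s, g (t - s) * (f s : ℂ)) a]
  congr 1 with t
  congr 1
  rw [← integral_sub_right_eq_self (fun s => g (t - a - s) * (f s : ℂ)) a]
  simp

theorem integrable_mul_convolution_translate {g : ℝ → ℂ} (hg : Integrable g) {f h : ℝ → ℝ}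
    {R a : ℝ} (hf : Continuous f) (hfs : HasCompactSupport f) (hh : Continuous h)
    (hhs : HasCompactSupport h) (hR0 : 0 < R) (hR : ∀ x, R < |x| → f x = 0) (ha : R < a) :
    Integrable fun t => (h (t - a) : ℂ) *
      ∫ s, g (t - s) * (Ici (0 : ℝ)).indicator (fun r => (f (r - a) : ℂ)) s := by
  rw [indicator_Ici_translate hR0 hR ha]
  have hfa : HasCompactSupport fun s => f (s - a) := hfs.comp_homeomorph (Homeomorph.subRight a)
  have hha : HasCompactSupport fun s => (h (s - a) : ℂ) :=
    (hhs.comp_homeomorph (Homeomorph.subRight a)).comp_left (g := fun x : ℝ => (x : ℂ)) (by simp)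
  have hc := continuous_integral_mul_of_hasCompactSupport hg (f := fun s => f (s - a))
    (by fun_prop) hfa
  exact Continuous.integrable_of_hasCompactSupport (by fun_prop) hha.mul_right

/-- For an orientation-preserving C¹ diffeomorphism `u` of `ℝ` with `u' → ∞` at `+∞`, the
Wiener-Hopf algebra is not preserved under conjugation by the induced unitary
`(Uξ)(x) = √(u'(x))·ξ(u(x))`: for `g₁, g₂ ∈ L¹` not both zero, the bounded operator
`ξ ↦ g₁ * (χ·ξ) − U⁻¹(g₂ * (χ·(Uξ)))` on `L²(ℝ)` is not compact. Here `v = u⁻¹`, so that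
`(U⁻¹η)(t) = η(v(t)) / √(u'(v(t)))`. -/
theorem statement13 (u v : ℝ → ℝ) (hu : ContDiff ℝ 1 u) (hubij : Function.Bijective u)
    (hu' : ∀ x : ℝ, 0 < deriv u x)
    (hulim : Filter.Tendsto (deriv u) Filter.atTop Filter.atTop)
    (hvu : ∀ x : ℝ, v (u x) = x) (huv : ∀ x : ℝ, u (v x) = x)
    (g₁ g₂ : ℝ → ℂ) (hg₁ : Integrable g₁ volume) (hg₂ : Integrable g₂ volume)
    (hne : ¬ (g₁ =ᵐ[volume] 0 ∧ g₂ =ᵐ[volume] 0))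
    (T : Lp ℂ 2 (volume : Measure ℝ) →L[ℂ] Lp ℂ 2 (volume : Measure ℝ))
    (hT : ∀ ξ : Lp ℂ 2 (volume : Measure ℝ),
      (T ξ : ℝ → ℂ) =ᵐ[volume] fun t : ℝ =>
        (∫ s : ℝ, g₁ (t - s) * (Set.Ici (0 : ℝ)).indicator (fun r => ξ r) s) -
          ((1 / Real.sqrt (deriv u (v t)) : ℝ) : ℂ) *
            (∫ s : ℝ, g₂ (v t - s) *
              (Set.Ici (0 : ℝ)).indicator
                (fun r => ((Real.sqrt (deriv u r) : ℝ) : ℂ) * ξ (u r)) s)) :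
    ¬ IsCompactOperator T := by
  intro hTc
  obtain ⟨hv, hv'⟩ := leftInverse_regularity hu hubij hu' huv
  have hcomp : ∀ {P : ℝ → Prop}, (∀ᵐ x, P x) → ∀ᵐ x, P (u x) := fun hP =>
    ae_comp_of_differentiable_inverse (hv.differentiable one_ne_zero) hvu hP
  have hg₁0 : g₁ =ᵐ[volume] 0 := by
    refine ae_eq_zero_of_integral_mul_convolution_eq_zero hg₁ fun f h hf hfs hh hhs => ?_
    obtain ⟨R, hR0, hR⟩ := hfs.exists_bound_support
    obtain ⟨a, ξ, ha, hξ, hint, hlim⟩ := hTc.exists_wavePacket_tendsto_zero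
      (w := id) contDiff_id Function.bijective_id (by simp) hf.continuous hfs hh.continuous hhs
    have hpacket : ∀ (k : ℝ → ℝ) b t, wavePacket id k b t = (k (t - b) : ℂ) := by
      simp [wavePacket]
    simp only [hpacket] at hint hlim
    have hD := (tendsto_integral_conj_convolution hu hubij hu' hulim hvu hg₂ hf.continuous hfs
      hh.continuous hhs).comp ha
    have hsum := hlim.add hD
    rw [add_zero] at hsum
    refine tendsto_nhds_unique (tendsto_const_nhds.congr' ?_) hsum
    filter_upwards [ha.eventually_gt_atTop R] with n hn
    have hC := integrable_mul_convolution_translate hg₁ hf.continuous hfs hh.continuous hhs hR0 hR hn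
    rw [← integral_mul_convolution_translate hR0 hR hn, ← sub_eq_iff_eq_add', ←
      integral_sub hC (hint n)]
    refine integral_congr_ae ?_
    filter_upwards [hT (ξ n)] with t ht
    have h1 : ∫ s, g₁ (t - s) * (Ici (0 : ℝ)).indicator (fun r => ξ n r) s =
        ∫ s, g₁ (t - s) * (Ici (0 : ℝ)).indicator (fun r => (f (r - a n) : ℂ)) s := by
      refine integral_congr_ae ?_
      filter_upwards [hξ n] with s hs
      simp only [indicator, hs, hpacket]
    have h2 : ∫ s, g₂ (v t - s) * (Ici (0 : ℝ)).indicator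
          (fun r => ((√(deriv u r) : ℝ) : ℂ) * ξ n (u r)) s =
        ∫ s, g₂ (v t - s) * (Ici (0 : ℝ)).indicator
          (fun r => ((√(deriv u r) : ℝ) : ℂ) * (f (u r - a n) : ℂ)) s := by
      refine integral_congr_ae ?_
      filter_upwards [hcomp (hξ n)] with s hs
      simp only [indicator, hs, hpacket]
    rw [ht, h1, h2]
    ring
  refine hne ⟨hg₁0, ?_⟩
  refine ae_eq_zero_of_integral_mul_convolution_eq_zero hg₂ fun f h hf hfs hh hhs => ?_
  obtain ⟨R, hR0, hR⟩ := hfs.exists_bound_support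
  have hvbij : Function.Bijective v :=
    ⟨Function.LeftInverse.injective huv, Function.RightInverse.surjective hvu⟩
  have hvpos : ∀ t, 0 < deriv v t := fun t => by rw [hv']; exact inv_pos.2 (hu' _)
  obtain ⟨a, ξ, ha, hξ, -, hlim⟩ := hTc.exists_wavePacket_tendsto_zero hv hvbij hvpos
    hf.continuous hfs hh.continuous hhs
  have hlim' := hlim.neg
  rw [neg_zero] at hlim'
  refine tendsto_nhds_unique (tendsto_const_nhds.congr' ?_) hlim'
  filter_upwards [ha.eventually_gt_atTop R] with n hn
  rw [← integral_mul_convolution_translate hR0 hR hn, ← integral_comp_diffeo hv hvbij hvpos,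
    ← integral_neg]
  refine integral_congr_ae ?_
  filter_upwards [hT (ξ n)] with t ht
  have h1 : ∫ s, g₁ (t - s) * (Ici (0 : ℝ)).indicator (fun r => ξ n r) s = 0 := by
    refine integral_eq_zero_of_ae ?_
    filter_upwards [(Measure.measurePreserving_sub_left
      (volume : Measure ℝ) t).quasiMeasurePreserving.ae hg₁0] with s hs
    simp [hs]
  have h2 : ∫ s, g₂ (v t - s) * (Ici (0 : ℝ)).indicator
        (fun r => ((√(deriv u r) : ℝ) : ℂ) * ξ n (u r)) s =
      ∫ s, g₂ (v t - s) * (Ici (0 : ℝ)).indicator (fun r => (f (r - a n) : ℂ)) s := by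
    refine integral_congr_ae ?_
    filter_upwards [hcomp (hξ n)] with s hs
    have hmul : √(deriv u s) * (√(deriv u s))⁻¹ = 1 :=
      mul_inv_cancel₀ (Real.sqrt_pos.2 (hu' s)).ne'
    simp only [indicator, hs, wavePacket, hvu, hv', Real.sqrt_inv]
    rw [← Complex.ofReal_mul, ← mul_assoc, hmul, one_mul]
  rw [ht, h1, h2, wavePacket, hv', Real.sqrt_inv]
  have hsq : (deriv u (v t))⁻¹ = (√(deriv u (v t)))⁻¹ * (√(deriv u (v t)))⁻¹ := by
    rw [← mul_inv, Real.mul_self_sqrt (hu' _).le]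
  rw [hsq]
  push_cast
  ring
end

section
/- Let f : ℝ → ℂ be a continuous function with f(t) → 1 as t → +∞ and f(t) → 0 as t → −∞, let g ∈ L¹(ℝ,ℂ), and let χ denote the indicator function of [0,∞). Then the bounded operator on L²(ℝ,ℂ) given by ξ ↦ f·(g * ξ) − χ·(g * (χ·ξ)) is a compact operator. (In the Wiener-Hopf algebra, M(f)λ(g) agrees with M(χ)λ(g)M(χ) modulo compact operators whenever f ∈ C₀(ℝ ∪ {+∞}) has f(+∞) = 1.) -/
open MeasureTheory
open scoped ENNReal

/-- Young's convolution inequality `L¹ * L² ⊆ L²` for nonnegative functions. -/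
theorem lintegral_sq_lintegral_sub_mul_le {H u : ℝ → ℝ≥0∞} (hH : Measurable H)
    (hu : Measurable u) :
    ∫⁻ t, (∫⁻ s, H (t - s) * u s) ^ 2 ≤ (∫⁻ x, H x) ^ 2 * ∫⁻ s, u s ^ 2 := by
  have translate (t : ℝ) : ∫⁻ s, H (t - s) = ∫⁻ x, H x := lintegral_sub_left_eq_self H t
  have pointwise (t : ℝ) : (∫⁻ s, H (t - s) * u s) ^ 2 ≤
      (∫⁻ x, H x) * ∫⁻ s, H (t - s) * u s ^ 2 := by
    have holder := ENNReal.lintegral_mul_norm_pow_le (μ := volume)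
      (f := fun s => H (t - s)) (g := fun s => H (t - s) * u s ^ 2)
      (by fun_prop) (by fun_prop) (p := 1 / 2) (q := 1 / 2) (by norm_num) (by norm_num)
      (by norm_num)
    have split (s : ℝ) : H (t - s) ^ (1 / 2 : ℝ) * (H (t - s) * u s ^ 2) ^ (1 / 2 : ℝ) =
        H (t - s) * u s := by
      rw [ENNReal.mul_rpow_of_nonneg _ _ (by norm_num), ← mul_assoc,
        ← ENNReal.rpow_add_of_nonneg _ _ (by norm_num) (by norm_num), ← ENNReal.rpow_natCast,
        ← ENNReal.rpow_mul]
      norm_num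
    simp only [split, translate] at holder
    calc (∫⁻ s, H (t - s) * u s) ^ 2
        ≤ ((∫⁻ x, H x) ^ (1 / 2 : ℝ) * (∫⁻ s, H (t - s) * u s ^ 2) ^ (1 / 2 : ℝ)) ^ 2 := by
          gcongr
      _ = _ := by
          rw [mul_pow, ← ENNReal.rpow_mul_natCast, ← ENNReal.rpow_mul_natCast]
          norm_num
  calc ∫⁻ t, (∫⁻ s, H (t - s) * u s) ^ 2
      ≤ ∫⁻ t, (∫⁻ x, H x) * ∫⁻ s, H (t - s) * u s ^ 2 := lintegral_mono pointwise
    _ = (∫⁻ x, H x) * ∫⁻ t, ∫⁻ s, H (t - s) * u s ^ 2 :=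
        lintegral_const_mul _ (Measurable.lintegral_prod_right' (f := fun p : ℝ × ℝ =>
          H (p.1 - p.2) * u p.2 ^ 2) (by fun_prop))
    _ = (∫⁻ x, H x) * ∫⁻ s, ∫⁻ t, H (t - s) * u s ^ 2 := by
        rw [lintegral_lintegral_swap]
        exact Measurable.aemeasurable (f := fun p : ℝ × ℝ => H (p.1 - p.2) * u p.2 ^ 2)
          (by fun_prop)
    _ = (∫⁻ x, H x) * ∫⁻ s, (∫⁻ x, H x) * u s ^ 2 := by
        congr 1
        refine lintegral_congr fun s => ?_
        rw [lintegral_mul_const _ (by fun_prop), lintegral_sub_right_eq_self H s]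
    _ = _ := by
        rw [lintegral_const_mul _ (by fun_prop)]
        ring

theorem enorm_sq_eq_lintegral (ξ : Lp ℂ 2 (volume : Measure ℝ)) :
    ‖ξ‖ₑ ^ 2 = ∫⁻ s, ‖ξ s‖ₑ ^ 2 := by
  have h := eLpNorm_nnreal_pow_eq_lintegral (f := (ξ : ℝ → ℂ)) (μ := volume) (p := 2) two_ne_zero
  rw [Lp.enorm_def]
  simpa using h

/-- The convolution integral of an integrable function and an `L²` function converges at almost
every point. -/
theorem ae_integrable_sub_mul {g : ℝ → ℂ} (hgm : StronglyMeasurable g) (hg : Integrable g volume)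
    (ξ : Lp ℂ 2 (volume : Measure ℝ)) :
    ∀ᵐ t : ℝ, Integrable (fun s => g (t - s) * ξ s) volume := by
  have hξ : Measurable ξ := (Lp.stronglyMeasurable ξ).measurable
  have hg' : Measurable g := hgm.measurable
  have young := lintegral_sq_lintegral_sub_mul_le hg'.enorm hξ.enorm
  have finite : (∫⁻ x, ‖g x‖ₑ) ^ 2 * ∫⁻ s, ‖ξ s‖ₑ ^ 2 < ∞ := by
    rw [← enorm_sq_eq_lintegral]
    exact ENNReal.mul_lt_top (ENNReal.pow_lt_top hg.2) (ENNReal.pow_lt_top enorm_lt_top)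
  have meas : Measurable fun t => (∫⁻ s, ‖g (t - s)‖ₑ * ‖ξ s‖ₑ) ^ 2 :=
    (Measurable.lintegral_prod_right' (f := fun p : ℝ × ℝ => ‖g (p.1 - p.2)‖ₑ * ‖ξ p.2‖ₑ)
      (by fun_prop)).pow_const 2
  filter_upwards [ae_lt_top meas (young.trans_lt finite).ne] with t ht
  refine ⟨by fun_prop, ?_⟩
  simp only [HasFiniteIntegral, enorm_mul]
  simpa using ht

/-- Schur's test for kernels dominated by a convolution kernel. -/
theorem norm_le_of_ae_eq_integral_mul {h : ℝ → ℝ} (hhm : Measurable h) (hh : Integrable h volume)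
    (hpos : ∀ x, 0 ≤ h x) (η ξ : Lp ℂ 2 (volume : Measure ℝ))
    (hη : ∀ᵐ t : ℝ, ∃ k : ℝ → ℂ, (∀ s, ‖k s‖ ≤ h (t - s)) ∧ η t = ∫ s, k s * ξ s) :
    ‖η‖ ≤ (∫ x, h x) * ‖ξ‖ := by
  have hξ : Measurable ξ := (Lp.stronglyMeasurable ξ).measurable
  have sq_le : ‖η‖ₑ ^ 2 ≤ ((∫⁻ x, ENNReal.ofReal (h x)) * ‖ξ‖ₑ) ^ 2 := by
    rw [enorm_sq_eq_lintegral, mul_pow, enorm_sq_eq_lintegral]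
    refine le_trans (lintegral_mono_ae ?_)
      (lintegral_sq_lintegral_sub_mul_le hhm.ennreal_ofReal hξ.enorm)
    filter_upwards [hη] with t ⟨k, hk, hkη⟩
    rw [hkη]
    gcongr
    refine (enorm_integral_le_lintegral_enorm _).trans (lintegral_mono fun s => ?_)
    rw [enorm_mul]
    gcongr
    rw [← ofReal_norm]
    exact ENNReal.ofReal_le_ofReal (hk s)
  have le := (ENNReal.pow_le_pow_left_iff two_ne_zero).1 sq_le
  rw [← ofReal_integral_eq_lintegral_ofReal hh (.of_forall hpos), ← ofReal_norm, ← ofReal_norm,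
    ← ENNReal.ofReal_mul (integral_nonneg hpos)] at le
  exact (ENNReal.ofReal_le_ofReal_iff (mul_nonneg (integral_nonneg hpos) (norm_nonneg _))).1 le

theorem integrable_mul_Lp {φ : ℝ → ℂ} (hφ : MemLp φ 2 volume)
    (ξ : Lp ℂ 2 (volume : Measure ℝ)) : Integrable (fun s => φ s * ξ s) volume :=
  hφ.integrable_mul (Lp.memLp ξ)

theorem exists_clm_eq_integral_mul {φ : ℝ → ℂ} (hφ : MemLp φ 2 volume) :
    ∃ L : Lp ℂ 2 (volume : Measure ℝ) →L[ℂ] ℂ, ∀ ξ, L ξ = ∫ s, φ s * ξ s := by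
  refine ⟨innerSL ℂ hφ.star.toLp, fun ξ => ?_⟩
  rw [innerSL_apply_apply, L2.inner_def]
  refine integral_congr_ae ?_
  filter_upwards [hφ.star.coeFn_toLp] with s hs
  rw [hs]
  simp [mul_comm]

/-- Kernels which are finite sums of products of `L²` functions define compact operators. -/
theorem exists_isCompactOperator_sum_mul_integral {ι : Type*} (I : Finset ι) {ψ φ : ι → ℝ → ℂ}
    (hψ : ∀ i, MemLp (ψ i) 2 volume) (hφ : ∀ i, MemLp (φ i) 2 volume) :
    ∃ F : Lp ℂ 2 (volume : Measure ℝ) →L[ℂ] Lp ℂ 2 (volume : Measure ℝ), IsCompactOperator F ∧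
      ∀ ξ, F ξ =ᵐ[volume] fun t => ∑ i ∈ I, ψ i t * ∫ s, φ i s * ξ s := by
  choose L hL using fun i => exists_clm_eq_integral_mul (hφ i)
  refine ⟨∑ i ∈ I, (L i).smulRight (hψ i).toLp, ?_, fun ξ => ?_⟩
  · exact (compactOperator (RingHom.id ℂ) (Lp ℂ 2 (volume : Measure ℝ))
      (Lp ℂ 2 (volume : Measure ℝ))).sum_mem (t := I)
      (f := fun i => (L i).smulRight (hψ i).toLp) fun i _ =>
        (isCompactOperator_of_locallyCompactSpace_dom (L i)).clm_comp
          ((ContinuousLinearMap.id ℂ ℂ).smulRight (hψ i).toLp)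
  · rw [sum_apply]
    have coe : ∀ᵐ t : ℝ, ∀ i ∈ I, ((L i).smulRight (hψ i).toLp ξ) t = ψ i t * L i ξ := by
      refine (Filter.eventually_all_finset I).2 fun i _ => ?_
      filter_upwards [Lp.coeFn_smul (L i ξ) (hψ i).toLp, (hψ i).coeFn_toLp] with t h1 h2
      rw [ContinuousLinearMap.smulRight_apply, h1, Pi.smul_apply, h2, smul_eq_mul, mul_comm]
    filter_upwards [Lp.coeFn_finsetSum I fun i => (L i).smulRight (hψ i).toLp ξ, coe] with t h1 h2
    rw [h1, Finset.sum_apply]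
    exact Finset.sum_congr rfl fun i hi => by rw [h2 i hi, hL]

theorem exists_bound_of_tendsto {f : ℝ → ℂ} (hf : Continuous f) {a b : ℂ}
    (htop : Filter.Tendsto f Filter.atTop (nhds a))
    (hbot : Filter.Tendsto f Filter.atBot (nhds b)) : ∃ C, 0 ≤ C ∧ ∀ t, ‖f t‖ ≤ C := by
  obtain ⟨A, hA⟩ := Filter.eventually_atTop.1 (htop.norm.eventually_lt_const (lt_add_one ‖a‖))
  obtain ⟨B, hB⟩ := Filter.eventually_atBot.1 (hbot.norm.eventually_lt_const (lt_add_one ‖b‖))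
  obtain ⟨D, hD⟩ := (isCompact_Icc (a := B) (b := A)).exists_bound_of_continuousOn hf.continuousOn
  refine ⟨max (max (‖a‖ + 1) (‖b‖ + 1)) D, le_max_of_le_left (by positivity), fun t => ?_⟩
  rcases le_total A t with h | h
  · exact (hA t h).le.trans (by simp)
  rcases le_total t B with h' | h'
  · exact (hB t h').le.trans (by simp)
  · exact (hD t ⟨h', h⟩).trans (by simp)

theorem memLp_indicator_of_bound {f : ℝ → ℂ} (hf : Measurable f) {C : ℝ} (hC : ∀ t, ‖f t‖ ≤ C)
    {A : Set ℝ} (hA : MeasurableSet A) (hA' : volume A ≠ ∞) :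
    MemLp (A.indicator f) 2 volume := by
  rw [memLp_indicator_iff_restrict hA]
  have : IsFiniteMeasure (volume.restrict A) := isFiniteMeasure_restrict.2 hA'
  exact MemLp.of_bound hf.aestronglyMeasurable C (.of_forall hC)

theorem memLp_comp_sub_left {p : ℝ → ℂ} (hp : Continuous p) (hps : HasCompactSupport p) (r : ℝ) :
    MemLp (fun s => p (r - s)) 2 volume :=
  (hp.comp (by fun_prop)).memLp_of_hasCompactSupport
    (hps.comp_homeomorph (Homeomorph.subLeft r))

/-- The factor by which the kernel `g (t - s)` is multiplied in `ξ ↦ f·(g * ξ) − χ·(g * (χ·ξ))`. -/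
noncomputable def cutoffDifference (f : ℝ → ℂ) (t s : ℝ) : ℂ :=
  f t - (Set.Ici (0 : ℝ)).indicator 1 t * (Set.Ici (0 : ℝ)).indicator 1 s

theorem norm_cutoffDifference_le {f : ℝ → ℂ} {C : ℝ} (hC : ∀ t, ‖f t‖ ≤ C) (t s : ℝ) :
    ‖cutoffDifference f t s‖ ≤ C + 1 := by
  refine (norm_sub_le _ _).trans (add_le_add (hC t) ?_)
  simp only [Set.indicator_apply]
  split_ifs <;> simp

theorem mul_cutoffDifference (f u : ℝ → ℂ) (t s : ℝ) :
    u s * cutoffDifference f t s = f t * u s -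
      (Set.Ici (0 : ℝ)).indicator 1 t * (Set.Ici (0 : ℝ)).indicator u s := by
  simp only [cutoffDifference, Set.indicator_apply, Pi.one_apply]
  split_ifs <;> ring

theorem integrable_mul_cutoffDifference (f : ℝ → ℂ) {u : ℝ → ℂ} (hu : Integrable u volume)
    (t : ℝ) : Integrable (fun s => u s * cutoffDifference f t s) volume := by
  simp only [mul_cutoffDifference]
  exact (hu.const_mul _).sub ((hu.indicator measurableSet_Ici).const_mul _)

theorem integral_mul_cutoffDifference (f : ℝ → ℂ) {u : ℝ → ℂ} (hu : Integrable u volume) (t : ℝ) :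
    ∫ s, u s * cutoffDifference f t s = f t * (∫ s, u s) -
      (Set.Ici (0 : ℝ)).indicator (fun _ => ∫ s, (Set.Ici (0 : ℝ)).indicator u s) t := by
  simp only [mul_cutoffDifference]
  rw [integral_sub (hu.const_mul _) ((hu.indicator measurableSet_Ici).const_mul _),
    integral_const_mul, integral_const_mul]
  congr 1
  simp only [Set.indicator_apply, Pi.one_apply]
  split_ifs <;> simp

theorem norm_kernel_sub_le {f g p : ℝ → ℂ} {C R N ε δ η : ℝ} (hC : ∀ t, ‖f t‖ ≤ C) (hC0 : 0 ≤ C)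
    (hR0 : 0 ≤ R) (hR : ∀ x, R < |x| → p x = 0) (hRN : R ≤ N) (hε : 0 ≤ ε) (hδ : 0 ≤ δ)
    (htop : ∀ t, N < t → ‖f t - 1‖ ≤ ε) (hbot : ∀ t, t < -N → ‖f t‖ ≤ ε)
    (hη0 : 0 < η) (hη1 : η ≤ 1) (hη : ∀ x y, |x - y| < η → ‖p x - p y‖ ≤ δ) (t s : ℝ) :
    ‖(g (t - s) - (Set.Icc (-N) N).indicator (fun r => p (⌊r / η⌋ * η - s)) t) *
        cutoffDifference f t s‖ ≤
      (C + 1) * ‖g (t - s) - p (t - s)‖ + ε * ‖p (t - s)‖ +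
        (Set.Icc (-(R + 1)) (R + 1)).indicator (fun _ => (C + 1) * δ) (t - s) := by
  have far : ‖((g (t - s) - p (t - s)) * cutoffDifference f t s)‖ ≤
      (C + 1) * ‖g (t - s) - p (t - s)‖ := by
    rw [norm_mul, mul_comm]
    gcongr
    exact norm_cutoffDifference_le hC t s
  have ind_nonneg : 0 ≤
      (Set.Icc (-(R + 1)) (R + 1)).indicator (fun _ => (C + 1) * δ) (t - s) :=
    Set.indicator_nonneg (fun _ _ => by positivity) _
  have tail_nonneg : 0 ≤ ε * ‖p (t - s)‖ := by positivity
  by_cases ht : t ∈ Set.Icc (-N) N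
  · rw [Set.indicator_of_mem ht]
    set r := ⌊t / η⌋ * η with hr
    have hr1 : r ≤ t := by
      have := Int.floor_le (t / η)
      rwa [le_div_iff₀ hη0] at this
    have hr2 : t < r + η := by
      have := Int.lt_floor_add_one (t / η)
      rw [div_lt_iff₀ hη0] at this
      linarith
    have near : ‖(p (t - s) - p (r - s)) * cutoffDifference f t s‖ ≤
        (Set.Icc (-(R + 1)) (R + 1)).indicator (fun _ => (C + 1) * δ) (t - s) := by
      by_cases hts : t - s ∈ Set.Icc (-(R + 1)) (R + 1)
      · rw [Set.indicator_of_mem hts, norm_mul, mul_comm]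
        gcongr
        · exact norm_cutoffDifference_le hC t s
        · refine hη _ _ ?_
          rw [abs_lt]
          constructor <;> linarith
      · rw [Set.indicator_of_notMem hts]
        have outside : R + 1 < |t - s| := by
          rw [← not_le, abs_le]
          exact hts
        have h1 : p (t - s) = 0 := hR _ (by linarith)
        have h2 : p (r - s) = 0 := by
          refine hR _ ?_
          rcases lt_abs.1 outside with h | h
          · exact lt_abs.2 (.inl (by linarith))
          · exact lt_abs.2 (.inr (by linarith))
        simp [h1, h2]
    calc _ = ‖(g (t - s) - p (t - s)) * cutoffDifference f t s +
          (p (t - s) - p (r - s)) * cutoffDifference f t s‖ := by ring_nf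
      _ ≤ _ := norm_add_le _ _
      _ ≤ _ := by linarith
  · rw [Set.indicator_of_notMem ht]
    have tail : ‖p (t - s) * cutoffDifference f t s‖ ≤ ε * ‖p (t - s)‖ := by
      by_cases hts : R < |t - s|
      · simp [hR _ hts]
      rw [norm_mul, mul_comm]
      gcongr
      have hts' := abs_le.1 (not_lt.1 hts)
      rcases lt_or_ge t (-N) with h | h
      · have : t ∉ Set.Ici (0 : ℝ) := by
          simp only [Set.mem_Ici, not_le]
          linarith
        simpa [cutoffDifference, this] using hbot t h
      · have hNt : N < t := by
          by_contra! h'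
          exact ht ⟨h, h'⟩
        have h1 : t ∈ Set.Ici (0 : ℝ) := Set.mem_Ici.2 (by linarith)
        have h2 : s ∈ Set.Ici (0 : ℝ) := Set.mem_Ici.2 (by linarith)
        rw [cutoffDifference, Set.indicator_of_mem h1, Set.indicator_of_mem h2]
        simpa using htop t hNt
    calc _ = ‖(g (t - s) - p (t - s)) * cutoffDifference f t s +
          p (t - s) * cutoffDifference f t s‖ := by ring_nf
      _ ≤ _ := norm_add_le _ _
      _ ≤ _ := by linarith

/-- The operator whose kernel is `p (r - s)`, cut off to `|t| ≤ N` and with `t` rounded down to the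
grid point `r`, is compact. -/
theorem exists_isCompactOperator_discretization {f p : ℝ → ℂ} (hf : Continuous f) {C : ℝ}
    (hC : ∀ t, ‖f t‖ ≤ C) (hp : Continuous p) (hps : HasCompactSupport p) (N : ℝ) {η : ℝ}
    (hη : 0 < η) :
    ∃ F : Lp ℂ 2 (volume : Measure ℝ) →L[ℂ] Lp ℂ 2 (volume : Measure ℝ), IsCompactOperator F ∧
      ∀ ξ, F ξ =ᵐ[volume] fun t => ∫ s,
        (Set.Icc (-N) N).indicator (fun r => p (⌊r / η⌋ * η - s)) t * ξ s *
          cutoffDifference f t s := by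
  let A : ℤ → Set ℝ := fun i => Set.Icc (-N) N ∩ {t | ⌊t / η⌋ = i}
  have hA (i : ℤ) : MeasurableSet (A i) :=
    measurableSet_Icc.inter (measurableSet_eq_fun (by fun_prop) measurable_const)
  have hA' (i : ℤ) : volume (A i) ≠ ∞ :=
    measure_ne_top_of_subset Set.inter_subset_left measure_Icc_lt_top.ne
  have hφ (i : ℤ) : MemLp (fun s => p (i * η - s)) 2 volume := memLp_comp_sub_left hp hps _
  obtain ⟨F₁, hF₁c, hF₁⟩ := exists_isCompactOperator_sum_mul_integral
    (Finset.Icc ⌊-N / η⌋ ⌊N / η⌋)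
    (fun i => memLp_indicator_of_bound hf.measurable hC (hA i) (hA' i)) hφ
  obtain ⟨F₂, hF₂c, hF₂⟩ := exists_isCompactOperator_sum_mul_integral
    (Finset.Icc ⌊-N / η⌋ ⌊N / η⌋)
    (fun i => memLp_indicator_of_bound (C := 1)
      ((measurable_const (a := (1 : ℂ))).indicator (measurableSet_Ici (a := (0 : ℝ))))
      (fun t => by
        simp only [Set.indicator_apply]
        split_ifs <;> simp) (hA i) (hA' i))
    (fun i => (hφ i).indicator (measurableSet_Ici (a := (0 : ℝ))))
  refine ⟨F₁ - F₂, hF₁c.sub hF₂c, fun ξ => ?_⟩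
  filter_upwards [Lp.coeFn_sub (F₁ ξ) (F₂ ξ), hF₁ ξ, hF₂ ξ] with t h h₁ h₂
  rw [sub_apply, h, Pi.sub_apply, h₁, h₂]
  by_cases ht : t ∈ Set.Icc (-N) N
  · have hfloor : ⌊t / η⌋ ∈ Finset.Icc ⌊-N / η⌋ ⌊N / η⌋ := by
      rw [Finset.mem_Icc]
      constructor <;> gcongr
      exacts [ht.1, ht.2]
    have mem : t ∈ A ⌊t / η⌋ := ⟨ht, rfl⟩
    have notMem (i : ℤ) (hi : i ≠ ⌊t / η⌋) : t ∉ A i := fun h => hi h.2.symm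
    rw [Finset.sum_eq_single_of_mem _ hfloor fun i _ hi => by
        rw [Set.indicator_of_notMem (notMem i hi), zero_mul],
      Finset.sum_eq_single_of_mem _ hfloor fun i _ hi => by
        rw [Set.indicator_of_notMem (notMem i hi), zero_mul],
      Set.indicator_of_mem mem, Set.indicator_of_mem mem]
    simp only [Set.indicator_of_mem ht]
    rw [integral_mul_cutoffDifference f (integrable_mul_Lp (hφ ⌊t / η⌋) ξ)]
    congr 1
    simp only [Set.indicator_apply]
    split_ifs <;> simp [ite_mul]
  · have notMem (i : ℤ) : t ∉ A i := fun h => ht h.1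
    simp [Set.indicator_of_notMem ht, Set.indicator_of_notMem (notMem _)]

theorem isCompactOperator_of_exists_norm_sub_le {E : Type*} [NormedAddCommGroup E]
    [NormedSpace ℂ E] [CompleteSpace E] {T : E →L[ℂ] E}
    (h : ∀ ε > 0, ∃ F : E →L[ℂ] E, IsCompactOperator F ∧ ‖T - F‖ ≤ ε) : IsCompactOperator T := by
  refine isClosed_setOfPred_isCompactOperator.closure_subset (Metric.mem_closure_iff.2 ?_)
  intro ε hε
  obtain ⟨F, hF, hle⟩ := h (ε / 2) (half_pos hε)
  exact ⟨F, hF, by rw [dist_eq_norm]; linarith⟩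

theorem isCompactOperator_of_stronglyMeasurable {f : ℝ → ℂ} (hf : Continuous f)
    (hftop : Filter.Tendsto f Filter.atTop (nhds 1))
    (hfbot : Filter.Tendsto f Filter.atBot (nhds 0))
    {g : ℝ → ℂ} (hgm : StronglyMeasurable g) (hg : Integrable g volume)
    {T : Lp ℂ 2 (volume : Measure ℝ) →L[ℂ] Lp ℂ 2 (volume : Measure ℝ)}
    (hT : ∀ ξ, ∀ᵐ t : ℝ, T ξ t = ∫ s, g (t - s) * ξ s * cutoffDifference f t s) :
    IsCompactOperator T := by
  refine isCompactOperator_of_exists_norm_sub_le fun ε hε => ?_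
  obtain ⟨C, hC0, hC⟩ := exists_bound_of_tendsto hf hftop hfbot
  obtain ⟨p, hps, hgp, hpc, hpi⟩ := hg.exists_hasCompactSupport_integral_sub_le
    (ε := ε / (3 * (C + 1))) (by positivity)
  obtain ⟨R, hR0, hR⟩ : ∃ R, 0 ≤ R ∧ ∀ x, R < |x| → p x = 0 := by
    obtain ⟨R, hR⟩ := hps.isCompact.isBounded.exists_norm_le
    refine ⟨max R 0, le_max_right _ _, fun x hx => image_eq_zero_of_notMem_tsupport fun h => ?_⟩
    exact absurd (hR x h) (not_le.2 ((le_max_left _ _).trans_lt hx))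
  set P := ∫ x, ‖p x‖ with hP
  have hP0 : 0 ≤ P := integral_nonneg fun _ => norm_nonneg _
  set τ := ε / (3 * (P + 1)) with hτ
  have hτ0 : 0 < τ := by positivity
  set δ := ε / (3 * ((C + 1) * (2 * (R + 1)))) with hδ
  have hδ0 : 0 < δ := by positivity
  obtain ⟨N₁, hN₁⟩ := Filter.eventually_atTop.1 (Metric.tendsto_nhds.1 hftop τ hτ0)
  obtain ⟨N₂, hN₂⟩ := Filter.eventually_atBot.1 (Metric.tendsto_nhds.1 hfbot τ hτ0)
  simp only [dist_eq_norm, sub_zero] at hN₁ hN₂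
  set N := max R (max N₁ (-N₂)) with hN
  have hNR : R ≤ N := le_max_left _ _
  have hNN₁ : N₁ ≤ N := (le_max_left _ _).trans (le_max_right _ _)
  have hNN₂ : -N₂ ≤ N := (le_max_right _ _).trans (le_max_right _ _)
  obtain ⟨η, hη0, hη1, hη⟩ : ∃ η, 0 < η ∧ η ≤ 1 ∧ ∀ x y, |x - y| < η → ‖p x - p y‖ ≤ δ := by
    obtain ⟨η, hη0, hη⟩ := Metric.uniformContinuous_iff.1
      (hps.uniformContinuous_of_continuous hpc) δ hδ0
    refine ⟨min η 1, by positivity, min_le_right _ _, fun x y hxy => ?_⟩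
    rw [← dist_eq_norm]
    exact (hη (hxy.trans_le (min_le_left _ _))).le
  obtain ⟨F, hFc, hF⟩ := exists_isCompactOperator_discretization hf hC hpc hps N hη0
  refine ⟨F, hFc, ?_⟩
  set h : ℝ → ℝ := fun x => (C + 1) * ‖g x - p x‖ + τ * ‖p x‖ +
    (Set.Icc (-(R + 1)) (R + 1)).indicator (fun _ => (C + 1) * δ) x with hh
  have int₁ : Integrable (fun x => (C + 1) * ‖g x - p x‖) volume := (hg.sub hpi).norm.const_mul _
  have int₂ : Integrable (fun x => τ * ‖p x‖) volume := hpi.norm.const_mul _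
  have int₃ : Integrable ((Set.Icc (-(R + 1)) (R + 1)).indicator fun _ => (C + 1) * δ) volume :=
    (integrable_indicator_iff measurableSet_Icc).2 (integrableOn_const measure_Icc_lt_top.ne)
  have hhm : Measurable h :=
    ((((hgm.measurable.sub hpc.measurable).norm).const_mul _).add
      (hpc.measurable.norm.const_mul _)).add (measurable_const.indicator measurableSet_Icc)
  have hpos (x : ℝ) : 0 ≤ h x :=
    add_nonneg (by positivity) (Set.indicator_nonneg (fun _ _ => by positivity) _)
  have hle : ∫ x, h x ≤ ε := by
    have e : ∫ x, h x = (C + 1) * (∫ x, ‖g x - p x‖) + τ * P + 2 * (R + 1) * ((C + 1) * δ) := by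
      rw [hh, integral_add (by exact int₁.add int₂) int₃, integral_add int₁ int₂, integral_const_mul,
        integral_const_mul, integral_indicator_const _ measurableSet_Icc, Real.volume_real_Icc,
        max_eq_left (by linarith), smul_eq_mul]
      ring
    have e₁ : (C + 1) * (∫ x, ‖g x - p x‖) ≤ ε / 3 :=
      (mul_le_mul_of_nonneg_left hgp (by positivity)).trans_eq (by field_simp)
    have e₂ : τ * P ≤ ε / 3 :=
      (mul_le_mul_of_nonneg_left (by linarith : P ≤ P + 1) hτ0.le).trans_eq (by
        rw [hτ]
        field_simp)
    have e₃ : 2 * (R + 1) * ((C + 1) * δ) = ε / 3 := by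
      rw [hδ]
      field_simp
    linarith
  refine ContinuousLinearMap.opNorm_le_bound _ hε.le fun ξ => ?_
  refine (norm_le_of_ae_eq_integral_mul hhm ((int₁.add int₂).add int₃) hpos _ ξ ?_).trans
    (by gcongr)
  filter_upwards [hT ξ, hF ξ, Lp.coeFn_sub (T ξ) (F ξ), ae_integrable_sub_mul hgm hg ξ]
    with t hTt hFt hsub hint
  refine ⟨_, norm_kernel_sub_le (g := g) hC hC0 hR0 hR hNR hτ0.le hδ0.le
    (fun t ht => (hN₁ t (by linarith)).le) (fun t ht => (hN₂ t (by linarith)).le)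
    hη0 hη1 hη t, ?_⟩
  rw [sub_apply, hsub, Pi.sub_apply, hTt, hFt, ← integral_sub]
  · exact integral_congr_ae (.of_forall fun s => by ring)
  · exact integrable_mul_cutoffDifference f hint t
  · refine integrable_mul_cutoffDifference f ?_ t
    by_cases ht : t ∈ Set.Icc (-N) N
    · simp only [Set.indicator_of_mem ht]
      exact integrable_mul_Lp (memLp_comp_sub_left hpc hps _) ξ
    · simp [Set.indicator_of_notMem ht]

/-- In the Wiener-Hopf algebra, `M(f)λ(g)` agrees with `M(χ)λ(g)M(χ)` modulo compact operators
whenever `f ∈ C₀(ℝ ∪ {+∞})` has `f(+∞) = 1`: the bounded operator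
`ξ ↦ f·(g * ξ) − χ·(g * (χ·ξ))` on `L²(ℝ)` is compact. -/
theorem statement14 (f : ℝ → ℂ) (hf : Continuous f)
    (hftop : Filter.Tendsto f Filter.atTop (nhds 1))
    (hfbot : Filter.Tendsto f Filter.atBot (nhds 0))
    (g : ℝ → ℂ) (hg : Integrable g volume)
    (T : Lp ℂ 2 (volume : Measure ℝ) →L[ℂ] Lp ℂ 2 (volume : Measure ℝ))
    (hT : ∀ ξ : Lp ℂ 2 (volume : Measure ℝ),
      (T ξ : ℝ → ℂ) =ᵐ[volume] fun t : ℝ =>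
        f t * (∫ s : ℝ, g (t - s) * ξ s) -
          (Set.Ici (0 : ℝ)).indicator
            (fun r => ∫ s : ℝ, g (r - s) * (Set.Ici (0 : ℝ)).indicator (fun a => ξ a) s) t) :
    IsCompactOperator T := by
  have hgm := hg.1.stronglyMeasurable_mk
  have hgi : Integrable (hg.1.mk g) volume := hg.congr hg.1.ae_eq_mk
  refine isCompactOperator_of_stronglyMeasurable hf hftop hfbot hgm hgi fun ξ => ?_
  filter_upwards [hT ξ, ae_integrable_sub_mul hgm hgi ξ] with t hTt hint
  have eq_mk : ∀ᵐ s, g (t - s) = hg.1.mk g (t - s) :=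
    (Measure.measurePreserving_sub_left volume t).quasiMeasurePreserving.ae hg.1.ae_eq_mk
  rw [hTt, integral_mul_cutoffDifference f hint]
  congr 1
  · congr 1
    exact integral_congr_ae (eq_mk.mono fun s hs => by simp only [hs])
  · by_cases ht : t ∈ Set.Ici (0 : ℝ)
    · rw [Set.indicator_of_mem ht, Set.indicator_of_mem ht]
      refine integral_congr_ae (eq_mk.mono fun s hs => ?_)
      simp only [Set.indicator_apply, hs, mul_ite, mul_zero]
    · rw [Set.indicator_of_notMem ht, Set.indicator_of_notMem ht]
end

section
/- For each integer n ∈ ℤ, define e_n : ℝ → ℂ by e_n(t) = (1/√π)·((t−i)/(t+i))^n·(1/(t+i)). Then the family (e_n)_{n ∈ ℤ} is an orthonormal basis of the Hilbert space L²(ℝ,ℂ): the e_n are pairwise orthogonal unit vectors whose closed linear span is all of L²(ℝ,ℂ). -/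
open MeasureTheory

open Filter Topology Complex

/-- An integrable function on `ℝ` is almost everywhere zero if its integrals against all Fourier
monomials, pulled back along a continuous injection into a circle, vanish. -/
lemma ae_eq_zero_of_integral_fourier_comp_mul_eq_zero {T : ℝ} [Fact (0 < T)]
    {φ : ℝ → AddCircle T} (hφ : Continuous φ) (hinj : Function.Injective φ)
    {h : ℝ → ℂ} (hh : Integrable h) (hzero : ∀ n : ℤ, ∫ t, fourier n (φ t) * h t = 0) :
    h =ᵐ[volume] 0 := by
  have hint (g : C(AddCircle T, ℂ)) : Integrable fun t ↦ g (φ t) * h t :=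
    hh.bdd_mul (g.continuous.comp hφ).aestronglyMeasurable
      (ae_of_all _ fun t ↦ g.norm_coe_le_norm (φ t))
  let L : C(AddCircle T, ℂ) →L[ℂ] ℂ := LinearMap.mkContinuous
    { toFun := fun g ↦ ∫ t, g (φ t) * h t
      map_add' := fun f g ↦ by
        simp only [ContinuousMap.add_apply, add_mul]
        exact integral_add (hint f) (hint g)
      map_smul' := fun c g ↦ by
        simp only [ContinuousMap.smul_apply, smul_eq_mul, mul_assoc, integral_const_mul,
          RingHom.id_apply] }
    (∫ t, ‖h t‖) fun g ↦ by
      rw [mul_comm, ← integral_const_mul]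
      refine norm_integral_le_of_norm_le (hh.norm.const_mul _) (ae_of_all _ fun t ↦ ?_)
      rw [norm_mul]
      gcongr
      exact g.norm_coe_le_norm (φ t)
  have hL : L = 0 := by
    refine ContinuousLinearMap.ext_on (s := Set.range (@fourier T)) ?_ ?_
    · exact Submodule.dense_iff_topologicalClosure_eq_top.2 span_fourier_closure_eq_top
    · rintro _ ⟨n, rfl⟩
      exact hzero n
  refine ae_eq_zero_of_forall_setIntegral_isCompact_eq_zero hh fun K hK ↦ ?_
  have hF : IsClosed (φ '' K) := (hK.image hφ).isClosed
  have hlim : Tendsto (fun k ↦ ∫ t, ((hF.apprSeq k (φ t) : ℝ) : ℂ) * h t) atTop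
      (𝓝 (∫ t, K.indicator h t)) := by
    refine tendsto_integral_of_dominated_convergence (fun t ↦ ‖h t‖) (fun k ↦ ?_) hh.norm
      (fun k ↦ ae_of_all _ fun t ↦ ?_) (ae_of_all _ fun t ↦ ?_)
    · refine AEStronglyMeasurable.mul (Continuous.aestronglyMeasurable ?_) hh.1
      fun_prop
    · rw [norm_mul]
      refine mul_le_of_le_one_left (norm_nonneg _) ?_
      simpa using HasOuterApproxClosed.apprSeq_apply_le_one hF k (φ t)
    · have hlim' := tendsto_pi_nhds.1 (HasOuterApproxClosed.tendsto_apprSeq hF) (φ t)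
      have hcont : Continuous fun x : NNReal ↦ ((x : ℝ) : ℂ) * h t := by fun_prop
      have hind : ((((φ '' K).indicator (fun _ ↦ (1 : NNReal)) (φ t) : NNReal) : ℝ) : ℂ) * h t =
          K.indicator h t := by
        by_cases ht : t ∈ K
        · simp [ht, Set.mem_image_of_mem φ ht]
        · simp [ht, hinj.mem_set_image.not.2 ht]
      exact hind ▸ (hcont.tendsto _).comp hlim'
  rw [← integral_indicator hK.measurableSet]
  refine tendsto_nhds_unique hlim (tendsto_const_nhds.congr fun k ↦ ?_)
  exact (DFunLike.congr_fun hL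
    (⟨fun x ↦ ((hF.apprSeq k x : ℝ) : ℂ), by fun_prop⟩ : C(AddCircle T, ℂ))).symm

lemma ofReal_add_I_ne_zero (t : ℝ) : (t : ℂ) + I ≠ 0 := fun h ↦ by
  simpa using congrArg Complex.im h

lemma ofReal_sub_I_ne_zero (t : ℝ) : (t : ℂ) - I ≠ 0 := fun h ↦ by
  simpa using congrArg Complex.im h

lemma ofReal_sub_I_mul_ofReal_add_I (t : ℝ) : ((t : ℂ) - I) * (t + I) = 1 + (t : ℂ) ^ 2 := by
  linear_combination -I_sq

lemma norm_ofReal_sub_I (t : ℝ) : ‖(t : ℂ) - I‖ = ‖(t : ℂ) + I‖ := by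
  rw [← Complex.norm_conj]
  simp

/-- The Cayley transform as a map from the real line to the unit circle. -/
noncomputable def cayleyTransform (t : ℝ) : Circle :=
  ⟨((t : ℂ) - I) / (t + I), mem_sphere_zero_iff_norm.2 <| by
    rw [norm_div, norm_ofReal_sub_I, div_self (norm_ne_zero_iff.2 (ofReal_add_I_ne_zero t))]⟩

lemma coe_cayleyTransform (t : ℝ) : (cayleyTransform t : ℂ) = ((t : ℂ) - I) / (t + I) := rfl

lemma continuous_cayleyTransform : Continuous cayleyTransform := by
  refine Continuous.subtype_mk (Continuous.div ?_ ?_ ofReal_add_I_ne_zero) _ <;> fun_prop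

lemma injective_cayleyTransform : Function.Injective cayleyTransform := fun s t h ↦ by
  have h' := congrArg (fun z : Circle ↦ (z : ℂ)) h
  simp only [coe_cayleyTransform] at h'
  rw [div_eq_div_iff (ofReal_add_I_ne_zero s) (ofReal_add_I_ne_zero t)] at h'
  have : 2 * I * ((s : ℂ) - t) = 0 := by linear_combination h'
  simpa [sub_eq_zero] using this

lemma tendsto_cayleyTransform_cobounded :
    Tendsto (fun t : ℝ ↦ (cayleyTransform t : ℂ)) (Bornology.cobounded ℝ) (𝓝 1) := by
  have hinv : Tendsto (fun t : ℝ ↦ ((t : ℂ) + I)⁻¹) (Bornology.cobounded ℝ) (𝓝 0) := by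
    refine tendsto_inv₀_cobounded.comp ?_
    rw [← tendsto_norm_atTop_iff_cobounded]
    refine tendsto_atTop_mono (fun t : ℝ ↦ ?_) tendsto_norm_cobounded_atTop
    simpa using Complex.abs_re_le_norm ((t : ℂ) + I)
  have h : Tendsto (fun t : ℝ ↦ 1 - 2 * I * ((t : ℂ) + I)⁻¹) (Bornology.cobounded ℝ) (𝓝 1) := by
    simpa using (hinv.const_mul (2 * I)).const_sub 1
  refine h.congr fun t ↦ ?_
  rw [coe_cayleyTransform]
  field_simp [ofReal_add_I_ne_zero t]
  ring

lemma hasDerivAt_cayleyTransform (t : ℝ) :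
    HasDerivAt (fun t : ℝ ↦ (cayleyTransform t : ℂ))
      (2 * I * cayleyTransform t * (1 + (t : ℂ) ^ 2)⁻¹) t := by
  have ht := ofReal_add_I_ne_zero t
  have ht' := ofReal_sub_I_ne_zero t
  refine (((Complex.ofRealCLM.hasDerivAt (x := t)).sub_const I).div
    ((Complex.ofRealCLM.hasDerivAt (x := t)).add_const I) ht).congr_deriv ?_
  rw [coe_cayleyTransform, ← ofReal_sub_I_mul_ofReal_add_I]
  simp only [Complex.ofRealCLM_apply, ofReal_one]
  field_simp
  ring

lemma hasDerivAt_cayleyTransform_zpow (k : ℤ) (t : ℝ) :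
    HasDerivAt (fun t : ℝ ↦ (cayleyTransform t : ℂ) ^ k)
      (2 * I * k * ((cayleyTransform t : ℂ) ^ k * (1 + (t : ℂ) ^ 2)⁻¹)) t := by
  have hne : (cayleyTransform t : ℂ) ≠ 0 := Circle.coe_ne_zero _
  refine ((hasDerivAt_zpow k _ (Or.inl hne)).comp t
    (hasDerivAt_cayleyTransform t)).congr_deriv ?_
  rw [zpow_sub_one₀ hne]
  field_simp

lemma integrable_cayleyTransform_zpow_mul (k : ℤ) :
    Integrable fun t : ℝ ↦ (cayleyTransform t : ℂ) ^ k * (1 + (t : ℂ) ^ 2)⁻¹ := by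
  have hint : Integrable fun t : ℝ ↦ (1 + (t : ℂ) ^ 2)⁻¹ := by
    simpa using integrable_inv_one_add_sq.ofReal (𝕜 := ℂ)
  refine hint.bdd_mul (c := 1) (Continuous.aestronglyMeasurable ?_) (ae_of_all _ fun t ↦ ?_)
  · exact (continuous_subtype_val.comp continuous_cayleyTransform).zpow₀ k
      fun t ↦ Or.inl (Circle.coe_ne_zero _)
  · rw [norm_zpow, Circle.norm_coe, one_zpow]

lemma integral_cayleyTransform_zpow_mul (k : ℤ) :
    ∫ t : ℝ, (cayleyTransform t : ℂ) ^ k * (1 + (t : ℂ) ^ 2)⁻¹ =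
      if k = 0 then (Real.pi : ℂ) else 0 := by
  split_ifs with hk
  · subst hk
    rw [← integral_univ_inv_one_add_sq, ← integral_complex_ofReal]
    simp
  · have hlim : Tendsto (fun t : ℝ ↦ (cayleyTransform t : ℂ) ^ k) (Bornology.cobounded ℝ)
        (𝓝 1) := by
      simpa using tendsto_cayleyTransform_cobounded.zpow₀ k (Or.inl one_ne_zero)
    have h := integral_of_hasDerivAt_of_tendsto (hasDerivAt_cayleyTransform_zpow k)
      ((integrable_cayleyTransform_zpow_mul k).const_mul _)
      (hlim.mono_left IsOrderBornology.atBot_le_cobounded)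
      (hlim.mono_left IsOrderBornology.atTop_le_cobounded)
    rw [integral_const_mul, sub_self] at h
    simpa [hk] using h

/-- The image of the `n`-th Fourier monomial under the unitarized Cayley transform. -/
noncomputable def cayleyFourier (n : ℤ) (t : ℝ) : ℂ :=
  ((1 / Real.sqrt Real.pi : ℝ) : ℂ) * (cayleyTransform t : ℂ) ^ n * (1 / ((t : ℂ) + I))

lemma conj_cayleyFourier (n : ℤ) (t : ℝ) :
    starRingEnd ℂ (cayleyFourier n t) =
      ((1 / Real.sqrt Real.pi : ℝ) : ℂ) * (cayleyTransform t : ℂ) ^ (-n) * (1 / ((t : ℂ) - I)) := by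
  have hconj : starRingEnd ℂ ((t : ℂ) + I) = t - I := by simp [sub_eq_add_neg]
  rw [cayleyFourier, map_mul, map_mul, map_zpow₀, ← Circle.coe_inv_eq_conj, conj_ofReal, map_div₀,
    hconj, map_one, Circle.coe_inv, inv_zpow']

lemma conj_cayleyFourier_mul (m n : ℤ) (t : ℝ) :
    starRingEnd ℂ (cayleyFourier m t) * cayleyFourier n t =
      (Real.pi : ℂ)⁻¹ * ((cayleyTransform t : ℂ) ^ (n - m) * (1 + (t : ℂ) ^ 2)⁻¹) := by
  have hpi : ((1 / Real.sqrt Real.pi : ℝ) : ℂ) * ((1 / Real.sqrt Real.pi : ℝ) : ℂ) =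
      (Real.pi : ℂ)⁻¹ := by
    rw [← ofReal_mul, ← ofReal_inv, one_div, ← mul_inv, Real.mul_self_sqrt Real.pi_pos.le]
  rw [conj_cayleyFourier, cayleyFourier, ← hpi, ← ofReal_sub_I_mul_ofReal_add_I, sub_eq_neg_add n m,
    zpow_add₀ (Circle.coe_ne_zero _), mul_inv]
  ring

lemma continuous_cayleyFourier (n : ℤ) : Continuous (cayleyFourier n) := by
  refine (continuous_const.mul ?_).mul (continuous_const.div (by fun_prop) ofReal_add_I_ne_zero)
  exact (continuous_subtype_val.comp continuous_cayleyTransform).zpow₀ n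
    fun t ↦ Or.inl (Circle.coe_ne_zero _)

lemma memLp_cayleyFourier (n : ℤ) : MemLp (cayleyFourier n) 2 volume := by
  rw [memLp_two_iff_integrable_sq_norm (continuous_cayleyFourier n).aestronglyMeasurable]
  have h := ((integrable_cayleyTransform_zpow_mul (n - n)).const_mul (Real.pi : ℂ)⁻¹).norm
  refine h.congr (ae_of_all _ fun t ↦ ?_)
  dsimp only
  rw [← conj_cayleyFourier_mul, norm_mul, Complex.norm_conj, sq]

lemma inner_toLp_cayleyFourier (n : ℤ) (f : Lp ℂ 2 (volume : Measure ℝ)) :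
    inner ℂ ((memLp_cayleyFourier n).toLp _) f =
      ∫ t, starRingEnd ℂ (cayleyFourier n t) * f t := by
  rw [L2.inner_def]
  refine integral_congr_ae ?_
  filter_upwards [(memLp_cayleyFourier n).coeFn_toLp] with t ht
  rw [ht, RCLike.inner_apply']

lemma orthonormal_toLp_cayleyFourier :
    Orthonormal ℂ fun n ↦ (memLp_cayleyFourier n).toLp (cayleyFourier n) := by
  rw [orthonormal_iff_ite]
  intro m n
  rw [inner_toLp_cayleyFourier]
  have h : ∫ t, starRingEnd ℂ (cayleyFourier m t) * (memLp_cayleyFourier n).toLp _ t =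
      ∫ t, (Real.pi : ℂ)⁻¹ * ((cayleyTransform t : ℂ) ^ (n - m) * (1 + (t : ℂ) ^ 2)⁻¹) := by
    refine integral_congr_ae ?_
    filter_upwards [(memLp_cayleyFourier n).coeFn_toLp] with t ht
    rw [ht, conj_cayleyFourier_mul]
  rw [h, integral_const_mul, integral_cayleyTransform_zpow_mul]
  simp [sub_eq_zero, eq_comm (a := n), Real.pi_ne_zero]

lemma eq_zero_of_forall_inner_toLp_cayleyFourier_eq_zero {f : Lp ℂ 2 (volume : Measure ℝ)}
    (hf : ∀ n, inner ℂ ((memLp_cayleyFourier n).toLp _) f = 0) : f = 0 := by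
  let e := AddCircle.homeomorphCircle (T := 1) one_ne_zero
  have hfourier (n : ℤ) (t : ℝ) :
      fourier n (e.symm (cayleyTransform t)) = (cayleyTransform t : ℂ) ^ n := by
    rw [fourier_apply, AddCircle.toCircle_zsmul, ← AddCircle.homeomorphCircle_apply one_ne_zero,
      e.apply_symm_apply, Circle.coe_zpow]
  have hint : Integrable fun t ↦ starRingEnd ℂ (cayleyFourier 0 t) * f t := by
    refine (L2.integrable_inner (𝕜 := ℂ) ((memLp_cayleyFourier 0).toLp _) f).congr ?_
    filter_upwards [(memLp_cayleyFourier 0).coeFn_toLp] with t ht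
    rw [ht, RCLike.inner_apply']
  have hae := ae_eq_zero_of_integral_fourier_comp_mul_eq_zero
    (e.symm.continuous.comp continuous_cayleyTransform)
    (e.symm.injective.comp injective_cayleyTransform) hint fun n ↦ by
      rw [← hf (-n), inner_toLp_cayleyFourier]
      refine integral_congr_ae (ae_of_all _ fun t ↦ ?_)
      simp only [Function.comp_apply, hfourier, conj_cayleyFourier, neg_neg, neg_zero, zpow_zero]
      ring
  rw [Lp.eq_zero_iff_ae_eq_zero]
  filter_upwards [hae] with t ht
  have hne : starRingEnd ℂ (cayleyFourier 0 t) ≠ 0 := by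
    simp [conj_cayleyFourier, ofReal_sub_I_ne_zero, Real.pi_pos.le]
  exact (mul_eq_zero.1 ht).resolve_left hne

/-- The functions `e_n(t) = (1/√π)·((t−i)/(t+i))^n·(1/(t+i))`, `n ∈ ℤ` — the image of the
standard Fourier basis of `L²(S¹)` under the unitarized Cayley transform — form an orthonormal
basis of `L²(ℝ, ℂ)`: they are orthonormal and their closed linear span is everything. -/
theorem statement16 :
    ∃ E : ℤ → Lp ℂ 2 (volume : Measure ℝ),
      (∀ n : ℤ, (E n : ℝ → ℂ) =ᵐ[volume] fun t : ℝ =>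
        ((1 / Real.sqrt Real.pi : ℝ) : ℂ) *
          (((t : ℂ) - Complex.I) / ((t : ℂ) + Complex.I)) ^ n *
          (1 / ((t : ℂ) + Complex.I))) ∧
      Orthonormal ℂ E ∧
      (Submodule.span ℂ (Set.range E)).topologicalClosure = ⊤ := by
  refine ⟨fun n ↦ (memLp_cayleyFourier n).toLp (cayleyFourier n),
    fun n ↦ (memLp_cayleyFourier n).coeFn_toLp, orthonormal_toLp_cayleyFourier, ?_⟩
  rw [Submodule.topologicalClosure_eq_top_iff, Submodule.eq_bot_iff]
  intro f hf
  refine eq_zero_of_forall_inner_toLp_cayleyFourier_eq_zero fun n ↦ ?_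
  exact (Submodule.mem_orthogonal _ _).1 hf _ (Submodule.subset_span ⟨n, rfl⟩)
end

section
/- Let k ≥ 1 be an integer. For every x₀ ∈ ℝ there exists a differentiable function y : ℝ → ℝ, defined on all of ℝ, satisfying y(0) = x₀ and y'(t) = (1 + y(t)²)^{−(k−1)/2}·(y(t))^k for all t ∈ ℝ. (The vector field X_k = (1+x²)^{−(k−1)/2}·x^k·d/dx on ℝ is complete.) -/
open Set Metric in
open scoped NNReal Manifold in
/-- A `C¹` vector field of at most linear growth on a proper normed space is complete. -/
theorem exists_forall_hasDerivAt_of_linear_growth {E : Type*} [NormedAddCommGroup E]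
    [NormedSpace ℝ E] [ProperSpace E] {f : E → E} (hf : ContDiff ℝ 1 f) {C : ℝ≥0}
    (hC : ∀ x, ‖f x‖ ≤ C * (1 + ‖x‖)) (x₀ : E) :
    ∃ y : ℝ → E, y 0 = x₀ ∧ ∀ t, HasDerivAt y (f (y t)) t := by
  have hT : (0 : ℝ) < 1 / (2 * C + 1) := by positivity
  set T : ℝ := 1 / (2 * C + 1) with hTdef
  have hCT : 2 * C * T ≤ 1 := by
    rw [hTdef, mul_one_div]
    exact div_le_one_of_le₀ (by linarith) (by positivity)
  have hloc : ∀ x : E, ∃ γ : ℝ → E, γ 0 = x ∧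
      IsMIntegralCurveOn (I := 𝓘(ℝ, E)) γ f (Ioo (-T) T) := by
    intro x
    obtain ⟨K, hK⟩ := hf.contDiffOn.exists_lipschitzOnWith (n := 1) one_ne_zero
      (convex_closedBall x (1 + ‖x‖)) (isCompact_closedBall x (1 + ‖x‖))
    have hb : ∀ z ∈ closedBall x ((1 + ‖x‖₊ : ℝ≥0) : ℝ),
        ‖f z‖ ≤ (2 * C * (1 + ‖x‖₊) : ℝ≥0) := by
      intro z hz
      have hz' : ‖z‖ ≤ ‖x‖ + (1 + ‖x‖) := by
        simpa using norm_le_of_mem_closedBall hz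
      refine (hC z).trans ?_
      push_cast
      nlinarith [C.coe_nonneg]
    have hPL : IsPicardLindelof (fun _ ↦ f) (⟨0, by constructor <;> linarith⟩ : Icc (-T) T) x
        (1 + ‖x‖₊) 0 (2 * C * (1 + ‖x‖₊)) K := by
      refine .of_time_independent hb (by simpa using hK) ?_
      push_cast
      simp only [sub_zero, zero_sub, neg_neg, max_self]
      nlinarith [norm_nonneg x]
    obtain ⟨γ, hγ0, hγ⟩ := hPL.exists_eq_forall_mem_Icc_hasDerivWithinAt₀
    refine ⟨γ, hγ0, fun t ht ↦ ?_⟩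
    exact ((hγ t (Ioo_subset_Icc_self ht)).mono Ioo_subset_Icc_self).hasFDerivWithinAt
      |>.hasMFDerivWithinAt
  obtain ⟨y, hy0, hy⟩ := exists_isMIntegralCurve_of_isMIntegralCurveOn (I := 𝓘(ℝ, E)) (v := f)
    (fun x ↦ contMDiffAt_vectorSpace_iff_contDiffAt.2 hf.contDiffAt) hT hloc x₀
  exact ⟨y, hy0, fun t ↦ hasDerivAt_iff_hasFDerivAt.2 (hasMFDerivAt_iff_hasFDerivAt.1 (hy t))⟩

/-- The field `(1 + x²)^(-(k-1)/2) x^k` is dominated by `|x|`. -/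
theorem abs_one_add_sq_rpow_mul_pow_le {k : ℕ} (hk : 1 ≤ k) (x : ℝ) :
    |(1 + x ^ 2) ^ (-(((k : ℝ) - 1) / 2)) * x ^ k| ≤ |x| := by
  obtain ⟨n, rfl⟩ := Nat.exists_eq_add_of_le' hk
  have hpos : (0 : ℝ) < 1 + x ^ 2 := by positivity
  have hle : |x| ^ n ≤ (1 + x ^ 2) ^ ((n : ℝ) / 2) := by
    calc |x| ^ n = (x ^ 2) ^ ((n : ℝ) / 2) := by
          rw [← sq_abs, ← Real.rpow_natCast_mul (abs_nonneg x), ← Real.rpow_natCast]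
          congr 1
          push_cast
          ring
      _ ≤ (1 + x ^ 2) ^ ((n : ℝ) / 2) := by gcongr; linarith
  push_cast
  rw [add_sub_cancel_right, Real.rpow_neg hpos.le, abs_mul, abs_inv,
    abs_of_pos (Real.rpow_pos_of_pos hpos _), abs_pow, pow_succ |x|, ← mul_assoc]
  refine mul_le_of_le_one_left (abs_nonneg x) ?_
  rw [inv_mul_le_one₀ (Real.rpow_pos_of_pos hpos _)]
  exact hle


/-- The vector field `X_k = (1+x²)^{−(k−1)/2}·x^k·d/dx` on `ℝ` is complete: every initial value
problem `y' = (1+y²)^{−(k−1)/2}·y^k`, `y(0) = x₀` has a global solution. -/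
theorem statement17 (k : ℕ) (hk : 1 ≤ k) :
    ∀ x₀ : ℝ, ∃ y : ℝ → ℝ, y 0 = x₀ ∧
      ∀ t : ℝ, HasDerivAt y ((1 + (y t) ^ 2) ^ (-(((k : ℝ) - 1) / 2)) * (y t) ^ k) t := by
  intro x₀
  refine exists_forall_hasDerivAt_of_linear_growth
    (f := fun x ↦ (1 + x ^ 2) ^ (-(((k : ℝ) - 1) / 2)) * x ^ k) (C := 1) ?_ (fun x ↦ ?_) x₀
  · exact ((contDiff_const.add (contDiff_id.pow 2)).rpow_const_of_ne
      fun x ↦ (by positivity : (0 : ℝ) < 1 + x ^ 2).ne').mul (contDiff_id.pow k)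
  · have h := abs_one_add_sq_rpow_mul_pow_le hk x
    simp only [Real.norm_eq_abs, NNReal.coe_one, one_mul]
    linarith
end
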